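/- arXiv:2409.06170 — 8 statements merged into one kernel-verified Lean document; each statement's English description precedes it below -/
import Mathlib

section
/- Let F, F′, and B be metric spaces with F′ locally compact and B locally connected. Let f : B × F → B × F′ be a continuous map that respects the projection onto the B factor, i.e. f(t,x) = (t, f_t(x)) for continuous maps f_t : F → F′, and assume each f_t is an open embedding. Then f is an open embedding. -/
open Topology Set

universe u v w

/-- Proposition 4.1: if `F′` is locally compact and `B` is locally connected, a continuous
map `B × F → B × F′` respecting the projection onto `B` whose slices are all open embeddings
is itself an open embedding. -/
theorem isOpenEmbedding_of_slices
    {B : Type u} {F : Type v} {F' : Type w}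
    [MetricSpace B] [MetricSpace F] [MetricSpace F']
    [LocallyCompactSpace F'] [LocallyConnectedSpace B]
    (f : B → F → F')
    (hcont : Continuous fun q : B × F => ((q.1, f q.1 q.2) : B × F'))
    (hemb : ∀ t, IsOpenEmbedding (f t)) :
    IsOpenEmbedding fun q : B × F => ((q.1, f q.1 q.2) : B × F') := by
  have hg : Continuous fun q : B × F => f q.1 q.2 := hcont.snd
  refine IsOpenEmbedding.of_continuous_injective_isOpenMap hcont ?_ ?_
  · rintro ⟨a, x⟩ ⟨b, y⟩ h
    simp only [Prod.mk.injEq] at h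
    obtain ⟨rfl, h⟩ := h
    rw [(hemb a).injective h]
  rw [isOpenMap_iff_nhds_le]
  rintro ⟨t0, x0⟩ s hs
  rw [Filter.mem_map, mem_nhds_prod_iff] at hs
  obtain ⟨W, hW, N, hN, hWN⟩ := hs
  haveI : LocallyCompactSpace F := (hemb t0).locallyCompactSpace
  obtain ⟨K, hK, hKN, hKc⟩ := local_compact_nhds hN
  have hD : IsCompact (K \ interior K) := hKc.diff isOpen_interior
  have h1 : ∀ᶠ p : B × F' in 𝓝 (t0, f t0 x0), ∀ x ∈ K \ interior K, f p.1 x ≠ p.2 := by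
    refine hD.eventually_forall_of_forall_eventually ?_
    intro x hx
    have hne : f t0 x ≠ f t0 x0 := by
      intro h
      have := (hemb t0).injective h
      subst this
      exact hx.2 (mem_interior_iff_mem_nhds.2 hK)
    have hc1 : Continuous fun z : (B × F') × F => f z.1.1 z.2 :=
      hg.comp (by fun_prop : Continuous fun z : (B × F') × F => (z.1.1, z.2))
    have hc2 : Continuous fun z : (B × F') × F => z.1.2 := by fun_prop
    exact (isOpen_ne_fun hc1 hc2).mem_nhds hne
  obtain ⟨V1, hV1, O, hO, hVO⟩ := mem_nhds_prod_iff.1 h1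
  have h2 : (fun q : B × F => f q.1 q.2) ⁻¹' O ∈ 𝓝 (t0, x0) :=
    hg.continuousAt.preimage_mem_nhds hO
  obtain ⟨V2, hV2, N', hN', hVN⟩ := mem_nhds_prod_iff.1 h2
  obtain ⟨V, hV, hVpre, hVsub⟩ := locallyConnectedSpace_iff_connected_subsets.1
    (inferInstance : LocallyConnectedSpace B) t0 _ (Filter.inter_mem (Filter.inter_mem hV1 hV2) hW)
  have hM : f t0 '' (N' ∩ interior K) ∈ 𝓝 (f t0 x0) :=
    (hemb t0).isOpenMap.image_mem_nhds (Filter.inter_mem hN' (interior_mem_nhds.2 hK))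
  refine Filter.mem_of_superset (prod_mem_nhds hV hM) ?_
  rintro ⟨t, y⟩ ⟨ht, x, ⟨hxN, hxK⟩, rfl⟩
  simp only at ht
  have hCpre : IsPreconnected ((fun r => f r x) '' V) :=
    hVpre.image _ (hg.comp (by fun_prop : Continuous fun r : B => (r, x))).continuousOn
  have hCO : (fun r => f r x) '' V ⊆ O := by
    rintro _ ⟨r, hr, rfl⟩
    exact hVN (show (r, x) ∈ V2 ×ˢ N' from ⟨(hVsub hr).1.2, hxN⟩)
  have hsub : (fun r => f r x) '' V ⊆ f t '' interior K := by
    refine hCpre.subset_left_of_subset_union (v := (f t '' K)ᶜ)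
      ((hemb t).isOpenMap _ isOpen_interior)
      (hKc.image (hemb t).continuous).isClosed.isOpen_compl ?_ ?_ ?_
    · exact disjoint_compl_right.mono_left (image_mono interior_subset)
    · intro z hz
      by_cases hzK : z ∈ f t '' K
      · obtain ⟨k, hk, rfl⟩ := hzK
        left
        refine ⟨k, ?_, rfl⟩
        by_contra hki
        exact hVO (show (t, f t k) ∈ V1 ×ˢ O from ⟨(hVsub ht).1.1, hCO hz⟩) k ⟨hk, hki⟩ rfl
      · exact Or.inr hzK
    · exact ⟨f t x, ⟨t, ht, rfl⟩, x, hxK, rfl⟩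
  obtain ⟨k, hk, hkx⟩ := hsub ⟨t0, mem_of_mem_nhds hV, rfl⟩
  have := hWN (show (t, k) ∈ W ×ˢ N from ⟨(hVsub ht).2, hKN (interior_subset hk)⟩)
  simp only [mem_preimage] at this
  simp only at hkx
  rwa [hkx] at this
end

section
/- Let B be a locally connected metric space, X a locally compact and locally connected metric space, and V a metric space. Let f_t : V → X (t ∈ B) be a family of open Lipschitz embeddings such that (t,x) ↦ (t, f_t(x)) is a Lipschitz isotopy B × V → B × X. Let C be a closed subset of V with compact boundary in V, and assume f_t(C) is closed in X for every t ∈ B. If the refined Lipschitz deformation principle L*(V − C) holds, then for each b ∈ B there exist a neighborhood N_b of b and a family of Lipschitz isomorphisms F_t : X → X (t ∈ N_b) such that (t,x) ↦ (t, F_t(x)) is a Lipschitz isotopy N_b × X → N_b × X and F_t ∘ f_b = f_t on a neighborhood of C; moreover, if C is compact, the F_t can be chosen so that in addition F_t ∘ f_b = f_b outside a compact neighborhood of C. -/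
open Topology Metric Set

universe u v w

section Defs

variable {X Y : Type*}

/-- A (local) Lipschitz embedding: `f` is injective, locally Lipschitz, and its inverse
`f ⁻¹ : f(X) → X` is locally Lipschitz. -/
def IsLipschitzEmbedding [MetricSpace X] [MetricSpace Y] (f : X → Y) : Prop :=
  Function.Injective f ∧ LocallyLipschitz f ∧
    ∃ g : Set.range f → X, Function.LeftInverse g (Set.rangeFactorization f) ∧ LocallyLipschitz g

/-- An open Lipschitz embedding: a Lipschitz embedding with open image. -/
def IsOpenLipschitzEmbedding [MetricSpace X] [MetricSpace Y] (f : X → Y) : Prop :=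
  IsLipschitzEmbedding f ∧ IsOpen (Set.range f)

/-- A Lipschitz isomorphism: a surjective Lipschitz embedding. -/
def IsLipschitzIso [MetricSpace X] [MetricSpace Y] (f : X → Y) : Prop :=
  IsLipschitzEmbedding f ∧ Function.Surjective f

/-- The inclusion of a subset, as a continuous map. -/
def inclCM [TopologicalSpace X] (U : Set X) : C(↥U, X) :=
  ⟨Subtype.val, continuous_subtype_val⟩

/-- The data of a deformation rule `h ↦ D h` for the principle `L(X; C; U)`:
the rule is continuous near the inclusion, sends the inclusion to the identity, and sends any
open Lipschitz embedding `h` in the neighbourhood `N` of the inclusion to a Lipschitz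
isomorphism of `X` agreeing with `h` on `C` and with the inclusion outside `U`. -/
def DeformationData [MetricSpace X] (U C : Set X) (N : Set C(↥U, X))
    (D : C(↥U, X) → C(X, X)) : Prop :=
  ContinuousOn D {h | h ∈ N ∧ IsOpenLipschitzEmbedding (⇑h : ↥U → X)} ∧
  D (inclCM U) = ContinuousMap.id X ∧
  ∀ h ∈ N, IsOpenLipschitzEmbedding (⇑h : ↥U → X) →
    IsLipschitzIso (⇑(D h) : X → X) ∧
    (∀ x : ↥U, (x : X) ∈ C → D h x = h x) ∧
    (∀ x : X, x ∉ U → D h x = x)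

/-- Sullivan's Lipschitz deformation principle `L(X)`. -/
def LipschitzDeformationPrinciple (X : Type v) [MetricSpace X] : Prop :=
  ∀ U : Set X, IsOpen U → ∀ C : Set X, IsCompact C → C ⊆ U →
    ∃ N ∈ 𝓝 (inclCM U), ∃ D : C(↥U, X) → C(X, X), DeformationData U C N D

end Defs

section Isotopy

/-- A Lipschitz isotopy: an open embedding between products of metric spaces which respects
the projection onto the first factor and is a Lipschitz isomorphism onto its image
(i.e. a Lipschitz embedding). -/
def IsLipschitzIsotopy {B X Y : Type*} [MetricSpace B] [MetricSpace X] [MetricSpace Y]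
    (F : B × X → B × Y) : Prop :=
  IsOpenEmbedding F ∧ (∀ q, (F q).1 = q.1) ∧ IsLipschitzEmbedding F

/-- The refined principle `L*(X)`: `L(X)` where the deformation rule additionally satisfies
property `(P)`: it turns Lipschitz isotopies into Lipschitz isotopies. -/
def LipschitzDeformationPrincipleStar (X : Type v) [MetricSpace X] : Prop :=
  ∀ U : Set X, IsOpen U → ∀ C : Set X, IsCompact C → C ⊆ U →
    ∃ N ∈ 𝓝 (inclCM U), ∃ D : C(↥U, X) → C(X, X), DeformationData U C N D ∧
      ∀ (B : Type u) [MetricSpace B] (h : B → C(↥U, X)),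
        (∀ t, h t ∈ N ∧ IsOpenLipschitzEmbedding (⇑(h t) : ↥U → X)) →
        IsLipschitzIsotopy (fun q : B × ↥U => (q.1, h q.1 q.2)) →
        IsLipschitzIsotopy (fun q : B × X => (q.1, D (h q.1) q.2))

end Isotopy

/-- Local bi-Lipschitz-and-open property at a point. -/
def LB {X Y : Type*} [MetricSpace X] [MetricSpace Y] (f : X → Y) (q : X) : Prop :=
  (∃ U ∈ 𝓝 q, ∃ K K' : NNReal, LipschitzOnWith K f U ∧
    ∀ x ∈ U, ∀ y ∈ U, edist x y ≤ K' * edist (f x) (f y)) ∧ 𝓝 (f q) ≤ Filter.map f (𝓝 q)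

section LBsec

variable {X Y Z : Type*} [MetricSpace X] [MetricSpace Y] [MetricSpace Z]

theorem LB.continuousAt {f : X → Y} {q : X} (h : LB f q) : ContinuousAt f q := by
  obtain ⟨⟨U, hU, K, K', h1, h2⟩, h3⟩ := h
  exact h1.continuousOn.continuousAt hU

theorem LB.map_nhds {f : X → Y} {q : X} (h : LB f q) : Filter.map f (𝓝 q) = 𝓝 (f q) :=
  le_antisymm h.continuousAt h.2

theorem LB.congr {f g : X → Y} {q : X} (h : LB f q) (hfg : f =ᶠ[𝓝 q] g) : LB g q := by
  obtain ⟨⟨U, hU, K, K', h1, h2⟩, h3⟩ := h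
  refine ⟨⟨U ∩ {x | f x = g x}, Filter.inter_mem hU hfg, K, K', ?_, ?_⟩, ?_⟩
  · intro x hx y hy
    rw [← show f x = g x from hx.2, ← show f y = g y from hy.2]
    exact h1 hx.1 hy.1
  · intro x hx y hy
    rw [← show f x = g x from hx.2, ← show f y = g y from hy.2]
    exact h2 x hx.1 y hy.1
  · rw [← hfg.eq_of_nhds, ← Filter.map_congr hfg]
    exact h3

theorem LB.comp {g : Y → Z} {f : X → Y} {q : X} (hg : LB g (f q)) (hf : LB f q) :
    LB (fun x => g (f x)) q := by
  have hc := hf.continuousAt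
  have hm := hf.map_nhds
  have hm' := hg.map_nhds
  obtain ⟨⟨U, hU, K, K', h1, h2⟩, h3⟩ := hf
  obtain ⟨⟨U', hU', L, L', h1', h2'⟩, h3'⟩ := hg
  refine ⟨⟨U ∩ f ⁻¹' U', Filter.inter_mem hU (hc hU'), L * K, K' * L', ?_, ?_⟩, ?_⟩
  · intro x hx y hy
    calc edist (g (f x)) (g (f y)) ≤ L * edist (f x) (f y) := h1' hx.2 hy.2
      _ ≤ L * (K * edist x y) := by gcongr; exact h1 hx.1 hy.1
      _ = _ := by push_cast; ring
  · intro x hx y hy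
    calc edist x y ≤ K' * edist (f x) (f y) := h2 x hx.1 y hy.1
      _ ≤ K' * (L' * edist (g (f x)) (g (f y))) := by gcongr; exact h2' _ hx.2 _ hy.2
      _ = _ := by push_cast; ring
  · change 𝓝 (g (f q)) ≤ Filter.map (g ∘ f) (𝓝 q)
    rw [← Filter.map_map, hm, hm']

theorem LB.cancel_left {G : Y → Z} {H : X → Y} {p : X} (hc : ContinuousAt H p)
    (hGH : LB (fun x => G (H x)) p) (hG : LB G (H p)) : LB H p := by
  have hGc := hG.continuousAt
  obtain ⟨⟨U, hU, K, K', h1, h2⟩, h3⟩ := hGH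
  obtain ⟨⟨U', hU', L, L', h1', h2'⟩, h3'⟩ := hG
  refine ⟨⟨U ∩ H ⁻¹' U', Filter.inter_mem hU (hc hU'), L' * K, K' * L, ?_, ?_⟩, ?_⟩
  · intro x hx y hy
    calc edist (H x) (H y) ≤ L' * edist (G (H x)) (G (H y)) := h2' _ hx.2 _ hy.2
      _ ≤ L' * (K * edist x y) := by gcongr; exact h1 hx.1 hy.1
      _ = _ := by push_cast; ring
  · intro x hx y hy
    calc edist x y ≤ K' * edist (G (H x)) (G (H y)) := h2 x hx.1 y hy.1
      _ ≤ K' * (L * edist (H x) (H y)) := by gcongr; exact h1' hx.2 hy.2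
      _ = _ := by push_cast; ring
  · rw [Filter.le_map_iff]
    intro A hA
    have hA' : A ∩ H ⁻¹' U' ∈ 𝓝 p := Filter.inter_mem hA (hc hU')
    have := Filter.le_map_iff.1 h3 _ hA'
    filter_upwards [hU', hGc this] with y hy hy'
    obtain ⟨a, ha, hay⟩ := hy'
    refine ⟨a, ha.1, ?_⟩
    have h := h2' _ ha.2 _ hy
    have hay : G (H a) = G y := hay
    rw [hay] at h
    simpa using h

theorem LB.cancel_right {G : Y → Z} {H : X → Y} {p : X} 
    (hGH : LB (fun x => G (H x)) p) (hH : LB H p) : LB G (H p) := by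
  have hm := hH.map_nhds
  have hm2 := hGH.map_nhds
  obtain ⟨⟨U, hU, K, K', h1, h2⟩, h3⟩ := hGH
  obtain ⟨⟨U', hU', L, L', h1', h2'⟩, h3'⟩ := hH
  refine ⟨⟨H '' (U ∩ U'), ?_, K * L', L * K', ?_, ?_⟩, ?_⟩
  · rw [← hm]; exact Filter.image_mem_map (Filter.inter_mem hU hU')
  · rintro _ ⟨x, hx, rfl⟩ _ ⟨y, hy, rfl⟩
    calc edist (G (H x)) (G (H y)) ≤ K * edist x y := h1 hx.1 hy.1
      _ ≤ K * (L' * edist (H x) (H y)) := by gcongr; exact h2' _ hx.2 _ hy.2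
      _ = _ := by push_cast; ring
  · rintro _ ⟨x, hx, rfl⟩ _ ⟨y, hy, rfl⟩
    calc edist (H x) (H y) ≤ L * edist x y := h1' hx.2 hy.2
      _ ≤ L * (K' * edist (G (H x)) (G (H y))) := by gcongr; exact h2 _ hx.1 _ hy.1
      _ = _ := by push_cast; ring
  · rw [← hm, Filter.map_map]
    exact hm2.ge

theorem LB.prodMap {W : Type*} [MetricSpace W] {g : X → Y} {k : Z → W} {x : X} {z : Z}
    (hg : LB g x) (hk : LB k z) : LB (fun q : X × Z => (g q.1, k q.2)) (x, z) := by
  have hm := hg.map_nhds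
  have hm2 := hk.map_nhds
  obtain ⟨⟨U, hU, K, K', h1, h2⟩, h3⟩ := hg
  obtain ⟨⟨U', hU', L, L', h1', h2'⟩, h3'⟩ := hk
  refine ⟨⟨U ×ˢ U', prod_mem_nhds hU hU', max K L, max K' L', ?_, ?_⟩, ?_⟩
  · rintro ⟨a, b⟩ ⟨ha, hb⟩ ⟨c, d⟩ ⟨hc, hd⟩
    simp only [Prod.edist_eq]
    refine max_le ((h1 ha hc).trans ?_) ((h1' hb hd).trans ?_)
    · gcongr
      · exact le_max_left _ _
      · exact le_max_left _ _
    · gcongr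
      · exact le_max_right _ _
      · exact le_max_right _ _
  · rintro ⟨a, b⟩ ⟨ha, hb⟩ ⟨c, d⟩ ⟨hc, hd⟩
    simp only [Prod.edist_eq]
    refine max_le ((h2 _ ha _ hc).trans ?_) ((h2' _ hb _ hd).trans ?_)
    · gcongr
      · exact le_max_left _ _
      · exact le_max_left _ _
    · gcongr
      · exact le_max_right _ _
      · exact le_max_right _ _
  · change 𝓝 (g x, k z) ≤ Filter.map (Prod.map g k) (𝓝 (x, z))
    rw [nhds_prod_eq, nhds_prod_eq, ← Filter.prod_map_map_eq', hm, hm2]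

theorem LB.id (x : X) : LB (fun y : X => y) x :=
  ⟨⟨univ, Filter.univ_mem, 1, 1, LipschitzWith.id.lipschitzOnWith, by simp⟩, by simp⟩

theorem LB.val {U : Set X} (hU : IsOpen U) (x : U) : LB (fun y : U => (y : X)) x :=
  ⟨⟨univ, Filter.univ_mem, 1, 1, (LipschitzWith.subtype_val U).lipschitzOnWith,
    by simp [Subtype.edist_eq]⟩,
    (hU.isOpenEmbedding_subtypeVal.map_nhds_eq x).ge⟩

theorem LB.of_emb {f : X → Y} (h1 : IsLipschitzEmbedding f) (h2 : IsOpen (range f)) (x : X) :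
    LB f x := by
  obtain ⟨hinj, hl, g, hg, hgl⟩ := h1
  obtain ⟨K, U, hU, hK⟩ := hl x
  obtain ⟨K', U', hU', hK'⟩ := hgl (rangeFactorization f x)
  have hcf : Continuous (rangeFactorization f) := by
    exact hl.continuous.subtype_mk _
  have hgc := hgl.continuous
  refine ⟨⟨U ∩ rangeFactorization f ⁻¹' U',
    Filter.inter_mem hU (hcf.continuousAt hU'), K, K', hK.mono inter_subset_left, ?_⟩, ?_⟩
  · intro x hx y hy
    have := hK' hx.2 hy.2
    rw [hg x, hg y] at this
    exact this
  · rw [Filter.le_map_iff]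
    intro A hA
    have h := hgc.continuousAt (x := rangeFactorization f x)
    rw [ContinuousAt, hg x] at h
    have h4 := h hA
    have h5 := Filter.image_mem_map (m := Subtype.val) h4
    rw [h2.isOpenEmbedding_subtypeVal.map_nhds_eq] at h5
    refine Filter.mem_of_superset h5 ?_
    rintro _ ⟨⟨_, z, rfl⟩, hz, rfl⟩
    have : g (rangeFactorization f z) ∈ A := hz
    rw [hg z] at this
    exact ⟨z, this, rfl⟩

theorem LB.to_emb {f : X → Y} (hinj : Function.Injective f) (h : ∀ x, LB f x) :
    IsOpenEmbedding f ∧ IsLipschitzEmbedding f := by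
  have hc : Continuous f := continuous_iff_continuousAt.2 fun x => (h x).continuousAt
  have ho : IsOpenMap f := IsOpenMap.of_nhds_le fun x => (h x).2
  refine ⟨.of_continuous_injective_isOpenMap hc hinj ho, hinj, ?_, ?_⟩
  · intro x
    obtain ⟨⟨U, hU, K, K', h1, h2⟩, h3⟩ := h x
    exact ⟨K, U, hU, h1⟩
  · refine ⟨fun y => y.2.choose, ?_, ?_⟩
    · intro x
      exact hinj (rangeFactorization f x).2.choose_spec
    · rintro ⟨_, x, rfl⟩
      obtain ⟨⟨U, hU, K, K', h1, h2⟩, h3⟩ := h x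
      refine ⟨K', Subtype.val ⁻¹' (f '' U), ?_, ?_⟩
      · exact continuous_subtype_val.continuousAt (Filter.le_map_iff.1 h3 _ hU)
      · rintro ⟨a, ha0⟩ ⟨a, ha, rfl⟩ ⟨c, hc0⟩ ⟨c, hc, rfl⟩
        have e1 : ha0.choose = a := hinj ha0.choose_spec
        have e2 : hc0.choose = c := hinj hc0.choose_spec
        change edist ha0.choose hc0.choose ≤ _
        rw [e1, e2]
        exact h2 _ ha _ hc

theorem LB.slice {g : Z → X → Y} {z : Z} {x : X}
    (h : LB (fun q : Z × X => (q.1, g q.1 q.2)) (z, x)) : LB (g z) x := by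
  obtain ⟨⟨U, hU, K, K', h1, h2⟩, h3⟩ := h
  have hcx : Continuous (fun x : X => (z, x)) := by fun_prop
  have hcy : Continuous (fun x : Y => (z, x)) := by fun_prop
  refine ⟨⟨(fun x : X => (z, x)) ⁻¹' U, hcx.continuousAt hU, K, K', ?_, ?_⟩, ?_⟩
  · intro a ha c hc
    have := h1 ha hc
    simpa [Prod.edist_eq] using this
  · intro a ha c hc
    have := h2 _ ha _ hc
    simpa [Prod.edist_eq] using this
  · rw [Filter.le_map_iff]
    intro A hA
    have h4 : (Prod.snd ⁻¹' A : Set (Z × X)) ∈ 𝓝 (z, x) := continuous_snd.continuousAt hA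
    have h5 := hcy.continuousAt (Filter.le_map_iff.1 h3 _ h4)
    refine Filter.mem_of_superset h5 ?_
    rintro y ⟨⟨z', a⟩, ha, hay⟩
    simp only [Prod.mk.injEq] at hay
    obtain ⟨rfl, rfl⟩ := hay
    exact ⟨a, ha, rfl⟩

theorem isotopy_of_LB {g : Z → X → Y} (hinj : ∀ z, Function.Injective (g z))
    (h : ∀ q : Z × X, LB (fun q : Z × X => (q.1, g q.1 q.2)) q) :
    IsLipschitzIsotopy (fun q : Z × X => (q.1, g q.1 q.2)) := by
  have : Function.Injective (fun q : Z × X => (q.1, g q.1 q.2)) := by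
    rintro ⟨a, b⟩ ⟨c, d⟩ hq
    simp only [Prod.mk.injEq] at hq
    obtain ⟨rfl, h2⟩ := hq
    rw [hinj a h2]
  obtain ⟨h1, h2⟩ := LB.to_emb this h
  exact ⟨h1, fun _ => rfl, h2⟩

end LBsec

/-- Traces of a compact set form a closed set. -/
theorem trace_compact_closed {B V X : Type*} [MetricSpace B] [MetricSpace V] [MetricSpace X]
    (f : B → V → X) (hf : Continuous (fun q : B × V => f q.1 q.2)) {K : Set V}
    (hK : IsCompact K) : IsClosed {q : B × X | q.2 ∈ f q.1 '' K} := by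
  have : CompactSpace K := isCompact_iff_compactSpace.1 hK
  have h1 : IsClosed {p : (B × X) × K | f p.1.1 p.2 = p.1.2} := by
    refine isClosed_eq ?_ (by fun_prop)
    exact hf.comp (f := fun p : (B × X) × K => (p.1.1, (p.2 : V))) (by fun_prop)
  have h2 := isClosedMap_fst_of_compactSpace (X := B × X) (Y := K) _ h1
  convert h2 using 1
  ext ⟨t, x⟩
  simp

theorem trace_closed {B V X : Type*} [MetricSpace B] [MetricSpace V] [MetricSpace X]
    [LocallyConnectedSpace B] [LocallyConnectedSpace X]
    (f : B → V → X) (hf : IsOpenEmbedding (fun q : B × V => (q.1, f q.1 q.2)))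
    (C : Set V) (hC : IsClosed C) (hbd : IsCompact (frontier C))
    (ho : ∀ t, IsOpenEmbedding (f t))
    (hCcl : ∀ t, IsClosed (f t '' C)) : IsClosed {q : B × X | q.2 ∈ f q.1 '' C} := by
  have hfc : Continuous (fun q : B × V => f q.1 q.2) := hf.continuous.snd
  have hFr := trace_compact_closed f hfc hbd
  set E := {q : B × X | q.2 ∈ f q.1 '' C} with hE
  -- dichotomy
  have dich : ∀ t, ∀ W : Set X, IsPreconnected W → (∀ w ∈ W, w ∉ f t '' frontier C) →
      ∀ x ∈ W, ∀ y ∈ W, x ∈ f t '' C → y ∈ f t '' C := by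
    intro t W hW hd x hx y hy hxC
    by_contra hyC
    have hint : IsOpen (f t '' interior C) := (ho t).isOpenMap _ isOpen_interior
    have := hW (f t '' interior C) (f t '' C)ᶜ hint (hCcl t).isOpen_compl ?_ ?_ ?_
    · obtain ⟨w, -, h1, h2⟩ := this
      exact h2 (image_mono interior_subset h1)
    · intro w hw
      by_cases hwC : w ∈ f t '' C
      · left
        obtain ⟨c, hc, rfl⟩ := hwC
        refine ⟨c, ?_, rfl⟩
        by_contra hci
        exact hd _ hw ⟨c, ⟨subset_closure hc, hci⟩, rfl⟩
      · exact Or.inr hwC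
    · refine ⟨x, hx, ?_⟩
      obtain ⟨c, hc, rfl⟩ := hxC
      refine ⟨c, ?_, rfl⟩
      by_contra hci
      exact hd _ hx ⟨c, ⟨subset_closure hc, hci⟩, rfl⟩
    · exact ⟨y, hy, hyC⟩
  have hEcl : ∀ t v, (t, f t v) ∈ closure E → v ∈ C := by
    intro t v h
    by_contra hv
    have hop : IsOpen ((fun q : B × V => (q.1, f q.1 q.2)) '' (univ ×ˢ Cᶜ)) :=
      hf.isOpenMap _ (isOpen_univ.prod hC.isOpen_compl)
    obtain ⟨⟨s, x⟩, ⟨⟨s', v'⟩, ⟨-, hv'⟩, heq⟩, c, hc, hcx⟩ :=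
      mem_closure_iff.1 h _ hop ⟨(t, v), ⟨mem_univ _, hv⟩, rfl⟩
    simp only [Prod.mk.injEq] at heq
    obtain ⟨rfl, rfl⟩ := heq
    have : c = v' := (ho s').injective hcx
    exact hv' (this ▸ hc)
  refine isClosed_of_closure_subset ?_
  rintro ⟨t₀, x₀⟩ hx₀
  by_contra hx₀C
  set Q : Set X := {x | (t₀, x) ∈ closure E ∧ x ∉ f t₀ '' C} with hQ
  have hQV : ∀ v, f t₀ v ∉ Q := fun v hv => hv.2 ⟨v, hEcl _ _ hv.1, rfl⟩
  have hQ' : Q = {x | (t₀, x) ∈ closure E} ∩ (range (f t₀))ᶜ := by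
    ext x
    constructor
    · intro h
      refine ⟨h.1, ?_⟩
      rintro ⟨v, rfl⟩
      exact hQV v h
    · rintro ⟨h1, h2⟩
      exact ⟨h1, fun h => h2 (image_subset_range _ _ h)⟩
  have hcx : Continuous (fun x : X => (t₀, x)) := by fun_prop
  have hQc : IsClosed Q := by
    rw [hQ']
    exact (isClosed_closure.preimage hcx).inter (ho t₀).isOpen_range.isClosed_compl
  have hQo : IsOpen Q := by
    rw [isOpen_iff_mem_nhds]
    intro x hx
    have hnf : (t₀, x) ∈ {q : B × X | q.2 ∈ f q.1 '' frontier C}ᶜ := by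
      intro h
      exact hx.2 (image_mono hC.frontier_subset h)
    have := hFr.isOpen_compl.mem_nhds hnf
    obtain ⟨T, hT, W', hW', hTW⟩ := mem_nhds_prod_iff.1 this
    obtain ⟨W, ⟨hWo, hxW, hWc⟩, hWW⟩ :=
      (locallyConnectedSpace_iff_hasBasis_isOpen_isConnected.1 inferInstance x).mem_iff.1 hW'
    refine Filter.mem_of_superset (hWo.mem_nhds hxW) ?_
    intro y hy
    refine ⟨?_, ?_⟩
    · rw [mem_closure_iff_nhds]
      intro A hA
      obtain ⟨T', hT', Y', hY', hTY⟩ := mem_nhds_prod_iff.1 hA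
      obtain ⟨⟨t, w⟩, ⟨⟨htT, htT'⟩, hw⟩, hwE⟩ := mem_closure_iff_nhds.1 hx.1 ((T ∩ T') ×ˢ W)
        (prod_mem_nhds (Filter.inter_mem hT hT') (hWo.mem_nhds hxW))
      refine ⟨(t, y), hTY ⟨htT', mem_of_mem_nhds hY'⟩, ?_⟩
      exact dich t W hWc.isPreconnected (fun w hw h => hTW (⟨htT, hWW hw⟩ : (t, w) ∈ T ×ˢ W') h)
        w hw y hy hwE
    · intro hyC
      exact hx.2 (dich t₀ W hWc.isPreconnected
        (fun w hw h => hTW (⟨mem_of_mem_nhds hT, hWW hw⟩ : (t₀, w) ∈ T ×ˢ W') h) y hy x hxW hyC)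
  obtain ⟨T, ⟨hTo, htT, hTc⟩, -⟩ :=
      (locallyConnectedSpace_iff_hasBasis_isOpen_isConnected.1 inferInstance t₀).mem_iff.1
        (Filter.univ_mem (f := 𝓝 t₀))
  obtain ⟨⟨t, x⟩, ⟨ht, hx⟩, c, hc, hcx⟩ := mem_closure_iff_nhds.1 hx₀ (T ×ˢ Q)
        (prod_mem_nhds (hTo.mem_nhds htT) (hQo.mem_nhds ⟨hx₀, hx₀C⟩))
  simp only at hcx hx ht
  have hcs : Continuous (fun s => f s c) :=
    hfc.comp (f := fun s : B => (s, c)) (by fun_prop)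
  have h1 : IsPreconnected ((fun s => f s c) '' T) := hTc.isPreconnected.image _ hcs.continuousOn
  have h2 := h1.subset_isClopen ⟨hQc, hQo⟩ ⟨x, ⟨t, ht, hcx⟩, hx⟩
  exact hQV c (h2 ⟨t₀, htT, rfl⟩)

/-- Gluing step: given the family `φ_t` and a global isotopy `G_t`. -/
theorem glue_step {T X V : Type*} [MetricSpace T] [PreconnectedSpace T] [MetricSpace X]
    [MetricSpace V] (b : T) (f : T → V → X)
    (hinj : ∀ t, Function.Injective (f t))
    (hf : ∀ q, LB (fun q : T × V => (q.1, f q.1 q.2)) q)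
    (M K : Set V) (hMcl : IsClosed {q : T × X | q.2 ∈ f q.1 '' M})
    (hMK : M ⊆ interior M ∪ interior K)
    (G : T → X → X) (hG : ∀ t, Function.Bijective (G t))
    (hGL : ∀ q, LB (fun q : T × X => (q.1, G q.1 q.2)) q)
    (hGb : ∀ x, G b x = x)
    (hGf : ∀ t, ∀ y ∈ K, G t (f b y) = f t y) :
    ∃ F : T → X → X, (∀ t, IsLipschitzIso (F t)) ∧
      IsLipschitzIsotopy (fun q : T × X => (q.1, F q.1 q.2)) ∧
      (∀ t, ∀ y ∈ M, F t (f b y) = f t y) ∧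
      (∀ t x, x ∉ f b '' M → F t x = G t x) := by
  classical
  have hfo : IsOpenMap (fun q : T × V => (q.1, f q.1 q.2)) :=
    IsOpenMap.of_nhds_le fun x => (hf x).2
  have hGo : IsOpenMap (fun q : T × X => (q.1, G q.1 q.2)) :=
    IsOpenMap.of_nhds_le fun x => (hGL x).2
  have slf : ∀ t, ∀ y, LB (f t) y := fun t y => LB.slice (hf (t, y))
  have hfto : IsOpenMap (f b) := IsOpenMap.of_nhds_le fun x => (slf b x).2
  -- openness along the parameter
  have opf : ∀ (A : Set V), IsOpen A → ∀ t₀, ∀ x ∈ f t₀ '' A, ∀ᶠ t in 𝓝 t₀, x ∈ f t '' A := by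
    rintro A hA t₀ _ ⟨y, hy, rfl⟩
    have h1 := hfo _ (isOpen_univ.prod hA)
    have h2 : Continuous (fun t : T => (t, f t₀ y)) := by fun_prop
    have h3 := (h1.preimage h2).mem_nhds (x := t₀) ⟨(t₀, y), ⟨mem_univ _, hy⟩, rfl⟩
    filter_upwards [h3]
    rintro t ⟨⟨t', y'⟩, ⟨-, hy'⟩, h⟩
    simp only [Prod.mk.injEq] at h
    obtain ⟨rfl, h⟩ := h
    exact ⟨y', hy', h⟩
  have opG : ∀ (A : Set X), IsOpen A → ∀ t₀, ∀ x ∈ G t₀ '' A, ∀ᶠ t in 𝓝 t₀, x ∈ G t '' A := by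
    rintro A hA t₀ _ ⟨y, hy, rfl⟩
    have h1 := hGo _ (isOpen_univ.prod hA)
    have h2 : Continuous (fun t : T => (t, G t₀ y)) := by fun_prop
    have h3 := (h1.preimage h2).mem_nhds (x := t₀) ⟨(t₀, y), ⟨mem_univ _, hy⟩, rfl⟩
    filter_upwards [h3]
    rintro t ⟨⟨t', y'⟩, ⟨-, hy'⟩, h⟩
    simp only [Prod.mk.injEq] at h
    obtain ⟨rfl, h⟩ := h
    exact ⟨y', hy', h⟩
  have hMbcl : IsClosed (f b '' M) := by
    have h2 : Continuous (fun x : X => (b, x)) := by fun_prop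
    exact hMcl.preimage h2
  -- the key set equality
  have key : ∀ t, ∀ x, x ∈ f t '' M ↔ x ∈ G t '' (f b '' M) := by
    intro t x
    let P : T → Prop := fun t => (x ∈ f t '' M ↔ x ∈ G t '' (f b '' M))
    have hP : IsLocallyConstant P := by
      rw [IsLocallyConstant.iff_eventually_eq]
      intro t₀
      by_cases hx : x ∈ f t₀ '' interior K
      · have hPt : ∀ t, x ∈ f t '' interior K → P t := by
          rintro t ⟨y, hy, rfl⟩
          change f t y ∈ f t '' M ↔ f t y ∈ G t '' (f b '' M)
          rw [(hinj t).mem_set_image, ← hGf t y (interior_subset hy),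
            (hG t).injective.mem_set_image, (hinj b).mem_set_image]
        filter_upwards [opf _ isOpen_interior t₀ x hx] with t ht
        exact propext (iff_of_true (hPt t ht) (hPt t₀ hx))
      · have h1 : ∀ᶠ t in 𝓝 t₀, (x ∈ f t '' M ↔ x ∈ f t₀ '' M) := by
          by_cases h : x ∈ f t₀ '' M
          · have h' : x ∈ f t₀ '' interior M := by
              obtain ⟨y, hy, rfl⟩ := h
              rcases hMK hy with h | h
              · exact ⟨y, h, rfl⟩
              · exact absurd ⟨y, h, rfl⟩ hx
            filter_upwards [opf _ isOpen_interior t₀ x h'] with t ht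
            exact iff_of_true (image_mono interior_subset ht) h
          · have h2 : Continuous (fun t : T => (t, x)) := by fun_prop
            filter_upwards [(hMcl.isOpen_compl.preimage h2).mem_nhds (x := t₀) h] with t ht
            exact iff_of_false ht h
        have h2 : ∀ᶠ t in 𝓝 t₀, (x ∈ G t '' (f b '' M) ↔ x ∈ G t₀ '' (f b '' M)) := by
          by_cases h : x ∈ G t₀ '' (f b '' M)
          · have h' : x ∈ G t₀ '' (f b '' interior M) := by
              obtain ⟨_, ⟨y, hy, rfl⟩, rfl⟩ := h
              rcases hMK hy with h | h
              · exact ⟨_, ⟨y, h, rfl⟩, rfl⟩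
              · exact absurd ⟨y, h, (hGf _ _ (interior_subset h)).symm⟩ hx
            filter_upwards [opG _ (hfto _ isOpen_interior) t₀ x h'] with t ht
            exact iff_of_true (image_mono (image_mono interior_subset) ht) h
          · have h' : x ∈ G t₀ '' (f b '' M)ᶜ := by
              rw [image_compl_eq (hG t₀)]; exact h
            filter_upwards [opG _ hMbcl.isOpen_compl t₀ x h'] with t ht
            rw [image_compl_eq (hG t)] at ht
            exact iff_of_false ht h
        filter_upwards [h1, h2] with t h1 h2
        exact propext (iff_congr h1 h2)
    have hPb : P b := by
      have : G b '' (f b '' M) = f b '' M := by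
        rw [show G b = id from funext hGb, image_id]
      change x ∈ f b '' M ↔ x ∈ G b '' (f b '' M)
      rw [this]
    have := hP.apply_eq_of_isPreconnected isPreconnected_univ (mem_univ b) (mem_univ t)
    exact this.mp hPb
  let F : T → X → X := fun t x => if h : ∃ y ∈ M, f b y = x then f t h.choose else G t x
  have F1 : ∀ t, ∀ y ∈ M, F t (f b y) = f t y := by
    intro t y hy
    have h : ∃ y' ∈ M, f b y' = f b y := ⟨y, hy, rfl⟩
    simp only [F, dif_pos h]
    rw [hinj b h.choose_spec.2]
  have F2 : ∀ t x, x ∉ f b '' M → F t x = G t x := by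
    intro t x hx
    exact dif_neg hx
  have F3 : ∀ t, ∀ y ∈ K, F t (f b y) = f t y := by
    intro t y hy
    by_cases h : y ∈ M
    · exact F1 t y h
    · rw [F2, hGf t y hy]
      rwa [(hinj b).mem_set_image]
  have Finj : ∀ t, Function.Injective (F t) := by
    intro t
    have mixed : ∀ y ∈ M, ∀ x', x' ∉ f b '' M → f t y ≠ G t x' := by
      intro y hy x' hx' h
      have := (key t _).1 ⟨y, hy, h⟩
      rw [(hG t).injective.mem_set_image] at this
      exact hx' this
    intro x x' h
    by_cases hx : x ∈ f b '' M <;> by_cases hx' : x' ∈ f b '' M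
    · obtain ⟨y, hy, rfl⟩ := hx
      obtain ⟨y', hy', rfl⟩ := hx'
      rw [F1 _ _ hy, F1 _ _ hy'] at h
      rw [hinj t h]
    · obtain ⟨y, hy, rfl⟩ := hx
      rw [F1 _ _ hy, F2 _ _ hx'] at h
      exact absurd h (mixed y hy _ hx')
    · obtain ⟨y, hy, rfl⟩ := hx'
      rw [F1 _ _ hy, F2 _ _ hx] at h
      exact absurd h.symm (mixed y hy _ hx)
    · rw [F2 _ _ hx, F2 _ _ hx'] at h
      exact (hG t).injective h
  have Fsurj : ∀ t, Function.Surjective (F t) := by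
    intro t x
    obtain ⟨x', rfl⟩ := (hG t).surjective x
    by_cases hx : x' ∈ f b '' M
    · obtain ⟨y, hy, h⟩ := (key t _).2 ⟨x', hx, rfl⟩
      exact ⟨f b y, by rw [F1 _ _ hy, h]⟩
    · exact ⟨x', F2 _ _ hx⟩
  have FL : ∀ q, LB (fun q : T × X => (q.1, F q.1 q.2)) q := by
    rintro ⟨t, x⟩
    by_cases hx : x ∈ f b '' (interior M ∪ interior K)
    · obtain ⟨y, hy, rfl⟩ := hx
      refine LB.cancel_right (G := fun q : T × X => (q.1, F q.1 q.2))
        (H := fun q : T × V => (q.1, f b q.2)) (p := (t, y)) ?_ ((LB.id t).prodMap (slf b y))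
      refine (hf (t, y)).congr ?_
      have ho : IsOpen (interior M ∪ interior K) := isOpen_interior.union isOpen_interior
      filter_upwards [(isOpen_univ.prod ho).mem_nhds (x := (t, y)) ⟨mem_univ _, hy⟩]
      rintro ⟨s, z⟩ ⟨-, hz⟩
      rcases hz with hz | hz
      · simp only [F1 s z (interior_subset hz)]
      · simp only [F3 s z (interior_subset hz)]
    · have hx' : x ∉ f b '' M := fun h => hx (image_mono hMK h)
      refine (hGL (t, x)).congr ?_
      filter_upwards [(isOpen_univ.prod hMbcl.isOpen_compl).mem_nhds (x := (t, x))
        ⟨mem_univ _, hx'⟩]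
      rintro ⟨s, z⟩ ⟨-, hz⟩
      simp only [F2 s z hz]
  refine ⟨F, fun t => ⟨(LB.to_emb (Finj t) fun x => LB.slice (FL (t, x))).2, Fsurj t⟩,
    isotopy_of_LB Finj FL, F1, F2⟩

/-- Extension of a family on an open piece by the identity. -/
theorem extend_step {T X Y : Type*} [MetricSpace T] [MetricSpace X]
    [MetricSpace Y] (e : Y → X) (he : Function.Injective e) (heL : ∀ y, LB e y)
    (D : T → Y → Y) (hD : ∀ t, Function.Bijective (D t))
    (hDL : ∀ q, LB (fun q : T × Y => (q.1, D q.1 q.2)) q)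
    (K : Set Y) (hK : IsCompact K) (hDK : ∀ t, ∀ y ∉ K, D t y = y) :
    ∃ G : T → X → X, (∀ t, Function.Bijective (G t)) ∧
      (∀ q, LB (fun q : T × X => (q.1, G q.1 q.2)) q) ∧
      (∀ t y, G t (e y) = e (D t y)) ∧ (∀ t, ∀ x ∉ e '' K, G t x = x) := by
  classical
  have hec : Continuous e := continuous_iff_continuousAt.2 fun x => (heL x).continuousAt
  let G : T → X → X := fun t x => if h : ∃ y, e y = x then e (D t h.choose) else x
  have G1 : ∀ t y, G t (e y) = e (D t y) := by
    intro t y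
    have h : ∃ y', e y' = e y := ⟨y, rfl⟩
    simp only [G, dif_pos h]
    rw [he h.choose_spec]
  have G2 : ∀ t x, x ∉ range e → G t x = x := fun t x hx => dif_neg hx
  have G3 : ∀ t, ∀ x ∉ e '' K, G t x = x := by
    intro t x hx
    by_cases h : x ∈ range e
    · obtain ⟨y, rfl⟩ := h
      rw [G1, hDK]
      exact fun hy => hx ⟨y, hy, rfl⟩
    · exact G2 t x h
  refine ⟨G, ?_, ?_, G1, G3⟩
  · intro t
    constructor
    · intro x x' h
      by_cases hx : x ∈ range e <;> by_cases hx' : x' ∈ range e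
      · obtain ⟨y, rfl⟩ := hx
        obtain ⟨y', rfl⟩ := hx'
        rw [G1, G1] at h
        rw [(hD t).injective (he h)]
      · obtain ⟨y, rfl⟩ := hx
        rw [G1, G2 _ _ hx'] at h
        exact absurd ⟨_, h⟩ hx'
      · obtain ⟨y, rfl⟩ := hx'
        rw [G1, G2 _ _ hx] at h
        exact absurd ⟨_, h.symm⟩ hx
      · rwa [G2 _ _ hx, G2 _ _ hx'] at h
    · intro x
      by_cases hx : x ∈ range e
      · obtain ⟨y, rfl⟩ := hx
        obtain ⟨z, rfl⟩ := (hD t).surjective y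
        exact ⟨e z, G1 t z⟩
      · exact ⟨x, G2 t x hx⟩
  · rintro ⟨t, x⟩
    by_cases hx : x ∈ e '' K
    · obtain ⟨y, hy, rfl⟩ := hx
      refine LB.cancel_right (G := fun q : T × X => (q.1, G q.1 q.2))
        (H := fun q : T × Y => (q.1, e q.2)) (p := (t, y)) ?_ ((LB.id t).prodMap (heL y))
      have := LB.comp (g := fun q : T × Y => (q.1, e q.2))
        (f := fun q : T × Y => (q.1, D q.1 q.2)) (q := (t, y))
        ((LB.id t).prodMap (heL (D t y))) (hDL (t, y))
      simpa only [G1] using this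
    · refine (LB.id (t, x)).congr ?_
      have hcl : IsClosed (e '' K) := (hK.image hec).isClosed
      filter_upwards [(isOpen_univ.prod hcl.isOpen_compl).mem_nhds (x := (t, x))
        ⟨mem_univ _, hx⟩]
      rintro ⟨s, z⟩ ⟨-, hz⟩
      simp only [G3 s z hz]

/-- **Strengthened Lipschitz isotopy extension theorem** (Corollary 3.3).  Let `B` be a
locally connected metric space, `X` locally compact and locally connected, and let
`f t : V → X` (`t ∈ B`) be a family of open Lipschitz embeddings inducing a Lipschitz isotopy.
Let `C ⊆ V` be closed with compact boundary and `f t '' C` closed for all `t`.  If `L*(V − C)`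
holds, then for each `b ∈ B` there are a neighbourhood `N` of `b` and a family of Lipschitz
isomorphisms `F t : X → X` (`t ∈ N`) inducing a Lipschitz isotopy, with `F t ∘ f b = f t` near
`C`; moreover if `C` is compact the `F t` may be chosen so that in addition `F t ∘ f b = f b`
away from a compact neighbourhood of `C`. -/
theorem lipschitz_isotopy_extension_star
    {B : Type u} {X : Type u} {V : Type u}
    [MetricSpace B] [LocallyConnectedSpace B]
    [MetricSpace X] [LocallyCompactSpace X] [LocallyConnectedSpace X]
    [MetricSpace V]
    (f : B → V → X)
    (hemb : ∀ t, IsOpenLipschitzEmbedding (f t))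
    (hiso : IsLipschitzIsotopy (fun q : B × V => (q.1, f q.1 q.2)))
    (C : Set V) (hC : IsClosed C) (hbd : IsCompact (frontier C))
    (hCcl : ∀ t, IsClosed (f t '' C))
    (hL : LipschitzDeformationPrincipleStar.{u} ↥(Cᶜ)) :
    ∀ b : B,
      (∃ N ∈ 𝓝 b, ∃ F : ↥N → X → X,
        (∀ t, IsLipschitzIso (F t)) ∧
        IsLipschitzIsotopy (fun q : ↥N × X => (q.1, F q.1 q.2)) ∧
        (∃ W, IsOpen W ∧ C ⊆ W ∧ ∀ t : ↥N, ∀ x ∈ W, F t (f b x) = f (t : B) x)) ∧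
      (IsCompact C →
        ∃ N ∈ 𝓝 b, ∃ F : ↥N → X → X,
          (∀ t, IsLipschitzIso (F t)) ∧
          IsLipschitzIsotopy (fun q : ↥N × X => (q.1, F q.1 q.2)) ∧
          (∃ W, IsOpen W ∧ C ⊆ W ∧ ∀ t : ↥N, ∀ x ∈ W, F t (f b x) = f (t : B) x) ∧
          (∃ K : Set V, IsCompact K ∧ C ⊆ interior K ∧
            ∀ t : ↥N, ∀ x ∉ K, F t (f b x) = f b x)) := by
  intro b
  suffices hS : ∃ N ∈ 𝓝 b, ∃ F : ↥N → X → X,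
        (∀ t, IsLipschitzIso (F t)) ∧
        IsLipschitzIsotopy (fun q : ↥N × X => (q.1, F q.1 q.2)) ∧
        (∃ W, IsOpen W ∧ C ⊆ W ∧ ∀ t : ↥N, ∀ x ∈ W, F t (f b x) = f (t : B) x) ∧
        (IsCompact C → (∃ K : Set V, IsCompact K ∧ C ⊆ interior K ∧
            ∀ t : ↥N, ∀ x ∉ K, F t (f b x) = f b x)) by
    obtain ⟨N, hN, F, h1, h2, h3, h4⟩ := hS
    exact ⟨⟨N, hN, F, h1, h2, h3⟩, fun hc => ⟨N, hN, F, h1, h2, h3, h4 hc⟩⟩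
  have hΦ : ∀ q, LB (fun q : B × V => (q.1, f q.1 q.2)) q :=
    LB.of_emb hiso.2.2 hiso.1.isOpen_range
  have slf : ∀ t, ∀ y, LB (f t) y := fun t y => LB.slice (hΦ (t, y))
  have hinj : ∀ t, Function.Injective (f t) := fun t => (hemb t).1.1
  have ho : ∀ t, IsOpenEmbedding (f t) := fun t => (LB.to_emb (hinj t) (slf t)).1
  have hfc : Continuous (fun q : B × V => f q.1 q.2) := hiso.1.continuous.snd
  have : LocallyCompactSpace V := (ho b).locallyCompactSpace
  -- the compact sets
  obtain ⟨K1, hK1, hK1b⟩ := exists_compact_superset hbd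
  set M := C ∪ K1 with hM
  have hCM : C ⊆ interior M := by
    intro x hx
    by_cases h : x ∈ interior C
    · exact interior_mono subset_union_left h
    · exact interior_mono subset_union_right (hK1b ⟨subset_closure hx, h⟩)
  have hMcl0 : IsClosed M := hC.union hK1.isClosed
  have hSsub : frontier M ⊆ K1 ∩ Cᶜ := by
    intro x hx
    rw [hMcl0.frontier_eq] at hx
    have hxC : x ∉ C := fun h => hx.2 (hCM h)
    exact ⟨hx.1.resolve_left hxC, hxC⟩
  have hS : IsCompact (frontier M) :=
    hK1.of_isClosed_subset isClosed_frontier (hSsub.trans inter_subset_left)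
  obtain ⟨K3, hK3, hSK3, hK3C⟩ := exists_compact_between hS hC.isOpen_compl
    (hSsub.trans inter_subset_right)
  obtain ⟨K4, hK4, hK34, hK4C⟩ := exists_compact_between hK3 hC.isOpen_compl hK3C
  have hcpt : ∀ K : Set V, IsCompact K → K ⊆ Cᶜ → IsCompact (Subtype.val ⁻¹' K : Set ↥(Cᶜ)) := by
    intro K hK hKC
    rw [Subtype.isCompact_iff, Subtype.image_preimage_coe, inter_eq_self_of_subset_right hKC]
    exact hK
  let U : Set ↥(Cᶜ) := Subtype.val ⁻¹' interior K4
  have hU : IsOpen U := isOpen_interior.preimage continuous_subtype_val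
  let e : ↥(Cᶜ) → X := fun y => f b y
  have heL : ∀ y, LB e y := fun y => LB.comp (slf b y) (LB.val hC.isOpen_compl y)
  have heinj : Function.Injective e := (hinj b).comp Subtype.val_injective
  have heo : IsOpenEmbedding e := (LB.to_emb heinj heL).1
  obtain ⟨N0, hN0, D, ⟨-, Did, Dprop⟩, DP⟩ := hL U hU (Subtype.val ⁻¹' K3) (hcpt K3 hK3 hK3C)
    (preimage_mono hK34)
  -- first neighbourhood
  have hopen : IsOpen {q : B × V | f q.1 q.2 ∈ f b '' Cᶜ} :=
    ((ho b).isOpenMap _ hC.isOpen_compl).preimage hfc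
  obtain ⟨N1, v, hN1, hv, hbN1, hKv, hN1v⟩ := generalized_tube_lemma (isCompact_singleton (x := b))
    hK4 hopen (by
      rintro ⟨t, y⟩ ⟨ht, hy⟩
      rw [mem_singleton_iff] at ht
      simp only at ht hy
      subst ht
      exact ⟨y, hK4C hy, rfl⟩)
  have hbN1 : b ∈ N1 := hbN1 rfl
  have hex : ∀ q : ↥N1 × ↥U, ∃ y : ↥(Cᶜ), e y = f q.1 q.2 := by
    rintro ⟨⟨t, ht⟩, ⟨⟨y, hy⟩, hyU⟩⟩
    obtain ⟨z, hz, h⟩ := hN1v (⟨ht, hKv (interior_subset hyU)⟩ : (t, y) ∈ N1 ×ˢ v)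
    exact ⟨⟨z, hz⟩, h⟩
  choose H hH using hex
  have hHc : Continuous H := by
    rw [heo.isInducing.continuous_iff]
    have : e ∘ H = fun q : ↥N1 × ↥U => f q.1 q.2 := funext hH
    rw [this]
    exact hfc.comp (f := fun q : ↥N1 × ↥U => ((q.1 : B), ((q.2 : ↥(Cᶜ)) : V))) (by fun_prop)
  let Hc : C(↥N1 × ↥U, ↥(Cᶜ)) := ⟨H, hHc⟩
  have hHb : Hc.curry ⟨b, hbN1⟩ = inclCM U := by
    ext1 u
    exact heinj (hH (⟨b, hbN1⟩, u))
  have hpre : Hc.curry ⁻¹' N0 ∈ 𝓝 (⟨b, hbN1⟩ : ↥N1) := by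
    apply Hc.curry.continuous.continuousAt
    rw [hHb]; exact hN0
  have hN2 : Subtype.val '' (Hc.curry ⁻¹' N0) ∈ 𝓝 b := by
    have := Filter.image_mem_map (m := Subtype.val) hpre
    rwa [hN1.isOpenEmbedding_subtypeVal.map_nhds_eq] at this
  obtain ⟨N, ⟨hNo, hbN, hNc⟩, hNN⟩ :=
      (locallyConnectedSpace_iff_hasBasis_isOpen_isConnected.1 inferInstance b).mem_iff.1 hN2
  have hNN1 : ∀ t : ↥N, (t : B) ∈ N1 := by
    intro t
    obtain ⟨s, -, hs⟩ := hNN t.2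
    exact hs ▸ s.2
  let h : ↥N → C(↥U, ↥(Cᶜ)) := fun t => Hc.curry ⟨t, hNN1 t⟩
  have hhN0 : ∀ t, h t ∈ N0 := by
    intro t
    obtain ⟨s, hs, hst⟩ := hNN t.2
    have : (⟨t, hNN1 t⟩ : ↥N1) = s := Subtype.ext hst.symm
    simp only [h, this]
    exact hs
  have heh : ∀ t u, e (h t u) = f t u := fun t u => hH (⟨t, hNN1 t⟩, u)
  have hpc : PreconnectedSpace ↥N := Subtype.preconnectedSpace hNc.isPreconnected
  -- restricted isotopy
  have hΦN : ∀ q, LB (fun q : ↥N × V => (q.1, f q.1 q.2)) q := by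
    rintro ⟨t, y⟩
    refine LB.cancel_left (G := fun q : ↥N × X => ((q.1 : B), q.2)) ?_ ?_
      ((LB.val hNo t).prodMap (LB.id _))
    · refine Continuous.continuousAt ?_
      refine continuous_fst.prodMk ?_
      exact hfc.comp (f := fun q : ↥N × V => ((q.1 : B), q.2)) (by fun_prop)
    · exact LB.comp (g := fun q : B × V => (q.1, f q.1 q.2))
        (f := fun q : ↥N × V => ((q.1 : B), q.2)) (q := (t, y)) (hΦ _)
        ((LB.val hNo t).prodMap (LB.id y))
  have hhL : ∀ q, LB (fun q : ↥N × ↥U => (q.1, h q.1 q.2)) q := by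
    rintro ⟨t, u⟩
    refine LB.cancel_left (G := fun q : ↥N × ↥(Cᶜ) => (q.1, e q.2)) ?_ ?_
      ((LB.id t).prodMap (heL _))
    · refine Continuous.continuousAt ?_
      refine continuous_fst.prodMk ?_
      exact hHc.comp (f := fun q : ↥N × ↥U => ((⟨q.1, hNN1 q.1⟩ : ↥N1), q.2)) (by fun_prop)
    · simp only [heh]
      exact LB.comp (g := fun q : ↥N × V => (q.1, f q.1 q.2))
        (f := fun q : ↥N × ↥U => (q.1, ((q.2 : ↥(Cᶜ)) : V))) (q := (t, u)) (hΦN _)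
        ((LB.id t).prodMap (LB.comp (LB.val hC.isOpen_compl _) (LB.val hU u)))
  have hhinj : ∀ t, Function.Injective (h t) := by
    intro t u u' huu
    have := congrArg e huu
    rw [heh, heh] at this
    exact Subtype.ext (Subtype.ext (hinj t this))
  have hhe : ∀ t, IsOpenLipschitzEmbedding (h t) := by
    intro t
    obtain ⟨h1, h2⟩ := LB.to_emb (hhinj t) fun u => LB.slice (g := fun t => h t) (hhL (t, u))
    exact ⟨h2, h1.isOpen_range⟩
  have hDiso := DP ↥N h (fun t => ⟨hhN0 t, hhe t⟩)
    (isotopy_of_LB (g := fun t => h t) hhinj hhL)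
  have hDK : ∀ t, ∀ y ∉ (Subtype.val ⁻¹' K4 : Set ↥(Cᶜ)), D (h t) y = y := fun t y hy =>
    (Dprop _ (hhN0 t) (hhe t)).2.2 y fun hyU => hy (interior_subset (s := K4) hyU)
  obtain ⟨G, Gbij, hGLB, G1, G2⟩ := extend_step e heinj heL (fun t y => D (h t) y)
    (fun t => ⟨(Dprop _ (hhN0 t) (hhe t)).1.1.1, (Dprop _ (hhN0 t) (hhe t)).1.2⟩)
    (LB.of_emb hDiso.2.2 hDiso.1.isOpen_range) _ (hcpt K4 hK4 hK4C) hDK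
  have hMcl : IsClosed {q : ↥N × X | q.2 ∈ f q.1 '' M} := by
    have h1 := trace_closed f hiso.1 C hC hbd ho hCcl
    have h2 := trace_compact_closed f hfc hK1
    have h3 : Continuous (fun q : ↥N × X => ((q.1 : B), q.2)) := by fun_prop
    convert (h1.union h2).preimage h3 using 1
    ext q
    simp only [hM, image_union]
    rfl
  have hMK : M ⊆ interior M ∪ interior K3 := by
    intro x hx
    by_cases hxi : x ∈ interior M
    · exact Or.inl hxi
    · exact Or.inr (hSK3 ⟨subset_closure hx, hxi⟩)
  obtain ⟨F, F1, F2, F3, F4⟩ := glue_step (⟨b, hbN⟩ : ↥N) (fun t => f t) (fun t => hinj t) hΦN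
    M K3 hMcl hMK G Gbij hGLB (by
      intro x
      by_cases hx : x ∈ range e
      · obtain ⟨y, rfl⟩ := hx
        rw [G1]
        have : h ⟨b, hbN⟩ = inclCM U := hHb
        simp only [this, Did]
        rfl
      · exact G2 _ _ fun hx' => hx (image_subset_range _ _ hx')) (by
      intro t y hy
      have hyU : (⟨y, hK3C hy⟩ : ↥(Cᶜ)) ∈ U := hK34 hy
      have h1 := G1 t ⟨y, hK3C hy⟩
      have h2 := (Dprop _ (hhN0 t) (hhe t)).2.1 ⟨⟨y, hK3C hy⟩, hyU⟩ hy
      simp only at h1 h2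
      rw [h2, heh] at h1
      exact h1)
  refine ⟨N, hNo.mem_nhds hbN, F, F1, F2, ⟨interior M, isOpen_interior, hCM, ?_⟩, ?_⟩
  · intro t x hx
    exact F3 t x (interior_subset hx)
  · intro hCc
    refine ⟨M ∪ K4, (hCc.union hK1).union hK4, hCM.trans (interior_mono subset_union_left), ?_⟩
    intro t x hx
    rw [F4 t (f b x) (by
      change f b x ∉ f b '' M
      rw [(hinj b).mem_set_image]
      exact fun h => hx (Or.inl h))]
    apply G2
    rintro ⟨y, hy, hyx⟩
    have : (y : V) = x := hinj b hyx
    exact hx (Or.inr (this ▸ hy))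
end

section
/- Let F and B be metric spaces with F locally compact and locally connected and such that the refined Lipschitz deformation principle L*(F) holds, and let p : F × B → B be the projection. Fix b ∈ B and identify F with p⁻¹(b) = F × {b}. Let U be an open subset of F with compact closure, let C be a compact subset of U, let N be a neighborhood of b, and let f : U × N → F × B be a Lipschitz product chart about U for p. Then there exist a neighborhood N′ of b and a Lipschitz product chart g : F × N′ → F × B about F for p such that g = f on a neighborhood of C × {b} and g = identity outside K × N′ for some compact neighborhood K of C. -/
open Topology Metric Set

universe u v

section ProjChart

/-- A Lipschitz product chart about `U` for the projection `p : F × B → B`, under the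
identification of `F` with the fiber `p ⁻¹ b = F × {b}`. -/
def IsProjProductChart {F B : Type*} [MetricSpace F] [MetricSpace B]
    (b : B) (U : Set F) (N : Set B) (f : ↥U × ↥N → F × B) : Prop :=
  b ∈ N ∧ IsOpenLipschitzEmbedding f ∧
    (∀ z : ↥U × ↥N, (f z).2 = (z.2 : B)) ∧
    (∀ (u : ↥U) (hb : b ∈ N), f (u, ⟨b, hb⟩) = ((u : F), b))

end ProjChart


section Helpers
variable {X Y Z : Type*} [MetricSpace X] [MetricSpace Y] [MetricSpace Z]

theorem IsLipschitzEmbedding.comp' {f : Y → Z} {a : X → Y}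
    (hf : IsLipschitzEmbedding f) (ha : IsLipschitzEmbedding a) :
    IsLipschitzEmbedding (f ∘ a) := by
  obtain ⟨hfi, hfl, g, hg, hgl⟩ := hf
  obtain ⟨hai, hal, k, hk, hkl⟩ := ha
  refine ⟨hfi.comp hai, hfl.comp hal, ?_⟩
  have hmem : ∀ z : Set.range (f ∘ a), (z : Z) ∈ Set.range f := by
    rintro ⟨_, x, rfl⟩; exact ⟨a x, rfl⟩
  have hgf : ∀ (y : Y) (h : f y ∈ Set.range f), g ⟨f y, h⟩ = y := fun y h => hg y
  have hmem2 : ∀ z : Set.range (f ∘ a), g ⟨z, hmem z⟩ ∈ Set.range a := by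
    rintro ⟨_, x, rfl⟩; exact ⟨x, (hgf (a x) _).symm⟩
  refine ⟨fun z => k ⟨g ⟨z, hmem z⟩, hmem2 z⟩, ?_, ?_⟩
  · intro x
    have : (⟨g ⟨_, hmem (Set.rangeFactorization (f ∘ a) x)⟩, hmem2 _⟩ : Set.range a)
        = Set.rangeFactorization a x := Subtype.ext (hgf (a x) _)
    show k _ = x
    rw [this]; exact hk x
  · have h1 : LocallyLipschitz (fun z : Set.range (f ∘ a) =>
        (⟨z, hmem z⟩ : Set.range f)) :=
      LipschitzWith.locallyLipschitz (K := 1) (LipschitzWith.of_edist_le fun x y => le_rfl)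
    have h2 := hgl.comp h1
    have h3 : LocallyLipschitz (fun z : Set.range (f ∘ a) =>
        (⟨g ⟨z, hmem z⟩, hmem2 z⟩ : Set.range a)) := by
      intro x
      obtain ⟨K, t, ht, hK⟩ := h2 x
      exact ⟨K, t, ht, fun p hp q hq => hK hp hq⟩
    exact hkl.comp h3

theorem IsLipschitzEmbedding.of_comp' {f : X → Y} {c : Y → Z}
    (h : IsLipschitzEmbedding (c ∘ f)) (hc : LocallyLipschitz c) (hf : LocallyLipschitz f) :
    IsLipschitzEmbedding f := by
  obtain ⟨hi, hl, g, hg, hgl⟩ := h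
  refine ⟨hi.of_comp, hf, ?_⟩
  have hmem : ∀ z : Set.range f, c z ∈ Set.range (c ∘ f) := by
    rintro ⟨_, x, rfl⟩; exact ⟨x, rfl⟩
  refine ⟨fun z => g ⟨c z, hmem z⟩, fun x => hg x, hgl.comp ?_⟩
  have h2 := hc.comp (LipschitzWith.subtype_val (Set.range f)).locallyLipschitz
  intro x
  obtain ⟨K, t, ht, hK⟩ := h2 x
  exact ⟨K, t, ht, fun p hp q hq => hK hp hq⟩

theorem isLipschitzEmbedding_of_isometry {f : X → Y} (hf : Isometry f) :
    IsLipschitzEmbedding f := by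
  refine ⟨hf.injective, hf.lipschitz.locallyLipschitz, ?_⟩
  refine ⟨fun z => z.2.choose, fun x => hf.injective (Exists.choose_spec (⟨x, rfl⟩ : f x ∈ Set.range f)), ?_⟩
  refine LipschitzWith.locallyLipschitz (K := 1) (LipschitzWith.of_edist_le fun x y => ?_)
  rw [← hf.edist_eq, x.2.choose_spec, y.2.choose_spec]
  exact le_rfl

theorem IsLipschitzEmbedding.isEmbedding' {f : X → Y} (hf : IsLipschitzEmbedding f) :
    IsEmbedding f := by
  obtain ⟨hi, hl, g, hg, hgl⟩ := hf
  have hgc := hgl.continuous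
  have h1 : IsEmbedding (Set.rangeFactorization f) :=
    IsEmbedding.of_leftInverse hg hgc (hl.continuous.subtype_mk _)
  exact IsEmbedding.subtypeVal.comp h1

end Helpers

/-- Lemma 4.5: extension of product charts for a projection.  Let `F` be locally compact and
locally connected with `L*(F)` and let `p : F × B → B` be the projection.  Let `U ⊆ F` be open
with compact closure, `C ⊆ U` compact, and `f : U × N → F × B` a Lipschitz product chart about
`U` for `p`.  Then there are a neighbourhood `N'` of `b` and a Lipschitz product chart
`g : F × N' → F × B` about `F` for `p` with `g = f` near `C × {b}` and `g = id` outside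
`K × N'` for some compact neighbourhood `K` of `C`. -/
theorem proj_product_chart_extension
    {F B : Type u} [MetricSpace F] [MetricSpace B]
    [LocallyCompactSpace F] [LocallyConnectedSpace F]
    (hL : LipschitzDeformationPrincipleStar.{u} F)
    (b : B) (U : Set F) (hU : IsOpen U) (hUc : IsCompact (closure U))
    (C : Set F) (hC : IsCompact C) (hCU : C ⊆ U)
    (N : Set B) (hN : N ∈ 𝓝 b) (f : ↥U × ↥N → F × B)
    (hf : IsProjProductChart b U N f) :
    ∃ N' ∈ 𝓝 b, ∃ g : F × ↥N' → F × B,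
      (IsOpenLipschitzEmbedding g ∧
        (∀ z : F × ↥N', (g z).2 = (z.2 : B)) ∧
        (∀ (u : F) (hb : b ∈ N'), g (u, ⟨b, hb⟩) = (u, b))) ∧
      (∃ W : Set F, IsOpen W ∧ C ⊆ W ∧ ∃ (hWU : W ⊆ U),
        ∃ M ∈ 𝓝 b, ∃ (hMN : M ⊆ N) (hMN' : M ⊆ N'),
          ∀ x (hx : x ∈ W), ∀ t (ht : t ∈ M),
            g (x, ⟨t, hMN' ht⟩) = f (⟨x, hWU hx⟩, ⟨t, hMN ht⟩)) ∧
      (∃ K : Set F, IsCompact K ∧ C ⊆ interior K ∧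
        ∀ x ∉ K, ∀ t : ↥N', g (x, t) = (x, (t : B))) := by
  obtain ⟨hbN, ⟨hfe, hfo⟩, hf2, hfb⟩ := hf
  obtain ⟨C', hC', hCC', hC'U⟩ := exists_compact_between hC hU hCU
  obtain ⟨𝒩, h𝒩, D, ⟨-, hDid, hD⟩, hP⟩ := hL U hU C' hC' hC'U
  have hfl := hfe.2.1
  have hfc : Continuous f := hfl.continuous
  let H : C(↥N, C(↥U, F)) := ContinuousMap.curry
    ⟨fun q : ↥N × ↥U => (f (q.2, q.1)).1, by fun_prop⟩
  have hH : ∀ t u, H t u = (f (u, t)).1 := fun t u => rfl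
  have hHb : H ⟨b, hbN⟩ = inclCM U := by
    ext u
    rw [hH, hfb]; rfl
  have hpre : H ⁻¹' 𝒩 ∈ 𝓝 (⟨b, hbN⟩ : ↥N) := by
    apply H.continuous.continuousAt
    rw [hHb]; exact h𝒩
  have himg : Subtype.val '' (H ⁻¹' 𝒩) ∈ 𝓝 b := by
    rw [← map_nhds_subtype_coe_eq_nhds hbN hN]
    exact Filter.image_mem_map hpre
  obtain ⟨N', hN'sub, hN'o, hbN'⟩ := _root_.mem_nhds_iff.1 himg
  have hN'N : N' ⊆ N := fun t ht => by
    obtain ⟨s, -, rfl⟩ := hN'sub ht; exact s.2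
  let j : ↥N' → ↥N := Set.inclusion hN'N
  have hj : ∀ t, H (j t) ∈ 𝒩 := by
    intro t
    obtain ⟨s, hs, hst⟩ := hN'sub t.2
    have : j t = s := Subtype.ext hst.symm
    rw [this]; exact hs
  have hjiso : Isometry j := fun x y => rfl
  -- each slice is an open Lipschitz embedding
  have hslice : ∀ t : ↥N, IsOpenLipschitzEmbedding (⇑(H t) : ↥U → F) := by
    intro t
    have ha : Isometry (fun u : ↥U => (u, t)) := by
      intro x y; simp [Prod.edist_eq]
    have hcI : Isometry (fun x : F => (x, (t : B))) := by
      intro x y; simp [Prod.edist_eq]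
    have hcomp : (fun x : F => (x, (t : B))) ∘ (⇑(H t)) = f ∘ (fun u : ↥U => (u, t)) := by
      funext u
      exact Prod.ext rfl (hf2 (u, t)).symm
    refine ⟨?_, ?_⟩
    · refine IsLipschitzEmbedding.of_comp' (c := fun x : F => (x, (t : B))) ?_
        hcI.lipschitz.locallyLipschitz ?_
      · rw [hcomp]; exact hfe.comp' (isLipschitzEmbedding_of_isometry ha)
      · exact LipschitzWith.prod_fst.locallyLipschitz.comp
          (hfl.comp ha.lipschitz.locallyLipschitz)
    · have : Set.range (⇑(H t)) = (fun x : F => (x, (t : B))) ⁻¹' Set.range f := by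
        ext x
        constructor
        · rintro ⟨u, rfl⟩
          exact ⟨(u, t), (congrFun hcomp u).symm⟩
        · rintro ⟨⟨u, s⟩, hus⟩
          have h2 := hf2 (u, s)
          rw [hus] at h2
          have : s = t := Subtype.ext h2.symm
          subst this
          exact ⟨u, by rw [hH, hus]⟩
      rw [this]
      exact hfo.preimage hcI.continuous
  have hcI : Isometry (fun q : ↥N' × F => (q.2, (q.1 : B))) := by
    intro x y; simp [Prod.edist_eq, max_comm, Subtype.edist_eq]
  have hIso : IsLipschitzIsotopy (fun q : ↥N' × ↥U => (q.1, H (j q.1) q.2)) := by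
    have ha : Isometry (fun q : ↥N' × ↥U => (q.2, j q.1)) := by
      intro x y; simp [Prod.edist_eq, max_comm, hjiso.edist_eq]
    have hcomp : (fun q : ↥N' × F => (q.2, (q.1 : B))) ∘
        (fun q : ↥N' × ↥U => (q.1, H (j q.1) q.2)) = f ∘ (fun q : ↥N' × ↥U => (q.2, j q.1)) := by
      funext q
      exact Prod.ext rfl (hf2 (q.2, j q.1)).symm
    have hemb : IsLipschitzEmbedding (fun q : ↥N' × ↥U => (q.1, H (j q.1) q.2)) := by
      refine IsLipschitzEmbedding.of_comp' (c := fun q : ↥N' × F => (q.2, (q.1 : B))) ?_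
        hcI.lipschitz.locallyLipschitz ?_
      · rw [hcomp]; exact hfe.comp' (isLipschitzEmbedding_of_isometry ha)
      · exact LipschitzWith.prod_fst.locallyLipschitz.prodMk
          (LipschitzWith.prod_fst.locallyLipschitz.comp
            (hfl.comp ha.lipschitz.locallyLipschitz))
    refine ⟨⟨hemb.isEmbedding', ?_⟩, fun q => rfl, hemb⟩
    have : Set.range (fun q : ↥N' × ↥U => (q.1, H (j q.1) q.2)) =
        (fun q : ↥N' × F => (q.2, (q.1 : B))) ⁻¹' Set.range f := by
      ext x
      constructor
      · rintro ⟨u, rfl⟩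
        exact ⟨_, (congrFun hcomp u).symm⟩
      · rintro ⟨⟨u, s⟩, hus⟩
        have h2 := hf2 (u, s)
        rw [hus] at h2
        have : s = j x.1 := Subtype.ext h2.symm
        subst this
        exact ⟨(x.1, u), Prod.ext rfl (by simp only [hH]; rw [hus])⟩
    rw [this]
    exact hfo.preimage hcI.continuous
  obtain ⟨hΨo, -, hΨe⟩ := hP ↥N' (fun t => H (j t)) (fun t => ⟨hj t, hslice _⟩) hIso
  have hsw : Isometry (Prod.swap : F × ↥N' → ↥N' × F) := by
    intro x y; simp [Prod.edist_eq, max_comm]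
  have hco : IsOpenEmbedding (fun q : ↥N' × F => (q.2, (q.1 : B))) := by
    refine ⟨hcI.isEmbedding, ?_⟩
    have : Set.range (fun q : ↥N' × F => (q.2, (q.1 : B))) = Prod.snd ⁻¹' N' := by
      ext x
      constructor
      · rintro ⟨q, rfl⟩; exact q.1.2
      · intro hx; exact ⟨(⟨x.2, hx⟩, x.1), rfl⟩
    rw [this]
    exact hN'o.preimage continuous_snd
  refine ⟨N', hN'o.mem_nhds hbN', (fun q : ↥N' × F => (q.2, (q.1 : B))) ∘
    ((fun q : ↥N' × F => (q.1, D (H (j q.1)) q.2)) ∘ (Prod.swap : F × ↥N' → ↥N' × F)),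
    ⟨⟨?_, ?_⟩, fun z => rfl, ?_⟩, ?_, ?_⟩
  · exact (isLipschitzEmbedding_of_isometry hcI).comp'
      (hΨe.comp' (isLipschitzEmbedding_of_isometry hsw))
  · exact (hco.comp (hΨo.comp (Homeomorph.prodComm F ↥N').isOpenEmbedding)).isOpen_range
  · intro u hb
    have : H (j ⟨b, hb⟩) = inclCM U := hHb
    simp [this, hDid]
  · refine ⟨interior C', isOpen_interior, hCC', interior_subset.trans hC'U, N',
      hN'o.mem_nhds hbN', hN'N, subset_rfl, ?_⟩
    intro x hx t ht
    have h1 := (hD _ (hj ⟨t, ht⟩) (hslice _)).2.1 ⟨x, hC'U (interior_subset hx)⟩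
      (interior_subset hx)
    exact Prod.ext h1 (hf2 (⟨x, hC'U (interior_subset hx)⟩, ⟨t, hN'N ht⟩)).symm
  · refine ⟨closure U, hUc, hCU.trans (interior_maximal subset_closure hU), ?_⟩
    intro x hx t
    have h1 := (hD _ (hj t) (hslice _)).2.2 x (fun h => hx (subset_closure h))
    exact Prod.ext h1 rfl
end

section
/- Let p : E → X be a Lipschitz submersion with X locally compact and locally connected. Let b = p(y) for some y ∈ E and F = p⁻¹(b); assume F is locally compact and locally connected and that the refined Lipschitz deformation principle L*(F) holds. Let A and B be compact subsets of F with open neighborhoods U and V in F respectively, and let f : U × N₁ → E and g : V × N₂ → E be Lipschitz product charts about U and about V for p. Then there exist an open neighborhood W of A ∪ B in F, a neighborhood N of b, and a Lipschitz product chart h : W × N → E about W for p such that h = f on a neighborhood of A × {b} and h = g on a neighborhood of (B − U) × {b}. -/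
open Topology Metric Set

universe u v

section Submersion

variable {E X : Type*}

/-- A Lipschitz product chart about an open subset `U` of the fiber `p ⁻¹ b` for `p`. -/
def IsLipschitzProductChart [MetricSpace E] [MetricSpace X] (p : E → X) (b : X)
    (U : Set (p ⁻¹' {b})) (N : Set X) (f : ↥U × ↥N → E) : Prop :=
  IsOpenLipschitzEmbedding f ∧
    (∀ z : ↥U × ↥N, p (f z) = (z.2 : X)) ∧
    (∀ (u : ↥U) (hb : b ∈ N), f (u, ⟨b, hb⟩) = ((u : ↥(p ⁻¹' {b})) : E))

/-- A Lipschitz submersion: a Lipschitz map which, near every point of `E`, admits a Lipschitz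
product chart about an open neighbourhood of the point in its fiber, onto a neighbourhood of
the point. -/
def IsLipschitzSubmersion [MetricSpace E] [MetricSpace X] (p : E → X) : Prop :=
  LocallyLipschitz p ∧
    ∀ y : E, ∃ U : Set (p ⁻¹' {p y}), ∃ N : Set X, ∃ f : ↥U × ↥N → E,
      IsOpen U ∧ (⟨y, rfl⟩ : ↥(p ⁻¹' {p y})) ∈ U ∧ N ∈ 𝓝 (p y) ∧
      IsLipschitzProductChart p (p y) U N f ∧ Set.range f ∈ 𝓝 y

end Submersion

open Filter in
/-- Locally bi-Lipschitz and open at a point. -/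
def LBA {S T : Type*} [MetricSpace S] [MetricSpace T] (φ : S → T) (x : S) : Prop :=
  (∃ K : ℝ, 0 ≤ K ∧ ∃ W ∈ 𝓝 x, ∀ a ∈ W, ∀ b ∈ W,
    dist (φ a) (φ b) ≤ K * dist a b ∧ dist a b ≤ K * dist (φ a) (φ b)) ∧
  𝓝 (φ x) ≤ Filter.map φ (𝓝 x)

section LBAlemmas

variable {S T R Q : Type*} [MetricSpace S] [MetricSpace T] [MetricSpace R] [MetricSpace Q]

theorem LBA.continuousAt {φ : S → T} {x : S} (h : LBA φ x) : ContinuousAt φ x := by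
  obtain ⟨⟨K, hK, W, hW, h⟩, -⟩ := h
  have hl : LipschitzOnWith ⟨K, hK⟩ φ W :=
    LipschitzOnWith.of_dist_le_mul fun a ha b hb => (h a ha b hb).1
  exact hl.continuousOn.continuousAt hW

theorem LBA.comp {φ : S → T} {ψ : T → R} {x : S} (hψ : LBA ψ (φ x)) (hφ : LBA φ x) :
    LBA (ψ ∘ φ) x := by
  have hc := hφ.continuousAt
  obtain ⟨⟨K, hK, W, hW, h⟩, ho⟩ := hφ
  obtain ⟨⟨K', hK', W', hW', h'⟩, ho'⟩ := hψ
  refine ⟨⟨K * K', by positivity, W ∩ φ ⁻¹' W', Filter.inter_mem hW (hc hW'), ?_⟩, ?_⟩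
  · rintro a ⟨ha, ha'⟩ b ⟨hb, hb'⟩
    obtain ⟨h1, h2⟩ := h a ha b hb
    obtain ⟨h3, h4⟩ := h' _ ha' _ hb'
    constructor
    · calc _ ≤ _ := h3
        _ ≤ K' * (K * dist a b) := by gcongr
        _ = _ := by ring
    · calc _ ≤ _ := h2
        _ ≤ K * (K' * dist (ψ (φ a)) (ψ (φ b))) := by gcongr
        _ = _ := by simp only [Function.comp]; ring
  · rw [← Filter.map_map]
    exact ho'.trans (Filter.map_mono ho)

theorem LBA.of_comp_left {φ : S → T} {ψ : T → R} {x : S} (hψ : LBA ψ (φ x))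
    (hc : ContinuousAt φ x) (hφ : LBA (ψ ∘ φ) x) : LBA φ x := by
  have hcψ := hψ.continuousAt
  obtain ⟨⟨K, hK, W, hW, h⟩, ho⟩ := hφ
  obtain ⟨⟨K', hK', W', hW', h'⟩, ho'⟩ := hψ
  refine ⟨⟨K * K', by positivity, W ∩ φ ⁻¹' W', Filter.inter_mem hW (hc hW'), ?_⟩, ?_⟩
  · rintro a ⟨ha, ha'⟩ b ⟨hb, hb'⟩
    obtain ⟨h1, h2⟩ := h a ha b hb
    obtain ⟨h3, h4⟩ := h' _ ha' _ hb'
    constructor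
    · calc _ ≤ _ := h4
        _ ≤ K' * (K * dist a b) := by gcongr; exact h1
        _ = _ := by ring
    · calc _ ≤ _ := h2
        _ ≤ K * (K' * dist (φ a) (φ b)) := by gcongr; exact h3
        _ = _ := by ring
  · intro O hO
    have hO : φ ⁻¹' O ∈ 𝓝 x := hO
    have h1 : (ψ ∘ φ) '' (φ ⁻¹' O ∩ φ ⁻¹' W') ∈ 𝓝 (ψ (φ x)) :=
      ho (Filter.image_mem_map (Filter.inter_mem hO (hc hW')))
    filter_upwards [hcψ h1, hW'] with z hz hzW
    obtain ⟨o, ⟨ho1, ho2⟩, ho3⟩ := hz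
    have := (h' _ hzW _ ho2).2
    rw [← ho3] at this
    simp only [Function.comp, dist_self, mul_zero] at this
    rw [dist_le_zero.1 this]
    exact ho1

theorem LBA.of_comp_right {φ : S → T} {ψ : T → R} {x : S} (hφ : LBA φ x)
    (hc : LBA (ψ ∘ φ) x) : LBA ψ (φ x) := by
  have hcφ := hφ.continuousAt
  obtain ⟨⟨K, hK, W, hW, h⟩, ho⟩ := hc
  obtain ⟨⟨K', hK', W', hW', h'⟩, ho'⟩ := hφ
  refine ⟨⟨K * K', by positivity, φ '' (W ∩ W'),
    ho' (Filter.image_mem_map (Filter.inter_mem hW hW')), ?_⟩, ?_⟩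
  · rintro _ ⟨a, ⟨ha, ha'⟩, rfl⟩ _ ⟨b, ⟨hb, hb'⟩, rfl⟩
    obtain ⟨h1, h2⟩ := h a ha b hb
    obtain ⟨h3, h4⟩ := h' _ ha' _ hb'
    constructor
    · calc _ ≤ _ := h1
        _ ≤ K * (K' * dist (φ a) (φ b)) := by gcongr
        _ = _ := by ring
    · calc _ ≤ _ := h3
        _ ≤ K' * (K * dist (ψ (φ a)) (ψ (φ b))) := by gcongr; exact h2
        _ = _ := by ring
  · refine ho.trans ?_
    rw [← Filter.map_map]
    exact Filter.map_mono hcφ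

theorem LBA.prodMap {φ : S → T} {ψ : R → Q} {x : S × R} (hφ : LBA φ x.1) (hψ : LBA ψ x.2) :
    LBA (Prod.map φ ψ) x := by
  obtain ⟨⟨K, hK, W, hW, h⟩, ho⟩ := hφ
  obtain ⟨⟨K', hK', W', hW', h'⟩, ho'⟩ := hψ
  refine ⟨⟨K + K', by positivity, W ×ˢ W', prod_mem_nhds hW hW', ?_⟩, ?_⟩
  · rintro ⟨a, a'⟩ ⟨ha, ha'⟩ ⟨b, b'⟩ ⟨hb, hb'⟩
    obtain ⟨h1, h2⟩ := h a ha b hb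
    obtain ⟨h3, h4⟩ := h' _ ha' _ hb'
    simp only [Prod.map, Prod.dist_eq]
    refine ⟨max_le (h1.trans ?_) (h3.trans ?_), max_le (h2.trans ?_) (h4.trans ?_)⟩
    · exact mul_le_mul (by linarith) (le_max_left _ _) dist_nonneg (by positivity)
    · exact mul_le_mul (by linarith) (le_max_right _ _) dist_nonneg (by positivity)
    · exact mul_le_mul (by linarith) (le_max_left _ _) dist_nonneg (by positivity)
    · exact mul_le_mul (by linarith) (le_max_right _ _) dist_nonneg (by positivity)
  · obtain ⟨x1, x2⟩ := x
    simp only [Prod.map, nhds_prod_eq]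
    refine (Filter.prod_mono ho ho').trans ?_
    rw [Filter.prod_map_map_eq]
    rfl

theorem LBA.id (x : S) : LBA (id : S → S) x :=
  ⟨⟨1, by norm_num, univ, Filter.univ_mem, by simp⟩, by simp⟩

theorem LBA.swap (x : S × T) : LBA (Prod.swap : S × T → T × S) x := by
  refine ⟨⟨1, by norm_num, univ, Filter.univ_mem, ?_⟩, ?_⟩
  · intro a _ b _
    simp [Prod.dist_eq, max_comm]
  · exact ((Homeomorph.prodComm S T).map_nhds_eq x).ge

theorem LBA.val {s : Set S} (hs : IsOpen s) (x : s) : LBA (Subtype.val : s → S) x := by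
  refine ⟨⟨1, by norm_num, univ, Filter.univ_mem, ?_⟩, ?_⟩
  · intro a _ b _
    simp [Subtype.dist_eq]
  · exact (hs.isOpenEmbedding_subtypeVal.map_nhds_eq x).ge

theorem LBA.inclusion {s t : Set S} (hs : IsOpen s) (h : s ⊆ t) (x : s) :
    LBA (Set.inclusion h) x := by
  refine ⟨⟨1, by norm_num, univ, Filter.univ_mem, ?_⟩, ?_⟩
  · intro a _ b _
    simp [Subtype.dist_eq]
  · have hi : IsOpenEmbedding (Set.inclusion h) := by
      refine .of_continuous_injective_isOpenMap (continuous_inclusion h)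
        (inclusion_injective h) ?_
      intro O hO
      have h1 := hs.isOpenMap_subtype_val _ hO
      convert h1.preimage (continuous_subtype_val (p := fun x => x ∈ t)) using 1
      ext z
      constructor
      · rintro ⟨o, ho, rfl⟩
        exact ⟨o, ho, rfl⟩
      · rintro ⟨o, ho, hoz⟩
        exact ⟨o, ho, Subtype.ext hoz⟩
    exact (hi.map_nhds_eq x).ge

theorem LBA.slice {φ : S → T → R} {t : S} {u : T}
    (h : LBA (fun q : S × T => (q.1, φ q.1 q.2)) (t, u)) : LBA (φ t) u := by
  obtain ⟨⟨K, hK, W, hW, h⟩, ho⟩ := h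
  refine ⟨⟨K, hK, (fun v => (t, v)) ⁻¹' W, ?_, ?_⟩, ?_⟩
  · exact (Continuous.prodMk_right t).continuousAt hW
  · intro a ha b hb
    have := h _ ha _ hb
    simpa [Prod.dist_eq] using this
  · intro O hO
    have hO : φ t ⁻¹' O ∈ 𝓝 u := hO
    have h1 : (univ : Set S) ×ˢ (φ t ⁻¹' O) ∈ 𝓝 (t, u) := prod_mem_nhds Filter.univ_mem hO
    have h2 := ho (Filter.image_mem_map h1)
    filter_upwards [(Continuous.prodMk_right t).continuousAt h2] with v hv
    obtain ⟨⟨t', o⟩, ⟨-, ho⟩, heq⟩ := hv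
    simp only [Prod.mk.injEq] at heq
    obtain ⟨rfl, rfl⟩ := heq
    exact ho

theorem openEmb_of_LBA {φ : S → T} (hi : Function.Injective φ) (h : ∀ x, LBA φ x) :
    IsOpenEmbedding φ :=
  .of_continuous_injective_isOpenMap (continuous_iff_continuousAt.2 fun x => (h x).continuousAt)
    hi (IsOpenMap.of_nhds_le fun x => (h x).2)

theorem ole_iff {φ : S → T} :
    IsOpenLipschitzEmbedding φ ↔ Function.Injective φ ∧ ∀ x, LBA φ x := by
  constructor
  · rintro ⟨⟨hi, hl, g, hg, hgl⟩, ho⟩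
    refine ⟨hi, fun x => ⟨?_, ?_⟩⟩
    · obtain ⟨K, W, hW, h⟩ := hl x
      obtain ⟨K', W', hW', h'⟩ := hgl (rangeFactorization φ x)
      have hc : Continuous (rangeFactorization φ) := hl.continuous.subtype_mk _
      refine ⟨K + K', by positivity, W ∩ rangeFactorization φ ⁻¹' W',
        Filter.inter_mem hW (hc.continuousAt hW'), ?_⟩
      rintro a ⟨ha, ha'⟩ b ⟨hb, hb'⟩
      have h1 := h.dist_le_mul a ha b hb
      have h2 := h'.dist_le_mul _ ha' _ hb'
      rw [hg, hg, Subtype.dist_eq] at h2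
      simp only [rangeFactorization_coe] at h2
      have := K.2
      have := K'.2
      constructor
      · refine h1.trans (mul_le_mul_of_nonneg_right ?_ dist_nonneg)
        simp
      · refine h2.trans (mul_le_mul_of_nonneg_right ?_ dist_nonneg)
        simp
    · intro O hO
      have hO : φ ⁻¹' O ∈ 𝓝 x := hO
      have h1 : g ⁻¹' (φ ⁻¹' O) ∈ 𝓝 (rangeFactorization φ x) := by
        apply hgl.continuous.continuousAt
        rw [hg]; exact hO
      have h2 : Subtype.val '' (g ⁻¹' (φ ⁻¹' O)) ∈ 𝓝 (φ x) :=
        (ho.isOpenEmbedding_subtypeVal.map_nhds_eq (rangeFactorization φ x)).ge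
          (Filter.image_mem_map h1)
      refine Filter.mem_of_superset h2 ?_
      rintro _ ⟨⟨_, z, rfl⟩, hz, rfl⟩
      have : g ⟨φ z, z, rfl⟩ = z := hg z
      simpa [this] using hz
  · rintro ⟨hi, h⟩
    have he := openEmb_of_LBA hi h
    have hgl : Function.LeftInverse (fun y : range φ => y.2.choose) (rangeFactorization φ) :=
      fun x => hi (rangeFactorization φ x).2.choose_spec
    refine ⟨⟨hi, ?_, fun y => y.2.choose, hgl, ?_⟩, he.isOpen_range⟩
    · intro x
      obtain ⟨⟨K, hK, W, hW, h⟩, -⟩ := h x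
      exact ⟨⟨K, hK⟩, W, hW, LipschitzOnWith.of_dist_le_mul fun a ha b hb => (h a ha b hb).1⟩
    · rintro ⟨_, x, rfl⟩
      obtain ⟨⟨K, hK, W, hW, h⟩, ho⟩ := h x
      refine ⟨⟨K, hK⟩, Subtype.val ⁻¹' (φ '' W),
        continuous_subtype_val.continuousAt (ho (Filter.image_mem_map hW)), ?_⟩
      refine LipschitzOnWith.of_dist_le_mul ?_
      rintro ⟨_, -⟩ ⟨a, ha, rfl⟩ ⟨_, -⟩ ⟨b, hb, rfl⟩
      have h1 := hgl a
      have h2 := hgl b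
      simp only [rangeFactorization] at h1 h2
      rw [h1, h2, Subtype.dist_eq]
      exact (h a ha b hb).2

theorem isotopy_iff {φ : S → T → R} :
    IsLipschitzIsotopy (fun q : S × T => (q.1, φ q.1 q.2)) ↔
      Function.Injective (fun q : S × T => (q.1, φ q.1 q.2)) ∧
        ∀ q, LBA (fun q : S × T => (q.1, φ q.1 q.2)) q := by
  rw [← ole_iff]
  constructor
  · rintro ⟨h1, -, h2⟩
    exact ⟨h2, h1.isOpen_range⟩
  · intro h
    have := ole_iff.1 h
    exact ⟨openEmb_of_LBA this.1 this.2, fun _ => rfl, h.1⟩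

end LBAlemmas

section Charts

variable {E X : Type*} [MetricSpace E] [MetricSpace X] {p : E → X} {b : X}

theorem chart_iff {U : Set (p ⁻¹' {b})} {N : Set X} {f : ↥U × ↥N → E} :
    IsLipschitzProductChart p b U N f ↔ (Function.Injective f ∧ ∀ x, LBA f x) ∧
    (∀ z : ↥U × ↥N, p (f z) = (z.2 : X)) ∧
    (∀ (u : ↥U) (hb : b ∈ N), f (u, ⟨b, hb⟩) = ((u : ↥(p ⁻¹' {b})) : E)) := by
  unfold IsLipschitzProductChart
  rw [ole_iff]

theorem chart_restrict {U U' : Set (p ⁻¹' {b})} {N N' : Set X} {f : ↥U × ↥N → E}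
    (hf : IsLipschitzProductChart p b U N f) (hU : U' ⊆ U) (hN : N' ⊆ N) (hU' : IsOpen U')
    (hN' : IsOpen N') :
    IsLipschitzProductChart p b U' N' (f ∘ Prod.map (inclusion hU) (inclusion hN)) := by
  rw [chart_iff] at hf ⊢
  obtain ⟨⟨h1, h2⟩, h3, h4⟩ := hf
  refine ⟨⟨h1.comp ((inclusion_injective hU).prodMap (inclusion_injective hN)), fun x => ?_⟩,
    fun z => ?_, fun u hb => ?_⟩
  · exact (h2 _).comp (LBA.prodMap (LBA.inclusion hU' _ _) (LBA.inclusion hN' _ _))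
  · exact h3 _
  · exact h4 _ _

/-- Tube lemma for charts. -/
theorem tube {Z : Type*} [TopologicalSpace Z] {N : Set X} (hN : IsOpen N) (hb : b ∈ N)
    {K : Set Z} (hK : IsCompact K) {S : Set (Z × N)} (hS : IsOpen S)
    (hKS : ∀ z ∈ K, (z, ⟨b, hb⟩) ∈ S) :
    ∃ N' : Set X, IsOpen N' ∧ b ∈ N' ∧ ∃ h : N' ⊆ N, ∀ z ∈ K, ∀ t (ht : t ∈ N'),
      (z, ⟨t, h ht⟩) ∈ S := by
  obtain ⟨u, v, hu, hv, hKu, hbv, huv⟩ := generalized_tube_lemma hK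
    (isCompact_singleton (x := (⟨b, hb⟩ : N))) hS (by
      rintro ⟨z, t⟩ ⟨hz, ht⟩
      obtain rfl : t = _ := ht
      exact hKS z hz)
  refine ⟨Subtype.val '' v, hN.isOpenMap_subtype_val _ hv, ⟨_, hbv rfl, rfl⟩, ?_, ?_⟩
  · rintro _ ⟨t, -, rfl⟩; exact t.2
  · rintro z hz _ ⟨t, ht, rfl⟩
    exact huv ⟨hKu hz, ht⟩

theorem isCompact_pre {Z : Type*} [TopologicalSpace Z] {K U : Set Z} (hK : IsCompact K)
    (h : K ⊆ U) : IsCompact (Subtype.val ⁻¹' K : Set U) :=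
  Topology.IsInducing.subtypeVal.isCompact_preimage' hK (by simpa using h)

theorem glue {U V : Set (p ⁻¹' {b})} {N : Set X} (hN : IsOpen N) (hb : b ∈ N)
    {f : ↥U × ↥N → E} {g : ↥V × ↥N → E}
    (hf : IsLipschitzProductChart p b U N f) (hg : IsLipschitzProductChart p b V N g)
    {A B C : Set (p ⁻¹' {b})} (hA : IsCompact A) (hB : IsCompact B) (hAU : A ⊆ U) (hBV : B ⊆ V)
    (hAB : A ∩ B ⊆ interior C)
    (hC : ∀ x (hU : x ∈ U) (hV : x ∈ V), x ∈ C → ∀ t, f (⟨x, hU⟩, t) = g (⟨x, hV⟩, t))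
    (hCV : C ⊆ V) :
    ∃ N' : Set X, IsOpen N' ∧ b ∈ N' ∧ ∃ hN' : N' ⊆ N,
      ∃ h : ↥(interior A ∪ interior B) × ↥N' → E,
        IsLipschitzProductChart p b (interior A ∪ interior B) N' h ∧
        (∀ x (hx : x ∈ A) hx' t (ht : t ∈ N'),
          h (⟨x, hx'⟩, ⟨t, ht⟩) = f (⟨x, hAU hx⟩, ⟨t, hN' ht⟩)) ∧
        (∀ x (hx : x ∈ B) hx' t (ht : t ∈ N'),
          h (⟨x, hx'⟩, ⟨t, ht⟩) = g (⟨x, hBV hx⟩, ⟨t, hN' ht⟩)) := by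
  classical
  rw [chart_iff] at hf hg
  obtain ⟨⟨f1, f2⟩, f3, f4⟩ := hf
  obtain ⟨⟨g1, g2⟩, g3, g4⟩ := hg
  have fc := (openEmb_of_LBA f1 f2).continuous
  have gc := (openEmb_of_LBA g1 g2).continuous
  obtain ⟨N', hN'o, hbN', hN', htube⟩ := tube (Z := U × V) hN hb
    ((isCompact_pre hA hAU).prod (isCompact_pre hB hBV))
    (S := {z | f (z.1.1, z.2) ≠ g (z.1.2, z.2)} ∪ {z | (z.1.1 : p ⁻¹' {b}) ∈ interior C})
    (by
      refine IsOpen.union (isOpen_ne_fun (by fun_prop) (by fun_prop)) ?_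
      exact isOpen_interior.preimage (by fun_prop : Continuous
        fun z : (U × V) × N => (z.1.1 : p ⁻¹' {b})))
    (by
      rintro ⟨x, x'⟩ ⟨hx, hx'⟩
      by_cases h : f (x, ⟨b, hb⟩) = g (x', ⟨b, hb⟩)
      · right
        rw [f4, g4] at h
        have h : (x : p ⁻¹' {b}) = x' := Subtype.ext h
        refine hAB ⟨hx, ?_⟩
        rw [h]; exact hx'
      · left; exact h)
  have key : ∀ x (hx : x ∈ A) x' (hx' : x' ∈ B) t (ht : t ∈ N'),
      f (⟨x, hAU hx⟩, ⟨t, hN' ht⟩) = g (⟨x', hBV hx'⟩, ⟨t, hN' ht⟩) → x = x' := by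
    intro x hx x' hx' t ht heq
    rcases htube (⟨x, hAU hx⟩, ⟨x', hBV hx'⟩) ⟨hx, hx'⟩ t ht with h | h
    · exact absurd heq h
    · have hxC : x ∈ C := interior_subset h
      rw [hC x (hAU hx) (hCV hxC) hxC] at heq
      have := g1 heq
      simpa using this
  have hB' : ∀ x : ↥(interior A ∪ interior B), (x : p ⁻¹' {b}) ∉ A → (x : p ⁻¹' {b}) ∈ B := by
    rintro ⟨x, hx | hx⟩ hxA
    · exact absurd (interior_subset hx) hxA
    · exact interior_subset hx
  let h : ↥(interior A ∪ interior B) × ↥N' → E := fun z =>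
    if hz : (z.1 : p ⁻¹' {b}) ∈ A then f (⟨z.1, hAU hz⟩, ⟨z.2, hN' z.2.2⟩)
    else g (⟨z.1, hBV (hB' z.1 hz)⟩, ⟨z.2, hN' z.2.2⟩)
  have hhf : ∀ x (hx : x ∈ A) hx' t (ht : t ∈ N'),
          h (⟨x, hx'⟩, ⟨t, ht⟩) = f (⟨x, hAU hx⟩, ⟨t, hN' ht⟩) := by
    intro x hx hx' t ht
    simp only [h, dif_pos hx]
  have hhg : ∀ x (hx : x ∈ B) hx' t (ht : t ∈ N'),
          h (⟨x, hx'⟩, ⟨t, ht⟩) = g (⟨x, hBV hx⟩, ⟨t, hN' ht⟩) := by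
    intro x hx hx' t ht
    by_cases hxA : x ∈ A
    · rw [hhf x hxA]
      exact hC _ _ _ (interior_subset (hAB ⟨hxA, hx⟩)) _
    · simp only [h, dif_neg hxA]
  have hph : ∀ z, p (h z) = z.2 := by
    rintro ⟨⟨x, hx⟩, ⟨t, ht⟩⟩
    by_cases hxA : x ∈ A
    · rw [hhf x hxA, f3]
    · rw [hhg x (hB' ⟨x, hx⟩ hxA), g3]
  refine ⟨N', hN'o, hbN', hN', h, ?_, hhf, hhg⟩
  rw [chart_iff]
  refine ⟨⟨?_, ?_⟩, hph, ?_⟩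
  · rintro ⟨⟨x, hx⟩, ⟨t, ht⟩⟩ ⟨⟨x', hx'⟩, ⟨t', ht'⟩⟩ heq
    have htt : t = t' := by
      have := congrArg p heq
      rwa [hph, hph] at this
    subst htt
    suffices x = x' by subst this; rfl
    by_cases hxA : x ∈ A <;> by_cases hxA' : x' ∈ A
    · rw [hhf x hxA, hhf x' hxA'] at heq
      simpa using f1 heq
    · rw [hhf x hxA, hhg x' (hB' ⟨x', hx'⟩ hxA')] at heq
      exact key x hxA x' (hB' ⟨x', hx'⟩ hxA') t ht heq
    · rw [hhf x' hxA', hhg x (hB' ⟨x, hx⟩ hxA)] at heq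
      exact (key x' hxA' x (hB' ⟨x, hx⟩ hxA) t ht heq.symm).symm
    · rw [hhg x' (hB' ⟨x', hx'⟩ hxA'), hhg x (hB' ⟨x, hx⟩ hxA)] at heq
      simpa using g1 heq
  · rintro ⟨⟨x, hx⟩, t⟩
    rcases id hx with hxA | hxB
    · have hj := LBA.prodMap (x := ((⟨x, hxA⟩ : interior A), t))
        (φ := inclusion (subset_union_left : _ ⊆ interior A ∪ interior B)) (ψ := (id : N' → N'))
        (LBA.inclusion isOpen_interior (subset_union_left : _ ⊆ interior A ∪ interior B) _)
        (LBA.id (S := N') _)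
      refine LBA.of_comp_right (x := ((⟨x, hxA⟩ : interior A), t)) (ψ := h)
        (φ := Prod.map (inclusion (subset_union_left : _ ⊆ interior A ∪ interior B)) id) hj ?_
      have : h ∘ Prod.map (inclusion (subset_union_left : _ ⊆ interior A ∪ interior B)) id =
          f ∘ Prod.map (inclusion (interior_subset.trans hAU)) (inclusion hN') := by
        funext z
        exact hhf z.1 (interior_subset z.1.2) _ z.2 z.2.2
      rw [this]
      exact (f2 _).comp (LBA.prodMap (LBA.inclusion isOpen_interior _ _) (LBA.inclusion hN'o _ _))
    · have hj := LBA.prodMap (x := ((⟨x, hxB⟩ : interior B), t))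
        (φ := inclusion (subset_union_right : _ ⊆ interior A ∪ interior B)) (ψ := (id : N' → N'))
        (LBA.inclusion isOpen_interior (subset_union_right : _ ⊆ interior A ∪ interior B) _)
        (LBA.id (S := N') _)
      refine LBA.of_comp_right (x := ((⟨x, hxB⟩ : interior B), t)) (ψ := h)
        (φ := Prod.map (inclusion (subset_union_right : _ ⊆ interior A ∪ interior B)) id) hj ?_
      have : h ∘ Prod.map (inclusion (subset_union_right : _ ⊆ interior A ∪ interior B)) id =
          g ∘ Prod.map (inclusion (interior_subset.trans hBV)) (inclusion hN') := by
        funext z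
        exact hhg z.1 (interior_subset z.1.2) _ z.2 z.2.2
      rw [this]
      exact (g2 _).comp (LBA.prodMap (LBA.inclusion isOpen_interior _ _) (LBA.inclusion hN'o _ _))
  · rintro ⟨x, hx⟩ hb'
    by_cases hxA : x ∈ A
    · rw [hhf x hxA, f4]
    · rw [hhg x (hB' ⟨x, hx⟩ hxA), g4]

end Charts

theorem adjust {E X : Type u} [MetricSpace E] [MetricSpace X] {p : E → X} {b : X}
    (hL : LipschitzDeformationPrincipleStar.{u} ↥(p ⁻¹' {b}))
    {U V : Set (p ⁻¹' {b})} (hV : IsOpen V) {N : Set X} (hN : IsOpen N) (hb : b ∈ N)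
    {f : ↥U × ↥N → E} {g : ↥V × ↥N → E}
    (hf : IsLipschitzProductChart p b U N f) (hg : IsLipschitzProductChart p b V N g)
    {O C K : Set (p ⁻¹' {b})} (hO : IsOpen O) (hC : IsCompact C) (hK : IsCompact K)
    (hCO : C ⊆ O) (hOK : O ⊆ K) (hKU : K ⊆ U) (hKV : K ⊆ V) :
    ∃ N' : Set X, IsOpen N' ∧ b ∈ N' ∧ ∃ hN' : N' ⊆ N, ∃ g' : ↥V × ↥N' → E,
      IsLipschitzProductChart p b V N' g' ∧
      (∀ x (hx : x ∈ C) t (ht : t ∈ N'), g' (⟨x, hKV (hOK (hCO hx))⟩, ⟨t, ht⟩) =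
        f (⟨x, hKU (hOK (hCO hx))⟩, ⟨t, hN' ht⟩)) ∧
      (∀ x (hx : x ∈ V) t (ht : t ∈ N'), x ∉ O →
        g' (⟨x, hx⟩, ⟨t, ht⟩) = g (⟨x, hx⟩, ⟨t, hN' ht⟩)) := by
  obtain ⟨ND, hND, D, ⟨hD1, hD2, hD3⟩, hP⟩ := hL O hO C hC hCO
  have hf0 := hf
  have hg0 := hg
  rw [chart_iff] at hf hg
  obtain ⟨⟨f1, f2⟩, f3, f4⟩ := hf
  obtain ⟨⟨g1, g2⟩, g3, g4⟩ := hg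
  have fc := (openEmb_of_LBA f1 f2).continuous
  obtain ⟨N₀, hN₀o, hbN₀, hN₀, htube⟩ := tube hN hb (isCompact_pre hK hKU)
    (S := f ⁻¹' (range g)) ((openEmb_of_LBA g1 g2).isOpen_range.preimage fc) (by
      intro x hx
      refine ⟨(⟨x, hKV hx⟩, ⟨b, hb⟩), ?_⟩
      rw [g4, f4])
  -- restricted charts
  have hOU := hOK.trans hKU
  have hOV := hOK.trans hKV
  have hf' := chart_iff.1 (chart_restrict hf0 hOU hN₀ hO hN₀o)
  have hg' := chart_iff.1 (chart_restrict hg0 (subset_refl V) hN₀ hV hN₀o)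
  set f' := f ∘ Prod.map (inclusion hOU) (inclusion hN₀) with hf'def
  set g' := g ∘ Prod.map (inclusion (subset_refl V)) (inclusion hN₀) with hg'def
  have hk : ∀ z : O × N₀, ∃ v : V, g' (v, z.2) = f' z := by
    rintro ⟨x, t⟩
    obtain ⟨⟨v, s⟩, hvs⟩ := htube ⟨x, hOU x.2⟩ (hOK x.2) t t.2
    refine ⟨v, ?_⟩
    have : (s : X) = t := by
      have := congrArg p hvs
      rwa [g3, f3] at this
    have : s = ⟨t, hN₀ t.2⟩ := Subtype.ext this
    subst this
    exact hvs
  choose k hk using hk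
  let k0 : O × N₀ → V × N₀ := fun z => (k z, z.2)
  have hgk : g' ∘ k0 = f' := funext hk
  have hk0c : Continuous k0 := by
    rw [(openEmb_of_LBA hg'.1.1 hg'.1.2).continuous_iff, hgk]
    exact (openEmb_of_LBA hf'.1.1 hf'.1.2).continuous
  have hk0L : ∀ z, LBA k0 z := fun z =>
    LBA.of_comp_left (hg'.1.2 _) hk0c.continuousAt (hgk ▸ hf'.1.2 z)
  have hk0i : Function.Injective k0 := by
    have := hf'.1.1
    rw [← hgk] at this
    exact this.of_comp
  have hkc : Continuous k := continuous_fst.comp hk0c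
  -- the family
  let hfam : C(N₀, C(O, p ⁻¹' {b})) :=
    ContinuousMap.curry ⟨fun q : N₀ × O => (k (q.2, q.1) : p ⁻¹' {b}), by fun_prop⟩
  have hfam_apply : ∀ t x, hfam t x = (k (x, t) : p ⁻¹' {b}) := fun t x => rfl
  have hfamb : hfam ⟨b, hbN₀⟩ = inclCM O := by
    ext x
    rw [hfam_apply]
    have := hk (x, ⟨b, hbN₀⟩)
    rw [hg'.2.2, hf'.2.2] at this
    exact this
  have hnb : hfam ⁻¹' ND ∈ 𝓝 (⟨b, hbN₀⟩ : N₀) :=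
    hfam.continuous.continuousAt (by rw [hfamb]; exact hND)
  obtain ⟨Q, hQs, hQo, hbQ⟩ := _root_.mem_nhds_iff.1 hnb
  let N₁ : Set X := Subtype.val '' Q
  have hN₁o : IsOpen N₁ := hN₀o.isOpenMap_subtype_val _ hQo
  have hbN₁ : b ∈ N₁ := ⟨_, hbQ, rfl⟩
  have hN₁ : N₁ ⊆ N₀ := by
    rintro _ ⟨t, -, rfl⟩; exact t.2
  have hN₁N := hN₁.trans hN₀
  let h : N₁ → C(O, p ⁻¹' {b}) := fun t => hfam (inclusion hN₁ t)
  have hhN : ∀ t, h t ∈ ND := by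
    rintro ⟨_, t, ht, rfl⟩
    exact hQs ht
  have hΦ : Function.Injective (fun q : N₁ × O => (q.1, h q.1 q.2)) ∧
      ∀ q, LBA (fun q : N₁ × O => (q.1, h q.1 q.2)) q := by
    constructor
    · rintro ⟨t, x⟩ ⟨t', x'⟩ heq
      simp only [Prod.mk.injEq] at heq
      obtain ⟨rfl, h2⟩ := heq
      have : k0 (x, inclusion hN₁ t) = k0 (x', inclusion hN₁ t) := by
        simp only [k0, Prod.mk.injEq, and_true]
        exact Subtype.ext h2
      have := hk0i this
      simp only [Prod.mk.injEq, and_true] at this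
      rw [this]
    · intro q
      refine LBA.of_comp_left (ψ := Prod.map (inclusion hN₁) id)
        (LBA.prodMap (LBA.inclusion hN₁o _ _) (LBA.id _)) ?_ ?_
      · apply Continuous.continuousAt
        refine continuous_fst.prodMk ?_
        have : Continuous fun q : N₁ × O => (k (q.2, inclusion hN₁ q.1) : p ⁻¹' {b}) := by
          have := continuous_inclusion hN₁
          fun_prop
        exact this
      · have : (Prod.map (inclusion hN₁) id ∘ fun q : N₁ × O => (q.1, h q.1 q.2)) =
            Prod.swap ∘ Prod.map Subtype.val id ∘ k0 ∘ Prod.swap ∘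
              Prod.map (inclusion hN₁) id := rfl
        rw [this]
        refine (LBA.swap _).comp ((LBA.prodMap (LBA.val hV _) (LBA.id _)).comp
          ((hk0L _).comp ((LBA.swap _).comp
            (LBA.prodMap (LBA.inclusion hN₁o _ _) (LBA.id _)))))
  have hOLE : ∀ t, IsOpenLipschitzEmbedding (⇑(h t) : O → p ⁻¹' {b}) := by
    intro t
    rw [ole_iff]
    refine ⟨fun x x' hxx => ?_, fun x => LBA.slice (φ := fun t x => h t x) (hΦ.2 (t, x))⟩
    have := @hΦ.1 (t, x) (t, x') (by simp only [hxx])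
    simpa using this
  have hΨ := (isotopy_iff (φ := fun t x => D (h t) x)).1 (hP N₁ h (fun t => ⟨hhN t, hOLE t⟩)
    (isotopy_iff (φ := fun t x => h t x) |>.2 hΦ))
  have hDi : ∀ t, Function.Injective (D (h t)) := fun t => (hD3 _ (hhN t) (hOLE t)).1.1.1
  have hDC : ∀ t, ∀ x : O, (x : p ⁻¹' {b}) ∈ C → D (h t) x = h t x :=
    fun t => (hD3 _ (hhN t) (hOLE t)).2.1
  have hDO : ∀ t, ∀ x, x ∉ O → D (h t) x = x := fun t => (hD3 _ (hhN t) (hOLE t)).2.2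
  have hDV : ∀ t, ∀ x ∈ V, D (h t) x ∈ V := by
    intro t x hx
    by_contra hn
    have h1 := hDO t _ (fun h => hn (hOV h))
    have h2 := hDi t h1
    rw [h2] at hn
    exact hn hx
  let ρ : V × N₁ → V × N₁ := fun z => (⟨D (h z.2) z.1, hDV _ _ z.1.2⟩, z.2)
  have hρeq : Prod.map Subtype.val id ∘ ρ =
      Prod.swap ∘ (fun q : N₁ × (p ⁻¹' {b}) => (q.1, D (h q.1) q.2)) ∘ Prod.swap ∘
        Prod.map Subtype.val id := rfl
  have hρL' : ∀ z, LBA ((Prod.map Subtype.val id : V × N₁ → (p ⁻¹' {b}) × N₁) ∘ ρ) z := by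
    intro z
    rw [hρeq]
    exact (LBA.swap _).comp ((hΨ.2 _).comp ((LBA.swap _).comp
      (LBA.prodMap (LBA.val hV _) (LBA.id _))))
  have hρc : Continuous ρ := by
    have hi : IsInducing (Prod.map Subtype.val id : V × N₁ → (p ⁻¹' {b}) × N₁) :=
      IsInducing.subtypeVal.prodMap .id
    rw [hi.continuous_iff]
    exact continuous_iff_continuousAt.2 fun z => (hρL' z).continuousAt
  have hρL : ∀ z, LBA ρ z := fun z =>
    LBA.of_comp_left (LBA.prodMap (LBA.val hV _) (LBA.id _)) hρc.continuousAt (hρL' z)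
  have hρi : Function.Injective ρ := by
    rintro ⟨x, t⟩ ⟨x', t'⟩ heq
    simp only [ρ, Prod.mk.injEq, Subtype.mk.injEq] at heq
    obtain ⟨h1, rfl⟩ := heq
    rw [Subtype.ext (hDi t h1)]
  have hg1 := chart_iff.1 (chart_restrict hg0 (subset_refl V) hN₁N hV hN₁o)
  refine ⟨N₁, hN₁o, hbN₁, hN₁N,
    (g ∘ Prod.map (inclusion (subset_refl V)) (inclusion hN₁N)) ∘ ρ, ?_, ?_, ?_⟩
  · rw [chart_iff]
    refine ⟨⟨hg1.1.1.comp hρi, fun z => (hg1.1.2 _).comp (hρL z)⟩, fun z => hg1.2.1 _, ?_⟩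
    intro u hb'
    have : ρ (u, ⟨b, hb'⟩) = (u, ⟨b, hb'⟩) := by
      have : h ⟨b, hb'⟩ = inclCM O := hfamb
      simp only [ρ, this, hD2]
      rfl
    rw [Function.comp_apply, this]
    exact hg1.2.2 _ _
  · intro x hx t ht
    have h1 := hDC ⟨t, ht⟩ ⟨x, hCO hx⟩ hx
    have h2 := hk (⟨x, hCO hx⟩, ⟨t, hN₁ ht⟩)
    have h3 : ρ (⟨x, hKV (hOK (hCO hx))⟩, ⟨t, ht⟩) =
        (k (⟨x, hCO hx⟩, ⟨t, hN₁ ht⟩), ⟨t, ht⟩) := by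
      simp only [ρ, Prod.mk.injEq, and_true]
      exact Subtype.ext h1
    rw [Function.comp_apply, h3]
    exact h2
  · intro x hx t ht hxO
    have h3 : ρ (⟨x, hx⟩, ⟨t, ht⟩) = (⟨x, hx⟩, ⟨t, ht⟩) := by
      simp only [ρ, Prod.mk.injEq, and_true]
      exact Subtype.ext (hDO _ _ hxO)
    rw [Function.comp_apply, h3]
    rfl

/-- **Lipschitz union lemma** (Lemma 4.6).  Let `p : E → X` be a Lipschitz submersion with
`X` locally compact and locally connected, let `F = p ⁻¹ (p y)` be locally compact and locally
connected with `L*(F)`, let `A, B` be compacta in `F` with open neighbourhoods `U, V` and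
Lipschitz product charts `f : U × N₁ → E`, `g : V × N₂ → E` about `U` and `V` for `p`.  Then
there is a Lipschitz product chart `h : W × N → E` about an open neighbourhood `W` of `A ∪ B`
with `h = f` near `A × {b}` and `h = g` near `(B − U) × {b}`. -/
theorem lipschitz_union_lemma
    {E X : Type u} [MetricSpace E] [MetricSpace X]
    [LocallyCompactSpace X] [LocallyConnectedSpace X]
    (p : E → X) (hp : IsLipschitzSubmersion p) (y : E)
    [LocallyCompactSpace ↥(p ⁻¹' {p y})] [LocallyConnectedSpace ↥(p ⁻¹' {p y})]
    (hL : LipschitzDeformationPrincipleStar.{u} ↥(p ⁻¹' {p y}))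
    (A B : Set ↥(p ⁻¹' {p y})) (hA : IsCompact A) (hB : IsCompact B)
    (U V : Set ↥(p ⁻¹' {p y})) (hU : IsOpen U) (hV : IsOpen V)
    (hAU : A ⊆ U) (hBV : B ⊆ V)
    (N₁ N₂ : Set X) (hN₁ : N₁ ∈ 𝓝 (p y)) (hN₂ : N₂ ∈ 𝓝 (p y))
    (f : ↥U × ↥N₁ → E) (g : ↥V × ↥N₂ → E)
    (hf : IsLipschitzProductChart p (p y) U N₁ f)
    (hg : IsLipschitzProductChart p (p y) V N₂ g) :
    ∃ W : Set ↥(p ⁻¹' {p y}), IsOpen W ∧ A ∪ B ⊆ W ∧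
      ∃ N ∈ 𝓝 (p y), ∃ h : ↥W × ↥N → E, IsLipschitzProductChart p (p y) W N h ∧
        (∃ W₁, IsOpen W₁ ∧ A ⊆ W₁ ∧ ∃ (hW₁ : W₁ ⊆ W) (hW₁' : W₁ ⊆ U),
          ∃ M₁ ∈ 𝓝 (p y), ∃ (hM₁ : M₁ ⊆ N) (hM₁' : M₁ ⊆ N₁),
            ∀ x (hx : x ∈ W₁), ∀ t (ht : t ∈ M₁),
              h (⟨x, hW₁ hx⟩, ⟨t, hM₁ ht⟩) = f (⟨x, hW₁' hx⟩, ⟨t, hM₁' ht⟩)) ∧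
        (∃ W₂, IsOpen W₂ ∧ B \ U ⊆ W₂ ∧ ∃ (hW₂ : W₂ ⊆ W) (hW₂' : W₂ ⊆ V),
          ∃ M₂ ∈ 𝓝 (p y), ∃ (hM₂ : M₂ ⊆ N) (hM₂' : M₂ ⊆ N₂),
            ∀ x (hx : x ∈ W₂), ∀ t (ht : t ∈ M₂),
              h (⟨x, hW₂ hx⟩, ⟨t, hM₂ ht⟩) = g (⟨x, hW₂' hx⟩, ⟨t, hM₂' ht⟩)) := by
  have hABUV : A ∩ B ⊆ U ∩ V := inter_subset_inter hAU hBV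
  obtain ⟨K, hK, hABK, hKUV⟩ := exists_compact_between (hA.inter hB) (hU.inter hV) hABUV
  obtain ⟨C, hC, hABC, hCK⟩ := exists_compact_between (hA.inter hB) isOpen_interior hABK
  -- separate
  have hdisj : Disjoint (A \ interior C) B := by
    rw [Set.disjoint_left]
    rintro x ⟨hxA, hxC⟩ hxB
    exact hxC (hABC ⟨hxA, hxB⟩)
  obtain ⟨O₁, O₂, hO₁, hO₂, hAO₁, hBO₂, hOO⟩ :=
    SeparatedNhds.of_isCompact_isCompact (hA.diff isOpen_interior) hB hdisj
  obtain ⟨A₀, hA₀, hAA₀, hA₀s⟩ := exists_compact_between hA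
    (U := (O₁ ∪ interior C) ∩ U) ((hO₁.union isOpen_interior).inter hU) (by
      intro x hx
      refine ⟨?_, hAU hx⟩
      by_cases h : x ∈ interior C
      · exact Or.inr h
      · exact Or.inl (hAO₁ ⟨hx, h⟩))
  obtain ⟨B₀, hB₀, hBB₀, hB₀s⟩ := exists_compact_between hB
    (U := O₂ ∩ V) (hO₂.inter hV) (fun x hx => ⟨hBO₂ hx, hBV hx⟩)
  have hA₀U : A₀ ⊆ U := fun x hx => (hA₀s hx).2
  have hB₀V : B₀ ⊆ V := fun x hx => (hB₀s hx).2
  have hAB₀ : A₀ ∩ B₀ ⊆ interior C := by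
    rintro x ⟨hx, hx'⟩
    rcases (hA₀s hx).1 with h | h
    · exact absurd (hB₀s hx').1 (Set.disjoint_left.1 hOO h)
    · exact h
  -- common base
  let N₀ : Set X := interior N₁ ∩ interior N₂
  have hN₀o : IsOpen N₀ := isOpen_interior.inter isOpen_interior
  have hbN₀ : p y ∈ N₀ := ⟨mem_interior_iff_mem_nhds.2 hN₁, mem_interior_iff_mem_nhds.2 hN₂⟩
  have h01 : N₀ ⊆ N₁ := inter_subset_left.trans interior_subset
  have h02 : N₀ ⊆ N₂ := inter_subset_right.trans interior_subset
  obtain ⟨N', hN'o, hbN', hN', g', hg', hg'C, hg'O⟩ := adjust hL hV hN₀o hbN₀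
    (chart_restrict hf (subset_refl U) h01 hU hN₀o) (chart_restrict hg (subset_refl V) h02 hV hN₀o)
    isOpen_interior hC hK hCK interior_subset (hKUV.trans inter_subset_left)
    (hKUV.trans inter_subset_right)
  have hCV : C ⊆ V := hCK.trans (interior_subset.trans (hKUV.trans inter_subset_right))
  obtain ⟨N, hNo, hbN, hN, h, hh, hhf, hhg⟩ := glue hN'o hbN'
    (chart_restrict hf (subset_refl U) (hN'.trans h01) hU hN'o) hg' hA₀ hB₀ hA₀U hB₀V hAB₀
    (fun x hxU hxV hxC t => (hg'C x hxC t t.2).symm) hCV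
  refine ⟨interior A₀ ∪ interior B₀, isOpen_interior.union isOpen_interior,
    union_subset_union hAA₀ hBB₀, N, hNo.mem_nhds hbN, h, hh, ?_, ?_⟩
  · refine ⟨interior A₀, isOpen_interior, hAA₀, subset_union_left, interior_subset.trans hA₀U,
      N, hNo.mem_nhds hbN, subset_refl _, hN.trans (hN'.trans h01), fun x hx t ht => ?_⟩
    exact hhf x (interior_subset hx) _ t ht
  · refine ⟨interior B₀ \ K, isOpen_interior.sdiff hK.isClosed, ?_,
      sdiff_subset.trans subset_union_right, sdiff_subset.trans (interior_subset.trans hB₀V),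
      N, hNo.mem_nhds hbN, subset_refl _, hN.trans (hN'.trans h02), fun x hx t ht => ?_⟩
    · rintro x ⟨hx, hxU⟩
      exact ⟨hBB₀ hx, fun h => hxU (hKUV h).1⟩
    · refine (hhg x (interior_subset hx.1) _ t ht).trans ?_
      exact hg'O x _ t _ (fun h => hx.2 (interior_subset h))
end

section
/- Let X be a locally compact, locally connected metric space such that the Lipschitz deformation principle L(X) holds, and let W, V, U be open subsets of X with cl(W) ⊆ V ⊆ cl(V) ⊆ U and with the boundary of V compact. Then there exist δ₀ > 0 and an increasing continuous function χ : [0,∞) → [0,∞) with χ(0)=0 such that for every 0 < δ ≤ δ₀ and every open Lipschitz embedding h : U → X that is sufficiently near the inclusion in the compact-open topology and satisfies d(h(x), x) < δ for all x ∈ U, there exists an open Lipschitz immersion h̃ : U → X with d(h̃(x), x) ≤ χ(δ) for all x ∈ U, h̃ = inclusion on U ∖ V, and h̃ = h on W. -/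
open Topology Metric Set

universe u v

/-- An open Lipschitz immersion: a map which is locally an open Lipschitz embedding. -/
def IsOpenLipschitzImmersion {X Y : Type*} [MetricSpace X] [MetricSpace Y] (f : X → Y) : Prop :=
  ∀ x : X, ∃ O : Set X, IsOpen O ∧ x ∈ O ∧
    IsOpenLipschitzEmbedding (fun z : ↥O => f z)

/-- An increasing continuous function `χ : [0,∞) → [0,∞)` with `χ(0) = 0`. -/
def IsModulus (χ : ℝ → ℝ) : Prop :=
  Continuous χ ∧ Monotone χ ∧ χ 0 = 0 ∧ ∀ x, 0 ≤ χ x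

theorem aux_modulus (P : ℝ → ℝ → Prop) (hmono : ∀ δ ε ε', ε ≤ ε' → P δ ε → P δ ε')
    (hP : ∀ ε > 0, ∃ η > 0, ∀ δ, 0 < δ → δ ≤ η → P δ ε) :
    ∃ δ₀ > (0:ℝ), ∃ χ : ℝ → ℝ, IsModulus χ ∧ ∀ δ, 0 < δ → δ ≤ δ₀ → P δ (χ δ) := by
  have h2 : ∀ n : ℕ, (0:ℝ) < (1/2)^n := fun n => by positivity
  choose η' hη' hP' using fun n : ℕ => hP ((1/2)^n) (h2 n)
  let η : ℕ → ℝ := fun n => min (η' n) ((1/2)^n)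
  have hη : ∀ n, 0 < η n := fun n => lt_min (hη' n) (h2 n)
  have hPη : ∀ n δ, 0 < δ → δ ≤ η n → P δ ((1/2)^n) := fun n δ h0 h1 =>
    hP' n δ h0 (h1.trans (min_le_left _ _))
  let f : ℕ → ℝ → ℝ := fun n t => (1/2)^n * max 0 (min 1 (t / η (n+1)))
  have hf0 : ∀ n t, 0 ≤ f n t := fun n t => mul_nonneg (h2 n).le (le_max_left _ _)
  have hf1 : ∀ n t, f n t ≤ (1/2)^n := fun n t =>
    mul_le_of_le_one_right (h2 n).le (max_le zero_le_one (min_le_left _ _))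
  have hsum : Summable (fun n : ℕ => ((1:ℝ)/2)^n) := summable_geometric_two
  have hs : ∀ t, Summable (fun n => f n t) := fun t =>
    Summable.of_nonneg_of_le (fun n => hf0 n t) (fun n => hf1 n t) hsum
  have hmf : ∀ n, Monotone (f n) := by
    intro n a b hab
    refine mul_le_mul_of_nonneg_left ?_ (h2 n).le
    exact max_le_max le_rfl (min_le_min le_rfl (div_le_div_of_nonneg_right hab (hη _).le))
  refine ⟨η 0, hη 0, fun t => ∑' n, f n t, ⟨?_, ?_, ?_, ?_⟩, ?_⟩
  · refine continuous_tsum (u := fun n : ℕ => ((1:ℝ)/2)^n) (fun n => ?_) hsum (fun n t => ?_)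
    · fun_prop
    · rw [Real.norm_of_nonneg (hf0 n t)]
      exact hf1 n t
  · intro a b hab
    exact (hs a).tsum_le_tsum (fun n => hmf n hab) (hs b)
  · simp [f]
  · intro t
    exact tsum_nonneg (fun n => hf0 n t)
  · intro δ hδ hδ0
    have hex : ∃ m, η m < δ := by
      obtain ⟨m, hm⟩ := exists_pow_lt_of_lt_one hδ (show (1:ℝ)/2 < 1 by norm_num)
      exact ⟨m, (min_le_right _ _).trans_lt hm⟩
    classical
    obtain ⟨m, hm⟩ : ∃ m, m = Nat.find hex := ⟨_, rfl⟩
    have hm1 : η m < δ := hm ▸ Nat.find_spec hex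
    cases m with
    | zero => linarith
    | succ n =>
      have hn : δ ≤ η n := not_lt.1 (Nat.find_min hex (by omega))
      refine hmono δ _ _ ?_ (hPη n δ hδ hn)
      have h3 : f n δ = (1/2)^n := by
        have h4 : 1 ≤ δ / η (n+1) := (one_le_div (hη _)).2 hm1.le
        simp only [f]
        rw [min_eq_left h4, max_eq_right zero_le_one, mul_one]
      have := (hs δ).le_tsum n (fun j _ => hf0 j δ)
      linarith

theorem aux_val {X : Type*} [MetricSpace X] {O : Set X} (hO : IsOpen O) :
    IsOpenLipschitzEmbedding (fun z : ↥O => (z : X)) := by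
  refine ⟨⟨Subtype.val_injective, (LipschitzWith.subtype_val O).locallyLipschitz,
    fun z => ⟨z.1, by obtain ⟨y, hy⟩ := z.2; exact hy ▸ y.2⟩, fun z => rfl, ?_⟩, ?_⟩
  · exact LipschitzWith.locallyLipschitz (K := 1) (fun a b => by simp [Subtype.edist_eq])
  · simpa using hO

theorem aux_comp {X Y Z : Type*} [MetricSpace X] [MetricSpace Y] [MetricSpace Z]
    {f : X → Y} {g : Y → Z} (hg : IsOpenLipschitzEmbedding g)
    (hf : IsOpenLipschitzEmbedding f) : IsOpenLipschitzEmbedding (fun x => g (f x)) := by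
  obtain ⟨⟨gi, gl, g1, g1i, g1l⟩, go⟩ := hg
  obtain ⟨⟨fi, fl, f1, f1i, f1l⟩, fo⟩ := hf
  have hg1 : ∀ y (h : g y ∈ range g), g1 ⟨g y, h⟩ = y := fun y _ => g1i y
  have hf1 : ∀ y (h : f y ∈ range f), f1 ⟨f y, h⟩ = y := fun y _ => f1i y
  have hr : ∀ z : range (fun x => g (f x)), (z : Z) ∈ range g := by
    rintro ⟨_, x, rfl⟩
    exact ⟨f x, rfl⟩
  have hr2 : ∀ z : range (fun x => g (f x)), g1 ⟨z, hr z⟩ ∈ range f := by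
    rintro ⟨_, x, rfl⟩
    exact ⟨x, (hg1 _ _).symm⟩
  refine ⟨⟨gi.comp fi, gl.comp fl, fun z => f1 ⟨g1 ⟨z, hr z⟩, hr2 z⟩, ?_, ?_⟩, ?_⟩
  · intro x
    have : (⟨g1 ⟨g (f x), hr ⟨_, x, rfl⟩⟩, hr2 ⟨_, x, rfl⟩⟩ : range f) = ⟨f x, x, rfl⟩ :=
      Subtype.ext (hg1 _ _)
    exact (congrArg f1 this).trans (hf1 _ _)
  · have h1 : LocallyLipschitz (fun z : range (fun x => g (f x)) => (⟨z, hr z⟩ : range g)) :=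
      LipschitzWith.locallyLipschitz (K := 1) (fun a b => by simp [Subtype.edist_eq])
    have h2 : LocallyLipschitz (fun z : range (fun x => g (f x)) => g1 ⟨z, hr z⟩) := g1l.comp h1
    have h3 : LocallyLipschitz
        (fun z : range (fun x => g (f x)) => (⟨g1 ⟨z, hr z⟩, hr2 z⟩ : range f)) := by
      intro z
      obtain ⟨K, t, ht, hK⟩ := h2 z
      exact ⟨K, t, ht, fun a ha b hb => hK ha hb⟩
    exact f1l.comp h3
  · have h1 : IsOpen (g1 ⁻¹' (range f)) := fo.preimage g1l.continuous
    have h2 := go.isOpenMap_subtype_val _ h1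
    convert h2 using 1
    ext z
    constructor
    · rintro ⟨x, rfl⟩
      exact ⟨⟨g (f x), f x, rfl⟩, ⟨x, (hg1 _ _).symm⟩, rfl⟩
    · rintro ⟨⟨_, y, rfl⟩, ⟨x, hx⟩, rfl⟩
      have hx := hx.trans (hg1 y ⟨y, rfl⟩)
      exact ⟨x, by simp [hx]⟩

theorem aux_inv {X : Type*} [MetricSpace X] {E : X → X} (hE : IsLipschitzIso E) :
    ∃ e : X → X, (∀ x, e (E x) = x) ∧ (∀ y, E (e y) = y) ∧ IsOpenLipschitzEmbedding e := by
  obtain ⟨⟨Ei, El, g, gi, gl⟩, Es⟩ := hE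
  have hl : ∀ x, g ⟨E x, Es _⟩ = x := fun x => gi x
  have hr : ∀ y, E (g ⟨y, Es y⟩) = y := by
    intro y
    obtain ⟨x, rfl⟩ := Es y
    rw [hl]
  refine ⟨fun y => g ⟨y, Es y⟩, hl, hr, ⟨?_, ?_, fun z => E z, ?_, ?_⟩, ?_⟩
  · exact Function.LeftInverse.injective (g := E) hr
  · exact gl.comp (LipschitzWith.locallyLipschitz (K := 1)
      (f := fun y : X => (⟨y, Es y⟩ : range E)) (fun a b => by simp [Subtype.edist_eq]))
  · exact hr
  · exact El.comp (LipschitzWith.subtype_val _).locallyLipschitz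
  · have : range (fun y => g ⟨y, Es y⟩) = univ :=
      Function.Surjective.range_eq (fun x => ⟨E x, hl x⟩)
    rw [this]
    exact isOpen_univ

theorem aux_nhds {X : Type*} [MetricSpace X] {U : Set X} {M : Set C(↥U, X)}
    (hM : M ∈ 𝓝 (inclCM U)) :
    ∃ η > 0, ∀ k : C(↥U, X), (∀ x : ↥U, dist (k x) (x : X) < η) → k ∈ M := by
  obtain ⟨S, hS, hSM⟩ := UniformSpace.mem_nhds_iff.1 hM
  obtain ⟨K, T, -, hT, hKT⟩ := (ContinuousMap.mem_compactConvergence_entourage_iff S).1 hS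
  obtain ⟨η, hη, hηT⟩ := Metric.mem_uniformity_dist.1 hT
  refine ⟨η, hη, fun k hk => hSM (hKT fun x _ => hηT ?_)⟩
  have := hk x
  rw [dist_comm] at this
  exact this

theorem aux_nhds2 {X : Type*} [MetricSpace X] {K : Set X} (hK : IsCompact K) {ε : ℝ}
    (hε : 0 < ε) :
    {f : C(X, X) | ∀ y ∈ K, dist (f y) y < ε} ∈ 𝓝 (ContinuousMap.id X) := by
  have : {fg : C(X, X) × C(X, X) | ∀ x ∈ K, (fg.1 x, fg.2 x) ∈ {p : X × X | dist p.1 p.2 < ε}}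
      ∈ uniformity C(X, X) :=
    (ContinuousMap.mem_compactConvergence_entourage_iff _).2
      ⟨K, _, hK, Metric.dist_mem_uniformity hε, Subset.rfl⟩
  have h2 := UniformSpace.ball_mem_nhds (ContinuousMap.id X) this
  refine Filter.mem_of_superset h2 ?_
  intro f hf y hy
  have h3 := hf y hy
  rw [dist_comm]
  exact h3

/-- **Lipschitz deformation lemma** (Proposition 5.1).  Let `X` be locally compact and locally
connected with `L(X)` and let `W, V, U` be open with `cl W ⊆ V ⊆ cl V ⊆ U` and `∂V` compact.
Then there are `δ₀ > 0` and a modulus `χ` such that every open Lipschitz embedding `h : U → X`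
sufficiently near the inclusion which is `δ`-close to the inclusion (`0 < δ ≤ δ₀`) admits an
open Lipschitz immersion `h̃ : U → X` which is `χ(δ)`-close to the inclusion, equals the
inclusion on `U ∖ V` and equals `h` on `W`. -/
theorem lipschitz_deformation_lemma
    {X : Type u} [MetricSpace X] [LocallyCompactSpace X] [LocallyConnectedSpace X]
    (hL : LipschitzDeformationPrinciple X)
    (W V U : Set X) (hW : IsOpen W) (hV : IsOpen V) (hU : IsOpen U)
    (hWV : closure W ⊆ V) (hVU : closure V ⊆ U) (hfr : IsCompact (frontier V)) :
    ∃ δ₀ > (0:ℝ), ∃ χ : ℝ → ℝ, IsModulus χ ∧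
      ∃ N ∈ 𝓝 (inclCM U), ∀ δ : ℝ, 0 < δ → δ ≤ δ₀ →
        ∀ h : C(↥U, X), h ∈ N → IsOpenLipschitzEmbedding (⇑h : ↥U → X) →
          (∀ x : ↥U, dist (h x) (x : X) < δ) →
          ∃ ht : ↥U → X, IsOpenLipschitzImmersion ht ∧
            (∀ x : ↥U, dist (ht x) (x : X) ≤ χ δ) ∧
            (∀ x : ↥U, (x : X) ∉ V → ht x = (x : X)) ∧
            (∀ x : ↥U, (x : X) ∈ W → ht x = h x) := by
  suffices key : ∀ ε > (0:ℝ), ∃ η > (0:ℝ), ∀ δ : ℝ, 0 < δ → δ ≤ η → ∀ h : C(↥U, X),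
      IsOpenLipschitzEmbedding (⇑h : ↥U → X) →
          (∀ x : ↥U, dist (h x) (x : X) < δ) →
          ∃ ht : ↥U → X, IsOpenLipschitzImmersion ht ∧
            (∀ x : ↥U, dist (ht x) (x : X) ≤ ε) ∧
            (∀ x : ↥U, (x : X) ∉ V → ht x = (x : X)) ∧
            (∀ x : ↥U, (x : X) ∈ W → ht x = h x) by
    obtain ⟨δ₀, h0, χ, hχ, H⟩ := aux_modulus _ (fun δ ε ε' hε hP h hh hd => by
      obtain ⟨ht, a, b, c⟩ := hP h hh hd
      exact ⟨ht, a, fun x => (b x).trans hε, c⟩) key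
    exact ⟨δ₀, h0, χ, hχ, univ, Filter.univ_mem, fun δ hδ hδ0 h _ => H δ hδ hδ0 h⟩
  intro ε hε
  have hfrU : frontier V ⊆ U ∩ (closure W)ᶜ := by
    intro x hx
    refine ⟨hVU hx.1, fun hxW => ?_⟩
    rw [hV.frontier_eq] at hx
    exact hx.2 (hWV hxW)
  obtain ⟨C, hC, hfC, hCU⟩ :=
    exists_compact_between hfr (hU.inter isClosed_closure.isOpen_compl) hfrU
  obtain ⟨K, hK, hCK, hKU⟩ :=
    exists_compact_between hC (hU.inter isClosed_closure.isOpen_compl) hCU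
  have hdisj : Disjoint K (closure W) := by
    rw [Set.disjoint_left]
    exact fun x hx => (hKU hx).2
  obtain ⟨r, hr, hthick⟩ := hdisj.exists_thickenings hK isClosed_closure
  obtain ⟨N, hN, D, hDc, hDi, hD⟩ := hL (interior K) isOpen_interior C hC hCK
  have hOU : interior K ⊆ U := fun x hx => (hKU (interior_subset hx)).1
  have hiE : IsOpenLipschitzEmbedding (⇑(inclCM (interior K)) : ↥(interior K) → X) :=
    aux_val isOpen_interior
  have hcont := hDc (inclCM (interior K)) ⟨mem_of_mem_nhds hN, hiE⟩
  have hnb := aux_nhds2 hK (half_pos hε)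
  rw [← hDi] at hnb
  obtain ⟨M, hM, hMD⟩ := mem_nhdsWithin_iff_exists_mem_nhds_inter.1 (hcont hnb)
  obtain ⟨η, hη, hηM⟩ := aux_nhds (Filter.inter_mem hM hN)
  refine ⟨min η (min r (ε / 2)), lt_min hη (lt_min hr (half_pos hε)), ?_⟩
  intro δ hδ hδη h hh hd
  have hδ1 : δ ≤ η := hδη.trans (min_le_left _ _)
  have hδ2 : δ ≤ r := hδη.trans ((min_le_right _ _).trans (min_le_left _ _))
  have hδ3 : δ ≤ ε / 2 := hδη.trans ((min_le_right _ _).trans (min_le_right _ _))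
  let k : C(↥(interior K), X) := h.comp ⟨Set.inclusion hOU, continuous_inclusion hOU⟩
  have hkd : ∀ x : ↥(interior K), dist (k x) (x : X) < η := fun x =>
    (hd (Set.inclusion hOU x)).trans_le hδ1
  have hkM := hηM k hkd
  have hincl : IsOpenLipschitzEmbedding (Set.inclusion hOU) := by
    refine ⟨⟨Set.inclusion_injective hOU,
      LipschitzWith.locallyLipschitz (K := 1) (fun a b => by simp [Subtype.edist_eq]),
      fun z => ⟨z.1.1, ?_⟩, fun z => rfl, ?_⟩, ?_⟩
    · obtain ⟨y, hy⟩ := z.2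
      rw [← hy]
      exact y.2
    · exact LipschitzWith.locallyLipschitz (K := 1) (fun a b => by simp [Subtype.edist_eq])
    · rw [Set.range_inclusion]
      exact isOpen_interior.preimage continuous_subtype_val
  have hkE : IsOpenLipschitzEmbedding (⇑k : ↥(interior K) → X) :=
    aux_comp (f := Set.inclusion hOU) (g := h) hh hincl
  obtain ⟨hiso, hDC, hDO⟩ := hD k hkM.2 hkE
  have hDε : ∀ y ∈ K, dist (D k y) y < ε / 2 := hMD ⟨hkM.1, hkM.2, hkE⟩
  obtain ⟨e, heE, hEe, he⟩ := aux_inv hiso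
  have heO : ∀ y, y ∉ interior K → e y = y := fun y hy => by
    conv_lhs => rw [← hDO y hy]
    exact heE y
  have hede : ∀ y, dist (e y) y ≤ ε / 2 := by
    intro y
    by_cases hy : e y ∈ interior K
    · have := hDε _ (interior_subset hy)
      rw [hEe, dist_comm] at this
      exact this.le
    · have := hDO _ hy
      rw [hEe] at this
      rw [← this, dist_self]
      positivity
  have heC : ∀ x : ↥U, (x : X) ∈ C → e (h x) = x := by
    intro x hx
    have h1 : D k x = h x := hDC ⟨x, hCK hx⟩ hx
    rw [← h1]
    exact heE _
  classical
  refine ⟨fun x => if (x : X) ∈ V then e (h x) else x, ?_, ?_, ?_, ?_⟩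
  · intro x
    by_cases hx : (x : X) ∈ V
    · have hO : IsOpen ((↑) ⁻¹' V : Set ↥U) := hV.preimage continuous_subtype_val
      refine ⟨_, hO, hx, ?_⟩
      have := aux_comp he (aux_comp hh (aux_val hO))
      convert this using 2 with z
      exact if_pos z.2
    · have hO : IsOpen ((↑) ⁻¹' (interior C ∪ (closure V)ᶜ) : Set ↥U) :=
        (isOpen_interior.union isClosed_closure.isOpen_compl).preimage continuous_subtype_val
      refine ⟨_, hO, ?_, ?_⟩
      · by_cases hx2 : (x : X) ∈ closure V
        · left
          apply hfC
          rw [hV.frontier_eq]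
          exact ⟨hx2, hx⟩
        · right
          exact hx2
      · have := aux_comp (aux_val hU) (aux_val hO)
        convert this using 2 with z
        dsimp only
        split_ifs with hz
        · rcases z.2 with h1 | h1
          · exact heC _ (interior_subset h1)
          · exact absurd (subset_closure hz) h1
        · rfl
  · intro x
    dsimp only
    split_ifs
    · have h1 := hede (h x)
      have h2 := hd x
      have h3 := dist_triangle (e (h x)) (h x) x
      linarith
    · rw [dist_self]
      exact hε.le
  · intro x hx
    exact if_neg hx
  · intro x hx
    dsimp only
    rw [if_pos (hWV (subset_closure hx))]
    apply heO
    intro hm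
    refine Set.disjoint_left.1 hthick (self_subset_thickening hr _ (interior_subset hm)) ?_
    exact mem_thickening_iff.2 ⟨x, subset_closure hx, (hd x).trans_le hδ2⟩
end

section
/- Let (X, d_X) be a compact metric space and let cX be the open cone on X with the quotient topology. Then the topology of cX is metrizable by a metric d satisfying: (1) d(α·p, α·q) = α·d(p, q) for all α ∈ [0,∞) and all p, q ∈ cX; and (2) d(α·q, β·q) = |α − β|·d(v, q) for all α, β ∈ [0,∞) and all q ∈ cX, where v is the cone point. -/
open Topology Metric Set
open scoped NNReal

universe u v


section Cone

open scoped NNReal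

/-- The setoid on `X × [0,∞)` collapsing `X × {0}` to a point. -/
def coneSetoid (X : Type u) : Setoid (X × ℝ≥0) where
  r a b := a = b ∨ (a.2 = 0 ∧ b.2 = 0)
  iseqv := by
    refine ⟨fun a => Or.inl rfl, ?_, ?_⟩
    · rintro a b (rfl | ⟨h1, h2⟩)
      · exact Or.inl rfl
      · exact Or.inr ⟨h2, h1⟩
    · rintro a b c (rfl | ⟨h1, h2⟩) (rfl | ⟨h3, h4⟩)
      · exact Or.inl rfl
      · exact Or.inr ⟨h3, h4⟩
      · exact Or.inr ⟨h1, h2⟩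
      · exact Or.inr ⟨h1, h4⟩

/-- The open cone over `X`: the quotient `(X × [0,∞)) / (X × {0})`, carrying the quotient
topology when `X` is a topological space. -/
abbrev OpenCone (X : Type u) := Quotient (coneSetoid X)

/-- The cone point (apex) of the open cone. -/
noncomputable def conePoint (X : Type u) [Nonempty X] : OpenCone X :=
  Quotient.mk (coneSetoid X) (Classical.arbitrary X, 0)

/-- The scaling action of `α ∈ [0,∞)` on the open cone: `α • (s·x) = (αs)·x`. -/
def coneSmul {X : Type u} (α : ℝ≥0) : OpenCone X → OpenCone X :=
  Quotient.map (fun q => (q.1, α * q.2)) (by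
    rintro ⟨x, s⟩ ⟨y, t⟩ (h | ⟨hs, ht⟩)
    · exact Or.inl (by cases h; rfl)
    · exact Or.inr ⟨by simp [show s = 0 from hs], by simp [show t = 0 from ht]⟩)

/-- The quotient topology on the open cone. -/
def coneQuotTop (X : Type u) [TopologicalSpace X] : TopologicalSpace (OpenCone X) :=
  instTopologicalSpaceQuotient

end Cone

/-- Proposition 5.2 (after Gauld): if `X` is a compact metric space then the open cone `cX`
is metrizable by a metric `d` with `d(αp, αq) = α d(p,q)` and
`d(αq, βq) = |α − β| d(v, q)`, where `v` is the cone point. -/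
theorem openCone_metrizable (X : Type u) [MetricSpace X] [CompactSpace X] [Nonempty X] :
    ∃ m : MetricSpace (OpenCone X),
      m.toUniformSpace.toTopologicalSpace = coneQuotTop X ∧
      (∀ (α : ℝ≥0) (p q : OpenCone X),
        m.dist (coneSmul α p) (coneSmul α q) = (α : ℝ) * m.dist p q) ∧
      (∀ (α β : ℝ≥0) (q : OpenCone X),
        m.dist (coneSmul α q) (coneSmul β q) = |(α : ℝ) - (β : ℝ)| * m.dist (conePoint X) q) := by
  obtain ⟨k, hk⟩ : ∃ k : X → lp (fun _ : ℕ => ℝ) ⊤, Isometry k :=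
    ⟨_, kuratowskiEmbedding.isometry X⟩
  let g : X × ℝ≥0 → ℝ × lp (fun _ : ℕ => ℝ) ⊤ := fun a => ((a.2 : ℝ), (a.2 : ℝ) • k a.1)
  have hg : ∀ a b : X × ℝ≥0, (coneSetoid X).r a b → g a = g b := by
    rintro ⟨x, s⟩ ⟨y, t⟩ (h | ⟨hs, ht⟩)
    · rw [h]
    · have hs : s = 0 := hs
      have ht : t = 0 := ht
      simp [g, hs, ht]
  let φ : OpenCone X → ℝ × lp (fun _ : ℕ => ℝ) ⊤ := Quotient.lift g hg
  have hgc : Continuous g := by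
    have := hk.continuous
    fun_prop
  have hφi : Function.Injective φ := by
    rintro ⟨x, s⟩ ⟨y, t⟩ h
    have h : g (x, s) = g (y, t) := h
    apply Quotient.sound
    have h1 : s = t := by simpa [g] using congrArg Prod.fst h
    subst h1
    by_cases hs : s = 0
    · exact Or.inr ⟨hs, hs⟩
    · left
      have h2 : (s : ℝ) • k x = (s : ℝ) • k y := congrArg Prod.snd h
      have h3 := smul_right_injective _ (NNReal.coe_ne_zero.2 hs) h2
      rw [hk.injective h3]
  have hprop : IsProperMap g := by
    apply isProperMap_of_comp_of_t2 hgc continuous_fst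
    have h1 : IsProperMap (Prod.snd : X × ℝ≥0 → ℝ≥0) := isProperMap_snd_of_compactSpace
    have h2 : IsProperMap ((↑) : ℝ≥0 → ℝ) :=
      (IsClosed.isClosedEmbedding_subtypeVal isClosed_Ici).isProperMap
    exact h2.comp h1
  have hφe : @IsClosedEmbedding _ _ (coneQuotTop X) _ φ := by
    letI := coneQuotTop X
    refine IsClosedEmbedding.of_continuous_injective_isClosedMap (hgc.quotient_lift hg) hφi ?_
    intro C hC
    have : φ '' C = g '' (Quotient.mk (coneSetoid X) ⁻¹' C) := by
      ext z
      constructor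
      · rintro ⟨⟨a⟩, ha, rfl⟩
        exact ⟨a, ha, rfl⟩
      · rintro ⟨a, ha, rfl⟩
        exact ⟨_, ha, rfl⟩
    rw [this]
    exact hprop.isClosedMap _ (hC.preimage continuous_quotient_mk')
  have hsm : ∀ (α : ℝ≥0) (p : OpenCone X), φ (coneSmul α p) = (α : ℝ) • φ p := by
    rintro α ⟨x, s⟩
    change g (x, α * s) = (α : ℝ) • g (x, s)
    simp [g, mul_smul]
  have hv : φ (conePoint X) = 0 := by
    change g (_, 0) = 0
    simp [g]
  refine ⟨MetricSpace.induced φ hφi inferInstance, ?_, ?_, ?_⟩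
  · exact hφe.toIsEmbedding.toIsInducing.eq_induced.symm
  · intro α p q
    change dist (φ _) (φ _) = α * dist (φ _) (φ _)
    rw [hsm, hsm, dist_smul₀]
    simp
  · intro α β q
    change dist (φ _) (φ _) = _ * dist (φ _) (φ _)
    rw [hsm, hsm, hv, dist_zero_left, dist_eq_norm, ← sub_smul, norm_smul, Real.norm_eq_abs]
end

section
/- Let X be a compact, locally connected metric space and equip the open cone cX with a metric d satisfying d(α·p, α·q) = α·d(p, q) for all α ∈ [0,∞), p, q ∈ cX, and d(α·q, β·q) = |α − β|·d(v, q) for all α, β ∈ [0,∞), q ∈ cX, where v is the cone point (such a metric exists). Let h : cX → cX be a Lipschitz isomorphism that equals the identity outside a fixed compact subset of cX. Then there exists an isotopy h_t : cX → cX (0 ≤ t ≤ 1), with (t, p) ↦ h_t(p) continuous and each h_t a Lipschitz isomorphism, such that h₀ = h and h₁ = identity. -/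
open Topology Metric Set
open scoped NNReal

universe u v

theorem lipIso_of_inv {C : Type u} [MetricSpace C] {f g : C → C}
    (hf : LocallyLipschitz f) (hg : LocallyLipschitz g)
    (h1 : ∀ p, g (f p) = p) (h2 : ∀ p, f (g p) = p) : IsLipschitzIso f :=
  ⟨⟨Function.LeftInverse.injective h1, hf, fun y => g y.1, fun p => h1 p,
    hg.comp (LipschitzWith.subtype_val _).locallyLipschitz⟩, fun p => ⟨g p, h2 p⟩⟩

theorem lipIso_inv {C : Type u} [MetricSpace C] {f : C → C} (h : IsLipschitzIso f) :
    LocallyLipschitz f ∧ ∃ g : C → C, LocallyLipschitz g ∧ (∀ p, g (f p) = p) ∧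
      ∀ p, f (g p) = p := by
  obtain ⟨⟨hi, hf, g, hgl, hg⟩, hs⟩ := h
  have key : ∀ p, g ⟨f p, mem_range_self p⟩ = p := fun p => hgl p
  refine ⟨hf, fun p => g ⟨p, hs p⟩, ?_, key, ?_⟩
  · refine LocallyLipschitz.comp (f := g) (g := fun p : C => (⟨p, hs p⟩ : Set.range f)) hg ?_
    apply LipschitzWith.locallyLipschitz (K := 1)
    intro x y
    simp [Subtype.edist_eq]
  · intro p
    obtain ⟨q, rfl⟩ := hs p
    show f (g ⟨f q, mem_range_self q⟩) = f q
    rw [key]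

theorem alexander_aux {C : Type u} [MetricSpace C] (v : C) (s : ℝ≥0 → C → C)
    (s1 : ∀ p, s 1 p = p) (smul : ∀ a b p, s a (s b p) = s (a * b) p)
    (hd1 : ∀ (α : ℝ≥0) (p q : C), dist (s α p) (s α q) = (α : ℝ) * dist p q)
    (hd2 : ∀ (α β : ℝ≥0) (q : C), dist (s α q) (s β q) = |(α : ℝ) - (β : ℝ)| * dist v q)
    (h : C → C) (hh : IsLipschitzIso h)
    (hK : ∃ K : Set C, IsCompact K ∧ ∀ p ∉ K, h p = p) :
    ∃ H : ↥(Set.Icc (0:ℝ) 1) → C → C,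
        Continuous (fun q : ↥(Set.Icc (0:ℝ) 1) × C => H q.1 q.2) ∧
        (∀ t, IsLipschitzIso (H t)) ∧
        (∀ p, H ⟨0, Set.left_mem_Icc.2 zero_le_one⟩ p = h p) ∧
        (∀ p, H ⟨1, Set.right_mem_Icc.2 zero_le_one⟩ p = p) := by
  obtain ⟨hl, g, hg, hgh, hhg⟩ := lipIso_inv hh
  obtain ⟨K, hKc, hKid⟩ := hK
  have slip : ∀ a, LocallyLipschitz (s a) := fun a =>
    (LipschitzWith.of_dist_le_mul (K := a) fun p q => (hd1 a p q).le).locallyLipschitz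
  have scont : Continuous (fun q : ℝ≥0 × C => s q.1 q.2) := by
    rw [continuous_iff_continuousAt]
    rintro ⟨a, p⟩
    rw [ContinuousAt, tendsto_iff_dist_tendsto_zero]
    have hb : Filter.Tendsto (fun q : ℝ≥0 × C =>
        (q.1 : ℝ) * dist q.2 p + |(q.1 : ℝ) - (a : ℝ)| * dist v p) (𝓝 (a, p)) (𝓝 0) := by
      have : Continuous (fun q : ℝ≥0 × C =>
        (q.1 : ℝ) * dist q.2 p + |(q.1 : ℝ) - (a : ℝ)| * dist v p) := by fun_prop
      simpa using this.tendsto (a, p)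
    refine squeeze_zero (fun _ => dist_nonneg) (fun q => ?_) hb
    calc _ ≤ dist (s q.1 q.2) (s q.1 p) + dist (s q.1 p) (s a p) := dist_triangle _ _ _
      _ = _ := by rw [hd1, hd2]
  obtain ⟨M, hM0, hM⟩ : ∃ M : ℝ, 0 ≤ M ∧ ∀ p, dist (h p) p ≤ M := by
    have hc : Continuous (fun p => dist (h p) p) := hl.continuous.dist continuous_id
    obtain ⟨M, hM⟩ := (hKc.image hc).bddAbove
    refine ⟨max M 0, le_max_right _ _, fun p => ?_⟩
    by_cases hp : p ∈ K
    · exact (hM ⟨p, hp, rfl⟩).trans (le_max_left _ _)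
    · simp [hKid p hp]
  let a : ↥(Set.Icc (0:ℝ) 1) → ℝ≥0 := fun t => ⟨1 - t.1, sub_nonneg.2 t.2.2⟩
  have ac : Continuous a := by
    apply Continuous.subtype_mk; fun_prop
  have ai : ∀ t, a t ≠ 0 → ∀ p, s (a t) (s (a t)⁻¹ p) = p := fun t ht p => by
    rw [smul, mul_inv_cancel₀ ht, s1]
  have ai' : ∀ t, a t ≠ 0 → ∀ p, s (a t)⁻¹ (s (a t) p) = p := fun t ht p => by
    rw [smul, inv_mul_cancel₀ ht, s1]
  let H : ↥(Set.Icc (0:ℝ) 1) → C → C := fun t p =>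
    if a t = 0 then p else s (a t) (h (s (a t)⁻¹ p))
  have hH0 : ∀ t p, a t = 0 → H t p = p := fun t p ht => if_pos ht
  have hH1 : ∀ t p, a t ≠ 0 → H t p = s (a t) (h (s (a t)⁻¹ p)) := fun t p ht => if_neg ht
  have hHd : ∀ t p, dist (H t p) p ≤ a t * M := by
    intro t p
    by_cases ht : a t = 0
    · rw [hH0 t p ht, dist_self]; positivity
    · rw [hH1 t p ht]
      conv_lhs => rw [← ai t ht p, ai' t ht]
      rw [hd1]
      exact mul_le_mul_of_nonneg_left (hM _) (a t).2
  refine ⟨H, ?_, ?_, ?_, ?_⟩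
  · rw [continuous_iff_continuousAt]
    rintro ⟨t, p⟩
    by_cases ht : a t = 0
    · rw [ContinuousAt, tendsto_iff_dist_tendsto_zero]
      have hb : Filter.Tendsto (fun q : ↥(Set.Icc (0:ℝ) 1) × C =>
          (a q.1 : ℝ) * M + dist q.2 p) (𝓝 (t, p)) (𝓝 0) := by
        have : Continuous (fun q : ↥(Set.Icc (0:ℝ) 1) × C =>
          (a q.1 : ℝ) * M + dist q.2 p) := by fun_prop
        simpa [ht] using this.tendsto (t, p)
      refine squeeze_zero (fun _ => dist_nonneg) (fun q => ?_) hb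
      simp only [hH0 t p ht]
      exact (dist_triangle _ q.2 _).trans (add_le_add (hHd _ _) le_rfl)
    · have hev : ∀ᶠ q : ↥(Set.Icc (0:ℝ) 1) × C in 𝓝 (t, p),
          s (a q.1) (h (s (a q.1)⁻¹ q.2)) = H q.1 q.2 := by
        have : ∀ᶠ q : ↥(Set.Icc (0:ℝ) 1) × C in 𝓝 (t, p), a q.1 ≠ 0 :=
          (ac.comp continuous_fst).continuousAt.eventually_ne ht
        filter_upwards [this] with q hq
        exact (hH1 _ _ hq).symm
      refine ContinuousAt.congr ?_ hev
      have ha1 : ContinuousAt (fun q : ↥(Set.Icc (0:ℝ) 1) × C => a q.1) (t, p) :=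
        (ac.comp continuous_fst).continuousAt
      have h1 : ContinuousAt (fun q : ↥(Set.Icc (0:ℝ) 1) × C => s (a q.1)⁻¹ q.2) (t, p) :=
        scont.continuousAt.comp ((ha1.inv₀ ht).prodMk continuousAt_snd)
      have h2 : ContinuousAt (fun q : ↥(Set.Icc (0:ℝ) 1) × C => h (s (a q.1)⁻¹ q.2)) (t, p) :=
        hl.continuous.continuousAt.comp h1
      exact scont.continuousAt.comp (ha1.prodMk h2)
  · intro t
    by_cases ht : a t = 0
    · have : H t = id := funext fun p => hH0 t p ht
      rw [this]
      exact lipIso_of_inv LocallyLipschitz.id LocallyLipschitz.id (fun _ => rfl) fun _ => rfl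
    · have : H t = fun p => s (a t) (h (s (a t)⁻¹ p)) := funext fun p => hH1 t p ht
      rw [this]
      refine lipIso_of_inv (g := fun p => s (a t) (g (s (a t)⁻¹ p)))
        ((slip _).comp (hl.comp (slip _))) ((slip _).comp (hg.comp (slip _))) ?_ ?_
      · intro p; simp only [ai' t ht, hgh, ai t ht]
      · intro p; simp only [ai' t ht, hhg, ai t ht]
  · intro p
    have h1 : a ⟨0, Set.left_mem_Icc.2 zero_le_one⟩ = 1 := Subtype.ext (sub_zero 1)
    rw [hH1 _ _ (by rw [h1]; exact one_ne_zero), h1, inv_one, s1, s1]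
  · intro p
    exact hH0 _ _ (Subtype.ext (sub_self 1))

theorem coneSmul_one' {X : Type u} (p : OpenCone X) : coneSmul 1 p = p := by
  induction p using Quotient.inductionOn with
  | h q => simp [coneSmul]

theorem coneSmul_mul' {X : Type u} (a b : ℝ≥0) (p : OpenCone X) :
    coneSmul a (coneSmul b p) = coneSmul (a * b) p := by
  induction p using Quotient.inductionOn with
  | h q => simp [coneSmul, mul_assoc]

/-- **Alexander isotopy on cones** (Proposition 5.3).  Let `X` be a compact, locally connected
metric space and equip the open cone `cX` with a metric compatible with the cone topology and
homogeneous under scaling (`d(αp, αq) = α d(p,q)` and `d(αq, βq) = |α − β| d(v,q)`).  Every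
Lipschitz isomorphism `h : cX → cX` equal to the identity outside a fixed compactum is
isotopic to the identity through Lipschitz isomorphisms. -/
theorem alexander_isotopy_on_cone
    {X : Type u} [MetricSpace X] [CompactSpace X] [LocallyConnectedSpace X] [Nonempty X]
    (m : MetricSpace (OpenCone X))
    (hcompat : m.toUniformSpace.toTopologicalSpace = coneQuotTop X) :
    letI := m
    ∀ (hd1 : ∀ (α : ℝ≥0) (p q : OpenCone X),
        dist (coneSmul α p) (coneSmul α q) = (α : ℝ) * dist p q)
      (hd2 : ∀ (α β : ℝ≥0) (q : OpenCone X),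
        dist (coneSmul α q) (coneSmul β q) = |(α : ℝ) - (β : ℝ)| * dist (conePoint X) q)
      (h : OpenCone X → OpenCone X), IsLipschitzIso h →
      (∃ K : Set (OpenCone X), IsCompact K ∧ ∀ p ∉ K, h p = p) →
      ∃ H : ↥(Set.Icc (0:ℝ) 1) → OpenCone X → OpenCone X,
        Continuous (fun q : ↥(Set.Icc (0:ℝ) 1) × OpenCone X => H q.1 q.2) ∧
        (∀ t, IsLipschitzIso (H t)) ∧
        (∀ p, H ⟨0, Set.left_mem_Icc.2 zero_le_one⟩ p = h p) ∧
        (∀ p, H ⟨1, Set.right_mem_Icc.2 zero_le_one⟩ p = p) := by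
  intro hd1 hd2 h hh hK
  have e : m.toUniformSpace.toTopologicalSpace =
    (instTopologicalSpaceQuotient : TopologicalSpace (OpenCone X)) := hcompat
  rw [← e] at hK ⊢
  exact alexander_aux (conePoint X) coneSmul coneSmul_one' coneSmul_mul' hd1 hd2 h hh hK
end

section
/- Let B be a locally connected metric space and X a locally compact, locally connected metric space. Let V be open in X and let K be a closed subset of X contained in V whose boundary in V is compact. Let f_t : V → X (t ∈ B) be a family of open Lipschitz embeddings such that the induced map f(t,x) = (t, f_t(x)) is a Lipschitz isotopy that is locally L-bi-Lipschitz, f_b is the inclusion for some b ∈ B, and f_t(K) is closed in X for all t ∈ B. If the controlled deformation principle L′(V − K) holds, then there exist constants C, M ≥ 1 depending only on V − K (independent of f, L and B), a neighborhood N_b of b, and a family of Lipschitz isomorphisms F_t : X → X (t ∈ N_b) such that: (1) the induced map (t,x) ↦ (t, F_t(x)) is a Lipschitz isotopy whose local bi-Lipschitz constants are uniformly bounded by C·L^M; and (2) F_t = f_t on a neighborhood of K. -/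
open Topology Metric Set

universe u v

section BiLip

variable {X Y : Type*}

/-- `f` is (globally) `L`-bi-Lipschitz: `dist x y / L ≤ dist (f x) (f y) ≤ L * dist x y`. -/
def IsBiLipschitzWith [MetricSpace X] [MetricSpace Y] (L : ℝ) (f : X → Y) : Prop :=
  ∀ x y : X, dist x y / L ≤ dist (f x) (f y) ∧ dist (f x) (f y) ≤ L * dist x y

/-- `f` is locally `L`-bi-Lipschitz: every point has a neighbourhood on which
`dist x y / L ≤ dist (f x) (f y) ≤ L * dist x y`. -/
def IsLocallyBiLipschitzWith [MetricSpace X] [MetricSpace Y] (L : ℝ) (f : X → Y) : Prop :=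
  ∀ x : X, ∃ O ∈ 𝓝 x, ∀ a ∈ O, ∀ b ∈ O,
    dist a b / L ≤ dist (f a) (f b) ∧ dist (f a) (f b) ≤ L * dist a b

end BiLip

section Controlled

/-- The controlled principle `L′(X)`: `L(X)` together with constants `C, K ≥ 1`, depending
only on `X`, such that the deformation rule sends (locally) `L`-bi-Lipschitz Lipschitz
isotopies to (locally) `C L ^ K`-bi-Lipschitz Lipschitz isotopies. -/
def ControlledDeformationPrinciple (X : Type v) [MetricSpace X] : Prop :=
  ∃ Cc K : ℝ, 1 ≤ Cc ∧ 1 ≤ K ∧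
    ∀ U : Set X, IsOpen U → ∀ C : Set X, IsCompact C → C ⊆ U →
      ∃ N ∈ 𝓝 (inclCM U), ∃ D : C(↥U, X) → C(X, X), DeformationData U C N D ∧
        ∀ (Z : Type u) [MetricSpace Z] (h : Z → C(↥U, X)),
          (∀ t, h t ∈ N ∧ IsOpenLipschitzEmbedding (⇑(h t) : ↥U → X)) →
          IsLipschitzIsotopy (fun q : Z × ↥U => (q.1, h q.1 q.2)) →
          ∀ L : ℝ, 1 ≤ L →
            (IsLocallyBiLipschitzWith L (fun q : Z × ↥U => (q.1, h q.1 q.2)) →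
              IsLipschitzIsotopy (fun q : Z × X => (q.1, D (h q.1) q.2)) ∧
              IsLocallyBiLipschitzWith (Cc * L ^ K)
                (fun q : Z × X => (q.1, D (h q.1) q.2))) ∧
            (IsBiLipschitzWith L (fun q : Z × ↥U => (q.1, h q.1 q.2)) →
              IsLipschitzIsotopy (fun q : Z × X => (q.1, D (h q.1) q.2)) ∧
              IsBiLipschitzWith (Cc * L ^ K)
                (fun q : Z × X => (q.1, D (h q.1) q.2)))

end Controlled

def GoodAt {α β : Type*} [MetricSpace α] [MetricSpace β] (c : ℝ) (f : α → β) (p : α) : Prop :=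
  𝓝 (f p) = Filter.map f (𝓝 p) ∧ ∃ O ∈ 𝓝 p, ∀ a ∈ O, ∀ b ∈ O,
    dist a b / c ≤ dist (f a) (f b) ∧ dist (f a) (f b) ≤ c * dist a b

section Good
variable {α β α' β' : Type*} [MetricSpace α] [MetricSpace β] [MetricSpace α'] [MetricSpace β']

theorem GoodAt.congr {c : ℝ} {f g : α → β} {p : α} (h : GoodAt c f p) (e : g =ᶠ[𝓝 p] f) :
    GoodAt c g p := by
  obtain ⟨h1, O, hO, h2⟩ := h
  refine ⟨by rw [e.eq_of_nhds, h1, Filter.map_congr e], O ∩ {x | g x = f x},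
    Filter.inter_mem hO e, ?_⟩
  rintro a ⟨ha, ha'⟩ b ⟨hb, hb'⟩
  rw [show g a = f a from ha', show g b = f b from hb']
  exact h2 a ha b hb

theorem GoodAt.mono {c c' : ℝ} {f : α → β} {p : α} (h : GoodAt c f p) (hc : 0 < c)
    (hcc : c ≤ c') : GoodAt c' f p := by
  obtain ⟨h1, O, hO, h2⟩ := h
  refine ⟨h1, O, hO, fun a ha b hb => ⟨le_trans ?_ (h2 a ha b hb).1, (h2 a ha b hb).2.trans ?_⟩⟩
  · gcongr
  · gcongr

theorem goodAt_iff {c : ℝ} {ι : α → α'} {ι' : β → β'} {g : α → β} {G : α' → β'}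
    (hι : IsOpenEmbedding ι) (hi : Isometry ι) (hι' : IsOpenEmbedding ι') (hi' : Isometry ι')
    (e : ∀ p, G (ι p) = ι' (g p)) (p : α) : GoodAt c g p ↔ GoodAt c G (ι p) := by
  have e' : G ∘ ι = ι' ∘ g := funext e
  unfold GoodAt
  refine and_congr ?_ ?_
  · rw [e, ← hι.map_nhds_eq, ← hι'.map_nhds_eq, Filter.map_map, e', ← Filter.map_map]
    exact (Filter.map_injective hι'.injective).eq_iff.symm
  · constructor
    · rintro ⟨O, hO, h⟩
      refine ⟨ι '' O, hι.image_mem_nhds.2 hO, ?_⟩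
      rintro _ ⟨a, ha, rfl⟩ _ ⟨b, hb, rfl⟩
      rw [e, e, hi.dist_eq, hi'.dist_eq]
      exact h a ha b hb
    · rintro ⟨O, hO, h⟩
      refine ⟨ι ⁻¹' O, hι.continuous.continuousAt hO, ?_⟩
      intro a ha b hb
      have := h _ ha _ hb
      rwa [e, e, hi.dist_eq, hi'.dist_eq] at this

theorem good_openEmbedding {c : ℝ} {f : α → β} (hf : Function.Injective f)
    (h : ∀ p, GoodAt c f p) : IsOpenEmbedding f := by
  refine .of_continuous_injective_isOpenMap ?_ hf ?_
  · exact continuous_iff_continuousAt.2 fun p => (h p).1.ge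
  · exact IsOpenMap.of_nhds_le fun p => (h p).1.le

theorem good_lip {c : ℝ} (hc : 0 < c) {f : α → β} (hf : Function.Injective f)
    (h : ∀ p, GoodAt c f p) : IsLipschitzEmbedding f := by
  refine ⟨hf, ?_, fun y => (Equiv.ofInjective f hf).symm y, ?_, ?_⟩
  · intro p
    obtain ⟨h1, O, hO, h2⟩ := h p
    refine ⟨⟨c, hc.le⟩, O, hO, LipschitzOnWith.of_dist_le_mul fun a ha b hb => (h2 a ha b hb).2⟩
  · intro x
    exact (Equiv.ofInjective f hf).symm_apply_apply x
  · rintro ⟨_, p, rfl⟩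
    obtain ⟨h1, O, hO, h2⟩ := h p
    refine ⟨⟨c, hc.le⟩, Subtype.val ⁻¹' (f '' O), ?_, ?_⟩
    · apply continuous_subtype_val.continuousAt
      change _ ∈ 𝓝 (f p)
      rw [h1]
      exact Filter.image_mem_map hO
    · apply LipschitzOnWith.of_dist_le_mul
      rintro ⟨_, _⟩ ⟨a, ha, rfl⟩ ⟨_, _⟩ ⟨b, hb, rfl⟩
      have := (h2 a ha b hb).1
      rw [div_le_iff₀ hc, mul_comm] at this
      have ea : (Equiv.ofInjective f hf).symm ⟨f a, mem_range_self a⟩ = a :=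
        (Equiv.ofInjective f hf).symm_apply_apply a
      have eb : (Equiv.ofInjective f hf).symm ⟨f b, mem_range_self b⟩ = b :=
        (Equiv.ofInjective f hf).symm_apply_apply b
      simp only [ea, eb]
      exact this

theorem good_of_emb {c : ℝ} {f : α → β} (hf : IsOpenEmbedding f)
    (h : IsLocallyBiLipschitzWith c f) (p : α) : GoodAt c f p :=
  ⟨(hf.map_nhds_eq p).symm, h p⟩

theorem goodAt_id (p : α) : GoodAt 1 (fun x : α => x) p :=
  ⟨Filter.map_id.symm, univ, Filter.univ_mem, fun a _ b _ => by simp⟩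

theorem good_slice {c : ℝ} {g : α → β → β'} {t : α} {x : β}
    (h : GoodAt c (fun q : α × β => (q.1, g q.1 q.2)) (t, x)) : GoodAt c (g t) x := by
  obtain ⟨h1, O, hO, h2⟩ := h
  have ct : Filter.Tendsto (fun y : β => (t, y)) (𝓝 x) (𝓝 (t, x)) :=
    (Continuous.prodMk_right t).continuousAt
  refine ⟨le_antisymm ?_ ?_, (fun y => (t, y)) ⁻¹' O, ct hO, ?_⟩
  · intro s hs
    have hs' : (univ : Set α) ×ˢ (g t ⁻¹' s) ∈ 𝓝 (t, x) := prod_mem_nhds Filter.univ_mem hs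
    have := Filter.image_mem_map (m := fun q : α × β => (q.1, g q.1 q.2)) hs'
    rw [← h1] at this
    have c2 : Filter.Tendsto (fun y : β' => (t, y)) (𝓝 (g t x)) (𝓝 (t, g t x)) :=
      (Continuous.prodMk_right t).continuousAt
    filter_upwards [c2 this] with y hy
    obtain ⟨⟨t', z⟩, ⟨-, hz⟩, e⟩ := hy
    simp only [Prod.mk.injEq] at e
    obtain ⟨rfl, rfl⟩ := e
    exact hz
  · have : ContinuousAt (fun q : α × β => (q.1, g q.1 q.2)) (t, x) := h1.ge
    exact (this.snd.tendsto.comp ct :)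
  · intro a ha b hb
    have := h2 _ ha _ hb
    simpa [Prod.dist_eq] using this

theorem good_isotopy {c : ℝ} (hc : 0 < c) {g : α → β → β'} (hf : ∀ t, Function.Injective (g t))
    (h : ∀ p, GoodAt c (fun q : α × β => (q.1, g q.1 q.2)) p) :
    IsLipschitzIsotopy (fun q : α × β => (q.1, g q.1 q.2)) := by
  have hi : Function.Injective (fun q : α × β => (q.1, g q.1 q.2)) := by
    rintro ⟨t, x⟩ ⟨t', x'⟩ e
    simp only [Prod.mk.injEq] at e
    obtain ⟨rfl, e⟩ := e
    rw [hf _ e]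
  exact ⟨good_openEmbedding hi h, fun _ => rfl, good_lip hc hi h⟩

theorem good_contAt {c : ℝ} {g : α → β → β'} {t : α} {x : β}
    (h : GoodAt c (fun q : α × β => (q.1, g q.1 q.2)) (t, x)) :
    ContinuousAt (fun q : α × β => g q.1 q.2) (t, x) := by
  have : ContinuousAt (fun q : α × β => (q.1, g q.1 q.2)) (t, x) := h.1.ge
  exact this.snd

theorem isom_prod {ι : α → α'} {ι' : β → β'} (h : Isometry ι) (h' : Isometry ι') :
    Isometry (Prod.map ι ι') := h.prodMap h'

end Good

theorem core_conn {N X : Type*} [MetricSpace N] [PreconnectedSpace N] [MetricSpace X] (b : N)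
    {f G : N → X → X} {c : ℝ} (V A : Set X) (hAV : A ⊆ V) (hA : IsClosed A)
    (hfi : ∀ t, InjOn (f t) V)
    (hf : ∀ t, ∀ x ∈ V, GoodAt c (fun q : N × X => (q.1, f q.1 q.2)) (t, x))
    (hG : ∀ p, GoodAt c (fun q : N × X => (q.1, G q.1 q.2)) p)
    (hGb : ∀ t, Function.Bijective (G t)) (hGid : ∀ x, G b x = x) (hfid : ∀ x ∈ V, f b x = x)
    (hfr : ∀ t, ∀ x ∈ frontier A, f t x = G t x)
    (W₁ W₂ : Set X) (h1 : IsOpen W₁) (h2 : IsOpen W₂) (hd : Disjoint W₁ W₂)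
    (hu : (frontier A)ᶜ ⊆ W₁ ∪ W₂) (y : X) (hy : y ∈ interior A) (hy1 : y ∈ W₁) (t : N) :
    f t y ∈ G t '' W₁ := by
  have hyV : y ∈ V := hAV (interior_subset hy)
  have hop : IsOpenMap (fun q : N × X => (q.1, G q.1 q.2)) :=
    IsOpenMap.of_nhds_le fun p => (hG p).1.le
  have hc : Continuous (fun s : N => (s, f s y)) := by
    rw [continuous_iff_continuousAt]
    intro s
    have h := good_contAt (hf s y hyV)
    exact continuousAt_id.prodMk
      (ContinuousAt.comp (f := fun s : N => (s, y)) h (Continuous.prodMk_left y).continuousAt)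
  have hopen : ∀ W : Set X, IsOpen W → IsOpen {s : N | f s y ∈ G s '' W} := by
    intro W hW
    have := (hop _ (isOpen_univ.prod hW)).preimage hc
    convert this using 1
    ext s
    simp only [mem_ofPred_eq, mem_preimage, mem_image, mem_prod, mem_univ, true_and, Prod.exists,
      Prod.mk.injEq]
    constructor
    · rintro ⟨x, hx, e⟩
      exact ⟨s, x, hx, rfl, e⟩
    · rintro ⟨_, x, hx, rfl, e⟩
      exact ⟨x, hx, e⟩
  have hcl : IsClopen {s : N | f s y ∈ G s '' W₁} := by
    refine ⟨?_, hopen _ h1⟩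
    rw [← isOpen_compl_iff]
    convert hopen _ h2 using 1
    ext s
    simp only [mem_compl_iff, mem_ofPred_eq]
    constructor
    · intro hn
      obtain ⟨z, hz⟩ := (hGb s).2 (f s y)
      have hzf : z ∉ frontier A := by
        intro hzf
        have hzA : z ∈ A := hA.frontier_subset hzf
        rw [← hfr s z hzf] at hz
        have := hfi s (hAV hzA) hyV hz
        subst this
        exact hzf.2 hy
      rcases hu hzf with h | h
      · exact absurd ⟨z, h, hz⟩ hn
      · exact ⟨z, h, hz⟩
    · rintro ⟨z, hz, e⟩ ⟨w, hw, e'⟩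
      have := (hGb s).1 (e.trans e'.symm)
      subst this
      exact disjoint_left.1 hd hw hz
  have := hcl.eq_univ ⟨b, y, hy1, by rw [hGid, hfid _ hyV]⟩
  have h3 : t ∈ {s : N | f s y ∈ G s '' W₁} := by rw [this]; trivial
  exact h3

theorem core {N X : Type*} [MetricSpace N] [PreconnectedSpace N] [MetricSpace X] (b : N)
    {f G : N → X → X} {c : ℝ} (V A : Set X) (hAV : A ⊆ V) (hA : IsClosed A)
    (hfi : ∀ t, InjOn (f t) V)
    (hf : ∀ t, ∀ x ∈ V, GoodAt c (fun q : N × X => (q.1, f q.1 q.2)) (t, x))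
    (hG : ∀ p, GoodAt c (fun q : N × X => (q.1, G q.1 q.2)) p)
    (hGb : ∀ t, Function.Bijective (G t)) (hGid : ∀ x, G b x = x) (hfid : ∀ x ∈ V, f b x = x)
    (hfr : ∀ t, ∀ x ∈ frontier A, f t x = G t x)
    (hcl : ∀ t, IsClosed (f t '' A)) (t : N) : f t '' A = G t '' A := by
  have hcov : ∀ x ∈ A, x ∈ interior A ∨ x ∈ frontier A := by
    intro x hx
    by_cases h : x ∈ interior A
    · exact .inl h
    · exact .inr ⟨subset_closure hx, h⟩
  have C := core_conn b V A hAV hA hfi hf hG hGb hGid hfid hfr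
  have hin : ∀ y ∈ interior A, f t y ∈ G t '' interior A := by
    intro y hy
    refine C (interior A) Aᶜ isOpen_interior hA.isOpen_compl ?_ ?_ y hy hy t
    · exact disjoint_compl_right.mono_left interior_subset
    · intro x hx
      by_cases h : x ∈ A
      · exact .inl ((hcov x h).resolve_right hx)
      · exact .inr h
  have hGc : Continuous (G t) :=
    continuous_iff_continuousAt.2 fun x => (good_slice (hG (t, x))).1.ge
  have hfo : IsOpen (f t '' interior A) := by
    rw [isOpen_iff_mem_nhds]
    rintro _ ⟨x, hx, rfl⟩
    rw [(good_slice (hf t x (hAV (interior_subset hx)))).1]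
    exact Filter.image_mem_map (isOpen_interior.mem_nhds hx)
  apply Subset.antisymm
  · rintro _ ⟨x, hx, rfl⟩
    rcases hcov x hx with h | h
    · exact image_mono interior_subset (hin x h)
    · exact ⟨x, hx, (hfr t x h).symm⟩
  · rintro _ ⟨y, hy, rfl⟩
    rcases hcov y hy with h | h
    swap
    · exact ⟨y, hy, hfr t y h⟩
    by_contra hn
    have hW2 : IsOpen (interior A ∩ G t ⁻¹' (f t '' interior A)) :=
      isOpen_interior.inter (hfo.preimage hGc)
    have hW1 : IsOpen ((interior A ∩ G t ⁻¹' (f t '' A)ᶜ) ∪ Aᶜ) :=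
      (isOpen_interior.inter ((hcl t).isOpen_compl.preimage hGc)).union hA.isOpen_compl
    have key := C _ _ hW1 hW2 ?_ ?_ y h (.inl ⟨h, hn⟩) t
    · obtain ⟨z, hz, e⟩ := key
      obtain ⟨w, hw, e'⟩ := hin y h
      have := (hGb t).1 (e.trans e'.symm)
      subst this
      rcases hz with hz | hz
      · exact hz.2 ⟨y, hy, e.symm⟩
      · exact hz (interior_subset hw)
    · rw [disjoint_left]
      rintro x (⟨hx, hx'⟩ | hx) ⟨hx2, hx3⟩
      · exact hx' (image_mono interior_subset hx3)
      · exact hx (interior_subset hx2)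
    · intro x hx
      by_cases hxA : x ∈ A
      · have hxi := (hcov x hxA).resolve_right hx
        by_cases h4 : G t x ∈ f t '' A
        · right
          refine ⟨hxi, ?_⟩
          obtain ⟨w, hw, e⟩ := h4
          rcases hcov w hw with h5 | h5
          · exact ⟨w, h5, e⟩
          · rw [hfr t w h5] at e
            exact absurd ((hGb t).1 e ▸ h5) hx
        · exact .inl (.inl ⟨hxi, h4⟩)
      · exact .inl (.inr hxA)

/-- **Isotopy extension with Lipschitz constant control** (Corollary 6.3).  Let `B` be a
locally connected metric space, `X` locally compact and locally connected, `V ⊆ X` open and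
`K ⊆ V` closed in `X` with compact boundary in `V`.  If `L′(V − K)` holds then there are
constants `C, M ≥ 1` depending only on `V − K` such that: for every family
`f t : V → X` (`t ∈ B`) of open Lipschitz embeddings inducing a locally `L`-bi-Lipschitz
Lipschitz isotopy with `f b` the inclusion and `f t '' K` closed for all `t`, there are a
neighbourhood `N` of `b` and a family of Lipschitz isomorphisms `F t : X → X` (`t ∈ N`)
inducing a Lipschitz isotopy that is locally `C L ^ M`-bi-Lipschitz, with `F t = f t`
near `K`. -/
theorem controlled_isotopy_extension
    {X : Type u} [MetricSpace X] [LocallyCompactSpace X] [LocallyConnectedSpace X]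
    (V : Set X) (hV : IsOpen V) (K : Set X) (hK : IsClosed K) (hKV : K ⊆ V)
    (hbd : IsCompact (frontier ((Subtype.val ⁻¹' K) : Set ↥V)))
    (hL : ControlledDeformationPrinciple.{u} ↥(V \ K)) :
    ∃ C M : ℝ, 1 ≤ C ∧ 1 ≤ M ∧
      ∀ (B : Type u) [MetricSpace B] [LocallyConnectedSpace B]
        (f : B → ↥V → X) (L : ℝ), 1 ≤ L → ∀ b : B,
        (∀ t, IsOpenLipschitzEmbedding (f t)) →
        IsLipschitzIsotopy (fun q : B × ↥V => (q.1, f q.1 q.2)) →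
        IsLocallyBiLipschitzWith L (fun q : B × ↥V => (q.1, f q.1 q.2)) →
        (∀ x : ↥V, f b x = (x : X)) →
        (∀ t, IsClosed (f t '' (Subtype.val ⁻¹' K))) →
        ∃ N ∈ 𝓝 b, ∃ F : ↥N → X → X,
          (∀ t, IsLipschitzIso (F t)) ∧
          IsLipschitzIsotopy (fun q : ↥N × X => (q.1, F q.1 q.2)) ∧
          IsLocallyBiLipschitzWith (C * L ^ M) (fun q : ↥N × X => (q.1, F q.1 q.2)) ∧
          ∃ O : Set X, IsOpen O ∧ K ⊆ O ∧ ∃ (hOV : O ⊆ V),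
            ∀ t : ↥N, ∀ x (hx : x ∈ O), F t x = f t ⟨x, hOV hx⟩ := by
  obtain ⟨Cc, M, hCc, hM, hD⟩ := hL
  refine ⟨Cc, M, hCc, hM, ?_⟩
  intro B _ _ f L hL1 b hfe hfiso hfL hfb hfK
  -- geometry
  have hE : IsOpen (V \ K) := hV.sdiff hK
  have hfrK : IsCompact (frontier K) := by
    have h1 := hbd.image continuous_subtype_val
    rw [← hV.isOpenMap_subtype_val.preimage_frontier_eq_frontier_preimage
      continuous_subtype_val, Subtype.image_preimage_coe,
      inter_eq_right.2 (hK.frontier_subset.trans hKV)] at h1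
    exact h1
  obtain ⟨P, hP, hP1, hP2⟩ := exists_compact_between hfrK hV (hK.frontier_subset.trans hKV)
  have hAcl : IsClosed (K ∪ P) := hK.union hP.isClosed
  set A : Set X := K ∪ P with hAdef
  have hAV : A ⊆ V := union_subset hKV hP2
  have hKA : K ⊆ interior A := by
    intro x hx
    by_cases h : x ∈ interior K
    · exact interior_mono subset_union_left h
    · exact interior_mono subset_union_right (hP1 ⟨subset_closure hx, h⟩)
  have hfrA : frontier A ⊆ V \ K := fun x hx =>
    ⟨hAV (hAcl.frontier_subset hx), fun h => hx.2 (hKA h)⟩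
  have hfrAc : IsCompact (frontier A) := by
    refine hP.of_isClosed_subset isClosed_frontier fun x hx => ?_
    exact (hAcl.frontier_subset hx).resolve_left (hfrA hx).2
  obtain ⟨C0, hC0, hC01, hC02⟩ := exists_compact_between hfrAc hE hfrA
  obtain ⟨C1, hC1, hC11, hC12⟩ := exists_compact_between hC0 hE hC02
  -- deformation data
  set U : Set ↥(V \ K) := Subtype.val ⁻¹' interior C1 with hU
  set C : Set ↥(V \ K) := Subtype.val ⁻¹' C0 with hC
  have hUo : IsOpen U := isOpen_interior.preimage continuous_subtype_val
  have hCc' : IsCompact C := by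
    rw [Subtype.isCompact_iff, hC, Subtype.image_preimage_coe, inter_eq_right.2 hC02]
    exact hC0
  have hCU : C ⊆ U := preimage_mono hC11
  obtain ⟨ND, hND, D, hDD, hctl⟩ := hD U hUo C hCc' hCU
  obtain ⟨-, hDid, hDp⟩ := hDD
  have hc0 : (0 : ℝ) < L := by linarith
  have hLc : L ≤ Cc * L ^ M := by
    have h1 : L ≤ L ^ M := by
      simpa using Real.rpow_le_rpow_of_exponent_le hL1 hM
    nlinarith
  have hc1 : 1 ≤ Cc * L ^ M := hL1.trans hLc
  -- extension of f to X
  classical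
  let f' : B → X → X := fun t x => if hx : x ∈ V then f t ⟨x, hx⟩ else x
  have f'e : ∀ t x (hx : x ∈ V), f' t x = f t ⟨x, hx⟩ := fun t x hx => dif_pos hx
  have hf'good : ∀ t, ∀ x ∈ V, GoodAt L (fun q : B × X => (q.1, f' q.1 q.2)) (t, x) := by
    intro t x hx
    refine (goodAt_iff (ι := Prod.map (id : B → B) (Subtype.val : ↥V → X)) (ι' := id)
      (IsOpenEmbedding.id.prodMap hV.isOpenEmbedding_subtypeVal)
      (isometry_id.prodMap isometry_subtype_coe) .id isometry_id ?_ (t, ⟨x, hx⟩)).1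
      (good_of_emb hfiso.1 hfL _)
    rintro ⟨s, y⟩
    simp [f'e _ _ y.2]
  have hf'inj : ∀ t, InjOn (f' t) V := by
    intro t x hx y hy e
    rw [f'e t x hx, f'e t y hy] at e
    exact congrArg Subtype.val ((hfe t).1.1 e)
  have hf'b : ∀ x ∈ V, f' b x = x := fun x hx => by rw [f'e b x hx, hfb]
  -- first neighbourhood
  have hN1 : ∀ᶠ t in 𝓝 b, ∀ x ∈ C1, f' t x ∈ V \ K := by
    refine hC1.eventually_forall_of_forall_eventually fun y hy => ?_
    refine (good_contAt (hf'good b y (hC12 hy).1)).eventually_mem (hE.mem_nhds ?_)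
    simp only [hf'b y (hC12 hy).1]
    exact hC12 hy
  obtain ⟨N1, hN1f, hN1o, hbN1⟩ := _root_.eventually_nhds_iff.1 hN1
  have hUC1 : ∀ x : ↥U, ((x : ↥(V \ K)) : X) ∈ C1 := fun x => interior_subset x.2
  let H : C(↥N1 × ↥U, ↥(V \ K)) :=
    ⟨fun q => ⟨f' q.1 q.2, hN1f q.1 q.1.2 _ (hUC1 q.2)⟩, by
      refine Continuous.subtype_mk ?_ _
      rw [continuous_iff_continuousAt]
      rintro ⟨t, x⟩
      have h1 := good_contAt (hf'good t x x.1.2.1)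
      exact ContinuousAt.comp (f := fun q : ↥N1 × ↥U => ((q.1 : B), ((q.2 : ↥(V \ K)) : X)))
        (x := (t, x)) (g := fun q : B × X => f' q.1 q.2) h1
        (Continuous.continuousAt (by fun_prop))⟩
  have hHv : ∀ t x, ((H.curry t x : ↥(V \ K)) : X) = f' t x := fun t x => rfl
  have hHb : H.curry ⟨b, hbN1⟩ = inclCM U := by
    ext x
    rw [hHv]
    exact hf'b _ x.1.2.1
  have hN2 : H.curry ⁻¹' ND ∈ 𝓝 (⟨b, hbN1⟩ : ↥N1) := by
    apply H.curry.continuous.continuousAt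
    rw [hHb]; exact hND
  have hN2' : Subtype.val '' (H.curry ⁻¹' ND) ∈ 𝓝 b :=
    hN1o.isOpenEmbedding_subtypeVal.image_mem_nhds.2 hN2
  obtain ⟨Nb, ⟨hNbo, hbNb, hNbc⟩, hNbs⟩ :=
    (LocallyConnectedSpace.open_connected_basis b).mem_iff.1 hN2'
  simp only [id] at hNbs
  have hNb1 : ∀ t : ↥Nb, (t : B) ∈ N1 := by
    intro t
    obtain ⟨s, -, e⟩ := hNbs t.2
    rw [← e]; exact s.2
  haveI : PreconnectedSpace ↥Nb := Subtype.preconnectedSpace hNbc.isPreconnected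
  let h : ↥Nb → C(↥U, ↥(V \ K)) := fun t => H.curry ⟨t, hNb1 t⟩
  have hhv : ∀ t x, ((h t x : ↥(V \ K)) : X) = f' t x := fun t x => rfl
  have hhN : ∀ t, h t ∈ ND := by
    intro t
    obtain ⟨s, hs, e⟩ := hNbs t.2
    have : s = ⟨t, hNb1 t⟩ := Subtype.ext e
    rw [this] at hs
    exact hs
  have hhb : h ⟨b, hbNb⟩ = inclCM U := hHb
  -- f on Nb
  have hvE := hE.isOpenEmbedding_subtypeVal
  have hfN : ∀ t : ↥Nb, ∀ x ∈ V, GoodAt L (fun q : ↥Nb × X => (q.1, f' q.1 q.2)) (t, x) := by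
    intro t x hx
    refine (goodAt_iff (ι := Prod.map (Subtype.val : ↥Nb → B) (id : X → X))
      (ι' := Prod.map (Subtype.val : ↥Nb → B) (id : X → X))
      (hNbo.isOpenEmbedding_subtypeVal.prodMap .id)
      (isometry_subtype_coe.prodMap isometry_id)
      (hNbo.isOpenEmbedding_subtypeVal.prodMap .id)
      (isometry_subtype_coe.prodMap isometry_id) ?_ (t, x)).2 (hf'good t x hx)
    rintro ⟨s, y⟩
    rfl
  have hhgood : ∀ p, GoodAt L (fun q : ↥Nb × ↥U => (q.1, h q.1 q.2)) p := by
    rintro ⟨t, x⟩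
    refine (goodAt_iff (ι := Prod.map (id : ↥Nb → ↥Nb) (fun x : ↥U => ((x : ↥(V \ K)) : X)))
      (ι' := Prod.map (id : ↥Nb → ↥Nb) (Subtype.val : ↥(V \ K) → X))
      (IsOpenEmbedding.id.prodMap (hvE.comp hUo.isOpenEmbedding_subtypeVal))
      (isometry_id.prodMap (isometry_subtype_coe.comp isometry_subtype_coe))
      (IsOpenEmbedding.id.prodMap hvE)
      (isometry_id.prodMap isometry_subtype_coe) ?_ (t, x)).2 (hfN t x x.1.2.1)
    rintro ⟨s, y⟩
    rfl
  have hhinj : ∀ t, Function.Injective (h t) := by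
    intro t x y e
    have e2 : f' t x = f' t y := congrArg Subtype.val e
    exact Subtype.ext (Subtype.ext (hf'inj t x.1.2.1 y.1.2.1 e2))
  have hhemb : ∀ t, IsOpenLipschitzEmbedding (⇑(h t) : ↥U → ↥(V \ K)) := by
    intro t
    have hg : ∀ x, GoodAt L (h t) x := fun x => good_slice (g := fun t x => h t x) (hhgood (t, x))
    exact ⟨good_lip hc0 (hhinj t) hg, (good_openEmbedding (hhinj t) hg).isOpen_range⟩
  obtain ⟨hDiso, hDL⟩ := (hctl ↥Nb h (fun t => ⟨hhN t, hhemb t⟩)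
    (good_isotopy (g := fun t x => h t x) hc0 hhinj hhgood) L hL1).1 (fun p => (hhgood p).2)
  -- G
  let G : ↥Nb → X → X := fun t x => if hx : x ∈ V \ K then (D (h t) ⟨x, hx⟩ : ↥(V \ K)) else x
  have Ge : ∀ t x (hx : x ∈ V \ K), G t x = (D (h t) ⟨x, hx⟩ : ↥(V \ K)) :=
    fun t x hx => dif_pos hx
  have Gn : ∀ t x, x ∉ V \ K → G t x = x := fun t x hx => dif_neg hx
  have GC1 : ∀ t x, x ∉ C1 → G t x = x := by
    intro t x hx
    by_cases hxE : x ∈ V \ K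
    · rw [Ge t x hxE, (hDp (h t) (hhN t) (hhemb t)).2.2]
      exact fun h => hx (interior_subset h)
    · exact Gn t x hxE
  have GC0 : ∀ t, ∀ x ∈ C0, G t x = f' t x := by
    intro t x hx
    rw [Ge t x (hC02 hx), (hDp (h t) (hhN t) (hhemb t)).2.1 ⟨⟨x, hC02 hx⟩, hC11 hx⟩ hx]
    rfl
  have hGbij : ∀ t, Function.Bijective (G t) := by
    intro t
    obtain ⟨⟨hi, -⟩, hs⟩ := (hDp (h t) (hhN t) (hhemb t)).1
    constructor
    · intro x y e
      by_cases hx : x ∈ V \ K <;> by_cases hy : y ∈ V \ K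
      · rw [Ge t x hx, Ge t y hy] at e
        exact congrArg Subtype.val (hi (Subtype.ext e))
      · rw [Ge t x hx, Gn t y hy] at e
        exact absurd (e ▸ Subtype.coe_prop _) hy
      · rw [Gn t x hx, Ge t y hy] at e
        exact absurd (e ▸ Subtype.coe_prop _) hx
      · rwa [Gn t x hx, Gn t y hy] at e
    · intro y
      by_cases hy : y ∈ V \ K
      · obtain ⟨x, hx⟩ := hs ⟨y, hy⟩
        exact ⟨x, by rw [Ge t x x.2]; exact congrArg Subtype.val hx⟩
      · exact ⟨y, Gn t y hy⟩
  have hGid : ∀ x, G ⟨b, hbNb⟩ x = x := by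
    intro x
    by_cases hx : x ∈ V \ K
    · rw [Ge _ x hx, hhb, hDid]; rfl
    · exact Gn _ x hx
  have hidgood : ∀ p, GoodAt (Cc * L ^ M) (fun q : ↥Nb × X => (q.1, q.2)) p := fun p =>
    (goodAt_id p).mono one_pos hc1
  have near : ∀ (t : ↥Nb) (x : X) (O : Set X), IsOpen O → x ∈ O → ∀ g₁ g₂ : ↥Nb → X → X,
      (∀ t, ∀ x ∈ O, g₁ t x = g₂ t x) →
      (fun q : ↥Nb × X => (q.1, g₁ q.1 q.2)) =ᶠ[𝓝 (t, x)] (fun q => (q.1, g₂ q.1 q.2)) := by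
    intro t x O hO hx g₁ g₂ e
    filter_upwards [(hO.preimage continuous_snd).mem_nhds (show (t, x) ∈ Prod.snd ⁻¹' O from hx)]
      with q hq
    rw [e _ _ hq]
  have hGgood : ∀ p, GoodAt (Cc * L ^ M) (fun q : ↥Nb × X => (q.1, G q.1 q.2)) p := by
    rintro ⟨t, x⟩
    by_cases hx : x ∈ V \ K
    · refine (goodAt_iff (ι := Prod.map (id : ↥Nb → ↥Nb) (Subtype.val : ↥(V \ K) → X))
        (ι' := Prod.map (id : ↥Nb → ↥Nb) (Subtype.val : ↥(V \ K) → X))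
        (IsOpenEmbedding.id.prodMap hvE)
        (isometry_id.prodMap isometry_subtype_coe)
        (IsOpenEmbedding.id.prodMap hvE)
        (isometry_id.prodMap isometry_subtype_coe) ?_ (t, ⟨x, hx⟩)).1 (good_of_emb hDiso.1 hDL _)
      rintro ⟨s, y⟩
      simp [Ge _ _ y.2]
    · exact (hidgood _).congr (near t x C1ᶜ hC1.isClosed.isOpen_compl (fun h => hx (hC12 h))
        G (fun _ x => x) GC1)
  have hfNg : ∀ t : ↥Nb, ∀ x ∈ V,
      GoodAt (Cc * L ^ M) (fun q : ↥Nb × X => (q.1, f' q.1 q.2)) (t, x) :=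
    fun t x hx => (hfN t x hx).mono hc0 hLc
  have hclA : ∀ t : ↥Nb, IsClosed (f' t '' A) := by
    intro t
    rw [hAdef, image_union]
    refine IsClosed.union ?_ (IsCompact.isClosed (hP.image_of_continuousOn ?_))
    · convert hfK t using 1
      ext y
      constructor
      · rintro ⟨x, hx, rfl⟩
        exact ⟨⟨x, hKV hx⟩, hx, (f'e t x (hKV hx)).symm⟩
      · rintro ⟨x, hx, rfl⟩
        exact ⟨x, hx, f'e t x x.2⟩
    · intro x hx
      have h1 := good_slice (g := fun (t : ↥Nb) x => f' t x) (hfN t x (hP2 hx))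
      have h2 : ContinuousAt (f' t) x := h1.1.ge
      exact h2.continuousWithinAt
  have himg := core (N := ↥Nb) ⟨b, hbNb⟩ (f := fun t x => f' t x) (G := G) V A hAV hAcl
    (fun t => hf'inj t) hfNg hGgood hGbij hGid hf'b
    (fun t x hx => (GC0 t x (interior_subset (hC01 hx))).symm) hclA
  -- F
  let F : ↥Nb → X → X := fun t x => if x ∈ A then f' t x else G t x
  have FA : ∀ t, ∀ x ∈ A, F t x = f' t x := fun t x hx => if_pos hx
  have FnA : ∀ t, ∀ x, x ∉ A → F t x = G t x := fun t x hx => if_neg hx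
  have FC0 : ∀ t, ∀ x ∈ C0, F t x = f' t x := by
    intro t x hx
    by_cases h : x ∈ A
    · exact FA t x h
    · rw [FnA t x h, GC0 t x hx]
  have hFinj : ∀ t, Function.Injective (F t) := by
    have aux : ∀ t, ∀ x ∈ A, ∀ y, y ∉ A → F t x ≠ F t y := by
      intro t x hx y hy e
      rw [FA t x hx, FnA t y hy] at e
      have : f' t x ∈ G t '' A := by rw [← himg t]; exact ⟨x, hx, rfl⟩
      obtain ⟨z, hz, e2⟩ := this
      exact hy ((hGbij t).1 (e2.trans e) ▸ hz)
    intro t x y e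
    by_cases hx : x ∈ A <;> by_cases hy : y ∈ A
    · rw [FA t x hx, FA t y hy] at e
      exact hf'inj t (hAV hx) (hAV hy) e
    · exact absurd e (aux t x hx y hy)
    · exact absurd e.symm (aux t y hy x hx)
    · rw [FnA t x hx, FnA t y hy] at e
      exact (hGbij t).1 e
  have hFsurj : ∀ t, Function.Surjective (F t) := by
    intro t z
    obtain ⟨y, rfl⟩ := (hGbij t).2 z
    by_cases hy : y ∈ A
    · have : G t y ∈ G t '' A := ⟨y, hy, rfl⟩
      rw [← himg t] at this
      obtain ⟨x, hx, e⟩ := this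
      exact ⟨x, (FA t x hx).trans e⟩
    · exact ⟨y, FnA t y hy⟩
  have hFgood : ∀ p, GoodAt (Cc * L ^ M) (fun q : ↥Nb × X => (q.1, F q.1 q.2)) p := by
    rintro ⟨t, x⟩
    by_cases hx : x ∈ A
    · refine (hfNg t x (hAV hx)).congr ?_
      by_cases hxi : x ∈ interior A
      · exact near t x (interior A) isOpen_interior hxi F (fun t x => f' t x)
          (fun t x hx => FA t x (interior_subset hx))
      · exact near t x (interior C0) isOpen_interior (hC01 ⟨subset_closure hx, hxi⟩) F
          (fun t x => f' t x) (fun t x hx => FC0 t x (interior_subset hx))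
    · exact (hGgood (t, x)).congr (near t x Aᶜ hAcl.isOpen_compl hx F G FnA)
  have hcpos : 0 < Cc * L ^ M := by linarith
  refine ⟨Nb, hNbo.mem_nhds hbNb, F, ?_, good_isotopy hcpos hFinj hFgood,
    fun p => (hFgood p).2, interior A, isOpen_interior, hKA, interior_subset.trans hAV, ?_⟩
  · intro t
    exact ⟨good_lip hcpos (hFinj t) fun x => good_slice (hFgood (t, x)), hFsurj t⟩
  · intro t x hx
    rw [FA t x (interior_subset hx), f'e]
end
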